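/- Let p be a prime, q = p^m a prime power, and n a natural number such that either n ≥ 5, or n = 4 and q is prime, or n = 4 and q is even. Let L = PSL_n(q) be the projective special linear group. If K is a field of characteristic p, W is a nonzero K-vector space, and L acts on W by K-linear automorphisms, then the set of element orders of the semidirect product W ⋊ L (with W viewed as an abelian group under addition) is not equal to the set of element orders of L. -/

import Mathlib

open Matrix

/-- The spectrum of a group: the set of orders of its elements. -/
def groupSpectrum (G : Type*) [Group G] : Set ℕ := {k | ∃ g : G, orderOf g = k}

/-- The group of `K`-linear automorphisms of `W`, mapped as a monoid homomorphism into
the multiplicative automorphisms of the (multiplicatively written) additive group of `W`. -/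
def linearToMulAut (K W : Type*) [Semiring K] [AddCommGroup W] [Module K W] :
    (W ≃ₗ[K] W) →* MulAut (Multiplicative W) where
  toFun e :=
    { toFun := fun w => Multiplicative.ofAdd (e w.toAdd)
      invFun := fun w => Multiplicative.ofAdd (e.symm w.toAdd)
      left_inv := fun w => by simp
      right_inv := fun w => by simp
      map_mul' := fun a b => e.map_add a.toAdd b.toAdd }
  map_one' := rfl
  map_mul' := fun _ _ => rfl

namespace PSLSpec

open Matrix.SpecialLinearGroup

section Embedding

variable {ι R : Type*} [Fintype ι] [DecidableEq ι] [CommRing R]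

/-- The embedding of `2 × 2` matrices in the block of rows and columns `i`, `j`. -/
def blockEmb (i j : ι) (A : Matrix (Fin 2) (Fin 2) R) : Matrix ι ι R :=
  1 + (single i i (A 0 0 - 1) + single i j (A 0 1) + single j i (A 1 0) + single j j (A 1 1 - 1))

theorem blockEmb_mul {i j : ι} (hij : i ≠ j) (A B : Matrix (Fin 2) (Fin 2) R) :
    blockEmb i j (A * B) = blockEmb i j A * blockEmb i j B := by
  have hji := hij.symm
  simp only [blockEmb, mul_add, add_mul, one_mul, mul_one, single_mul_single_same,
    single_mul_single_of_ne _ _ _ _ hij, single_mul_single_of_ne _ _ _ _ hji, Matrix.mul_apply,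
    Fin.sum_univ_two]
  ext a b
  simp only [Matrix.add_apply, Matrix.single_apply, Matrix.zero_apply]
  split_ifs <;> first | (exfalso; grind) | ring

theorem coe_transvection_eq_blockEmb {i j : ι} (hij : i ≠ j) (t : R) :
    (transvection hij t : Matrix ι ι R) = blockEmb i j !![1, t; 0, 1] := by
  simp [transvection_coe, blockEmb]

theorem coe_transvection_symm_eq_blockEmb {i j : ι} (hij : i ≠ j) (t : R) :
    (transvection hij.symm t : Matrix ι ι R) = blockEmb i j !![1, 0; t, 1] := by
  simp [transvection_coe, blockEmb]

theorem blockEmb_one (i j : ι) : blockEmb i j (1 : Matrix (Fin 2) (Fin 2) R) = 1 := by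
  simp [blockEmb]

/-- The standard representative of the reflection exchanging `i` and `j`. -/
def weyl {i j : ι} (hij : i ≠ j) : Matrix.SpecialLinearGroup ι R :=
  transvection hij 1 * transvection hij.symm (-1) * transvection hij 1

theorem coe_weyl {i j : ι} (hij : i ≠ j) :
    ((weyl hij : Matrix.SpecialLinearGroup ι R) : Matrix ι ι R) = blockEmb i j !![0, 1; -1, 0] := by
  simp only [weyl, Matrix.SpecialLinearGroup.coe_mul, coe_transvection_eq_blockEmb hij,
    coe_transvection_symm_eq_blockEmb hij, ← blockEmb_mul hij]
  congr 1
  simp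

theorem transvection_eq_conj {i j : ι} (hij : i ≠ j) (t : R) :
    transvection hij t * weyl hij = weyl hij * transvection hij.symm (-t) := by
  apply Subtype.ext
  simp only [Matrix.SpecialLinearGroup.coe_mul, coe_transvection_eq_blockEmb hij, coe_weyl,
    coe_transvection_symm_eq_blockEmb hij, ← blockEmb_mul hij]
  congr 1
  simp

end Embedding

section Field

variable {ι F : Type*} [Fintype ι] [DecidableEq ι] [Field F]

theorem coe_diag2n_eq_blockEmb {i j : ι} (hij : i ≠ j) {a : F} (ha : a ≠ 0) :
    (diag2n hij a ha : Matrix ι ι F) = blockEmb i j !![a, 0; 0, a⁻¹] := by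
  rw [diag2n_coe, blockEmb]
  ext k l
  simp only [diagonal_apply, Matrix.add_apply, Matrix.single_apply, Matrix.one_apply]
  simp
  grind

theorem transvection_mul_weyl {i j : ι} (hij : i ≠ j) {t : F} (ht : t ≠ 0) :
    transvection hij t * weyl hij =
      transvection hij.symm t⁻¹ * diag2n hij (-t) (neg_ne_zero.2 ht) * transvection hij (-t⁻¹) := by
  apply Subtype.ext
  simp only [Matrix.SpecialLinearGroup.coe_mul, coe_transvection_eq_blockEmb hij, coe_weyl,
    coe_transvection_symm_eq_blockEmb hij, ← blockEmb_mul hij, coe_diag2n_eq_blockEmb hij]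
  congr 1
  simp [ht, inv_neg]

theorem weyl_mul_transvection_symm {i j : ι} (hij : i ≠ j) {t : F} (ht : t ≠ 0) :
    weyl hij * transvection hij.symm t =
      transvection hij.symm (-t⁻¹) * diag2n hij t ht * transvection hij t⁻¹ := by
  apply Subtype.ext
  simp only [Matrix.SpecialLinearGroup.coe_mul, coe_transvection_eq_blockEmb hij, coe_weyl,
    coe_transvection_symm_eq_blockEmb hij, ← blockEmb_mul hij, coe_diag2n_eq_blockEmb hij]
  congr 1
  simp [ht]

theorem weyl_mul_transvection_mul_weyl {i j : ι} (hij : i ≠ j) {t : F} (ht : t ≠ 0) :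
    weyl hij * transvection hij t * weyl hij =
      transvection hij (-t⁻¹) * weyl hij * diag2n hij (-t) (neg_ne_zero.2 ht) *
        transvection hij (-t⁻¹) := by
  apply Subtype.ext
  simp only [Matrix.SpecialLinearGroup.coe_mul, coe_transvection_eq_blockEmb hij, coe_weyl,
    coe_transvection_symm_eq_blockEmb hij, ← blockEmb_mul hij, coe_diag2n_eq_blockEmb hij]
  congr 1
  simp [ht]

theorem weyl_mul_weyl {i j : ι} (hij : i ≠ j) :
    weyl hij * weyl hij = diag2n hij (-1 : F) (neg_ne_zero.2 one_ne_zero) := by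
  apply Subtype.ext
  simp only [Matrix.SpecialLinearGroup.coe_mul, coe_weyl, ← blockEmb_mul hij, coe_diag2n_eq_blockEmb hij]
  congr 1
  simp [inv_neg]

theorem diag2n_mul_weyl {i j : ι} (hij : i ≠ j) {a : F} (ha : a ≠ 0) :
    diag2n hij a ha * weyl hij =
      transvection hij a * transvection hij.symm (-a⁻¹) * transvection hij a := by
  apply Subtype.ext
  simp only [Matrix.SpecialLinearGroup.coe_mul, coe_transvection_eq_blockEmb hij, coe_weyl,
    coe_transvection_symm_eq_blockEmb hij, ← blockEmb_mul hij, coe_diag2n_eq_blockEmb hij]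
  congr 1
  simp [ha]

/-- A subgroup containing all transvections is everything. -/
theorem eq_top_of_transvection_mem [Nontrivial ι] (H : Subgroup (Matrix.SpecialLinearGroup ι F))
    (h : ∀ (i j : ι) (hij : i ≠ j) (a : F), transvection hij a ∈ H) : H = ⊤ := by
  refine (Subgroup.eq_top_iff' H).2 fun M => ?_
  refine diagonal_transvection_induction' (fun g => g ∈ H) M ?_ h (fun _ _ => H.mul_mem)
  intro i j hij c hc
  have hw : (weyl hij : Matrix.SpecialLinearGroup ι F) ∈ H :=
    H.mul_mem (H.mul_mem (h _ _ _ _) (h _ _ _ _)) (h _ _ _ _)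
  refine (H.mul_mem_cancel_right hw).1 ?_
  rw [diag2n_mul_weyl]
  exact H.mul_mem (H.mul_mem (h _ _ _ _) (h _ _ _ _)) (h _ _ _ _)

/-- The commutator of two transvections. -/
theorem transvection_mul_transvection {i j k : ι} (hij : i ≠ j) (hjk : j ≠ k) (hik : i ≠ k)
    (a b : F) :
    transvection hij a * transvection hjk b =
      transvection hik (a * b) * (transvection hjk b * transvection hij a) := by
  apply Subtype.ext
  simp only [Matrix.SpecialLinearGroup.coe_mul, transvection_coe, mul_add, add_mul, one_mul, mul_one,
    single_mul_single_same, single_mul_single_of_ne _ _ _ _ hij,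
    single_mul_single_of_ne _ _ _ _ hjk, single_mul_single_of_ne _ _ _ _ hik,
    single_mul_single_of_ne _ _ _ _ hij.symm, single_mul_single_of_ne _ _ _ _ hjk.symm,
    single_mul_single_of_ne _ _ _ _ hik.symm, mul_zero, add_zero]
  abel

theorem transvection_commute {i j k l : ι} (hij : i ≠ j) (hkl : k ≠ l) (hjk : j ≠ k) (hil : i ≠ l)
    (a b : F) : Commute (transvection hij a) (transvection hkl b) := by
  apply Subtype.ext
  simp only [Matrix.SpecialLinearGroup.coe_mul, transvection_coe, mul_add, add_mul, one_mul, mul_one,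
    single_mul_single_same, single_mul_single_of_ne _ _ _ _ hjk,
    single_mul_single_of_ne _ _ _ _ hil.symm]
  abel

end Field

section Simple

variable {N : ℕ} {R : Type*} [CommRing R]

theorem castSucc_ne_succ (k : Fin N) : k.castSucc ≠ k.succ := Fin.castSucc_lt_succ.ne

/-- The simple positive root element. -/
def sx (k : Fin N) (t : R) : Matrix.SpecialLinearGroup (Fin (N + 1)) R :=
  transvection (castSucc_ne_succ k) t

/-- The simple negative root element. -/
def sy (k : Fin N) (t : R) : Matrix.SpecialLinearGroup (Fin (N + 1)) R :=
  transvection (castSucc_ne_succ k).symm t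

/-- The representative of a simple reflection. -/
def sn (R : Type*) [CommRing R] (k : Fin N) : Matrix.SpecialLinearGroup (Fin (N + 1)) R :=
  weyl (castSucc_ne_succ k)

theorem sx_add (k : Fin N) (s t : R) : sx k (s + t) = sx k s * sx k t := transvection_add _ _ _
theorem sy_add (k : Fin N) (s t : R) : sy k (s + t) = sy k s * sy k t := transvection_add _ _ _
@[simp] theorem sx_zero (k : Fin N) : sx k (0 : R) = 1 := transvection_coeff_zero _
@[simp] theorem sy_zero (k : Fin N) : sy k (0 : R) = 1 := transvection_coeff_zero _
theorem sx_inv (k : Fin N) (t : R) : (sx k t)⁻¹ = sx k (-t) := transvection_inv _ _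
theorem sn_eq (k : Fin N) : sn R k = sx k 1 * sy k (-1) * sx k 1 := rfl
theorem sx_mul_sn (k : Fin N) (t : R) : sx k t * sn R k = sn R k * sy k (-t) :=
  transvection_eq_conj _ _

end Simple

section Field

variable {N : ℕ} {F : Type*} [Field F]

/-- The simple coroot element. -/
noncomputable def sh (k : Fin N) (t : Fˣ) : Matrix.SpecialLinearGroup (Fin (N + 1)) F :=
  diag2n (castSucc_ne_succ k) (t : F) t.ne_zero

theorem sx_mul_sn' (k : Fin N) (t : Fˣ) :
    sx k (t : F) * sn F k = sy k (t : F)⁻¹ * sh k (-t) * sx k (-(t : F)⁻¹) := by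
  have := transvection_mul_weyl (castSucc_ne_succ k) t.ne_zero
  simpa [sx, sn, sy, sh] using this

theorem sn_mul_sy (k : Fin N) (t : Fˣ) :
    sn F k * sy k (t : F) = sy k (-(t : F)⁻¹) * sh k t * sx k (t : F)⁻¹ :=
  weyl_mul_transvection_symm (castSucc_ne_succ k) t.ne_zero

theorem sn_mul_sx_mul_sn (k : Fin N) (t : Fˣ) :
    sn F k * sx k (t : F) * sn F k = sx k (-(t : F)⁻¹) * sn F k * sh k (-t) * sx k (-(t : F)⁻¹) := by
  have := weyl_mul_transvection_mul_weyl (castSucc_ne_succ k) t.ne_zero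
  simpa [sx, sn, sy, sh] using this

theorem sn_mul_sn (k : Fin N) : sn F k * sn F k = sh k (-1) := by
  have := weyl_mul_weyl (F := F) (castSucc_ne_succ k)
  simpa [sx, sn, sy, sh] using this

theorem transvection_mem_of_sx_mem (H : Subgroup (Matrix.SpecialLinearGroup (Fin (N + 1)) F))
    (h : ∀ k t, sx k t ∈ H) {i j : Fin (N + 1)} (hij : i < j) (a : F) :
    transvection hij.ne a ∈ H := by
  obtain ⟨d, hd⟩ : ∃ d, j.val = i.val + d + 1 := ⟨j.val - i.val - 1, by
    have : i.val < j.val := hij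
    omega⟩
  induction d generalizing j a with
  | zero =>
    have hiN : i.val < N := by omega
    obtain ⟨k, rfl⟩ : ∃ k : Fin N, i = k.castSucc := ⟨⟨i, hiN⟩, rfl⟩
    obtain rfl : j = k.succ := Fin.ext (by simpa using hd)
    exact h k a
  | succ d ih =>
    have hmN : i.val + d + 1 < N := by omega
    set m : Fin N := ⟨i.val + d + 1, hmN⟩ with hm
    have him : i < m.castSucc := by
      rw [Fin.lt_def]; simp [hm]
    obtain rfl : j = m.succ := Fin.ext (by simp [hm]; omega)
    have h1 := ih him a (by simp [hm])
    have h2 := h m 1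
    have h3 := transvection_mul_transvection him.ne (castSucc_ne_succ m) hij.ne a 1
    rw [mul_one] at h3
    rw [← mul_inv_eq_iff_eq_mul] at h3
    rw [← h3]
    exact H.mul_mem (H.mul_mem h1 h2) (H.inv_mem (H.mul_mem h2 h1))

theorem transvection_mem_of_sy_mem (H : Subgroup (Matrix.SpecialLinearGroup (Fin (N + 1)) F))
    (h : ∀ k t, sy k t ∈ H) {i j : Fin (N + 1)} (hij : i < j) (a : F) :
    transvection hij.ne' a ∈ H := by
  obtain ⟨d, hd⟩ : ∃ d, j.val = i.val + d + 1 := ⟨j.val - i.val - 1, by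
    have : i.val < j.val := hij
    omega⟩
  induction d generalizing j a with
  | zero =>
    have hiN : i.val < N := by omega
    obtain ⟨k, rfl⟩ : ∃ k : Fin N, i = k.castSucc := ⟨⟨i, hiN⟩, rfl⟩
    obtain rfl : j = k.succ := Fin.ext (by simpa using hd)
    exact h k a
  | succ d ih =>
    have hmN : i.val + d + 1 < N := by omega
    set m : Fin N := ⟨i.val + d + 1, hmN⟩ with hm
    have him : i < m.castSucc := by
      rw [Fin.lt_def]; simp [hm]
    obtain rfl : j = m.succ := Fin.ext (by simp [hm]; omega)
    have h1 := ih him a (by simp [hm])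
    have h2 := h m 1
    have h3 := transvection_mul_transvection (castSucc_ne_succ m).symm him.ne' hij.ne' 1 a
    rw [one_mul] at h3
    rw [← mul_inv_eq_iff_eq_mul] at h3
    rw [← h3]
    exact H.mul_mem (H.mul_mem h2 h1) (H.inv_mem (H.mul_mem h1 h2))

theorem eq_top_of_simple_mem (hN : 0 < N)
    (H : Subgroup (Matrix.SpecialLinearGroup (Fin (N + 1)) F))
    (hx : ∀ k t, sx k t ∈ H) (hy : ∀ k t, sy k t ∈ H) : H = ⊤ := by
  have : Nontrivial (Fin (N + 1)) := Fin.nontrivial_iff_two_le.2 (by omega)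
  refine eq_top_of_transvection_mem H fun i j hij a => ?_
  rcases lt_or_gt_of_ne hij with h | h
  · exact transvection_mem_of_sx_mem H hx h a
  · exact transvection_mem_of_sy_mem H hy h a

end Field

section Unitriangular

variable {n : ℕ} {R : Type*} [CommRing R]

/-- Upper unitriangular matrices. -/
def IsUni (M : Matrix (Fin n) (Fin n) R) : Prop :=
  ∀ i j, j ≤ i → M i j = (1 : Matrix (Fin n) (Fin n) R) i j

theorem IsUni.apply_self {M : Matrix (Fin n) (Fin n) R} (h : IsUni M) (i : Fin n) : M i i = 1 := by
  simpa using h i i le_rfl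

theorem IsUni.apply_lt {M : Matrix (Fin n) (Fin n) R} (h : IsUni M) {i j : Fin n} (hij : j < i) :
    M i j = 0 := by
  simpa [hij.ne'] using h i j hij.le

theorem IsUni.mul {A B : Matrix (Fin n) (Fin n) R} (hA : IsUni A) (hB : IsUni B) :
    IsUni (A * B) := by
  intro i j hij
  rw [Matrix.mul_apply, Finset.sum_eq_single i]
  · rw [hA.apply_self, one_mul, hB i j hij]
  · intro l _ hl
    rcases lt_or_gt_of_ne hl with h | h
    · rw [hA.apply_lt h, zero_mul]
    · rw [hB.apply_lt (hij.trans_lt h), mul_zero]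
  · simp

theorem IsUni.of_mul_left {A B : Matrix (Fin n) (Fin n) R} (hA : IsUni A) (hAB : IsUni (A * B)) :
    IsUni B := by
  have key : ∀ d : ℕ, ∀ i j : Fin n, n - i.val = d → j ≤ i →
      B i j = (1 : Matrix (Fin n) (Fin n) R) i j := by
    intro d
    induction d using Nat.strong_induction_on with
    | _ d ih =>
      intro i j hd hij
      rw [← hAB i j hij, Matrix.mul_apply, Finset.sum_eq_single i]
      · rw [hA.apply_self, one_mul]
      · intro l _ hl
        rcases lt_or_gt_of_ne hl with h | h
        · rw [hA.apply_lt h, zero_mul]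
        · have h' : i.val < l.val := h
          rw [ih (n - l.val) (by omega) l j rfl (hij.trans h.le),
            Matrix.one_apply_ne (hij.trans_lt h).ne', mul_zero]
      · simp
  exact fun i j hij => key _ i j rfl hij

/-- The group of upper unitriangular matrices. -/
def upperU (n : ℕ) (R : Type*) [CommRing R] : Subgroup (Matrix.SpecialLinearGroup (Fin n) R) where
  carrier := {g | IsUni (g : Matrix (Fin n) (Fin n) R)}
  one_mem' := fun i j _ => rfl
  mul_mem' {a b} ha hb := by
    simp only [Set.mem_ofPred_eq, Matrix.SpecialLinearGroup.coe_mul] at *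
    exact ha.mul hb
  inv_mem' {a} ha := by
    refine IsUni.of_mul_left (A := (a : Matrix (Fin n) (Fin n) R)) ha ?_
    rw [← Matrix.SpecialLinearGroup.coe_mul, mul_inv_cancel]
    exact fun i j _ => rfl

/-- The group of lower unitriangular matrices. -/
def lowerU (n : ℕ) (R : Type*) [CommRing R] : Subgroup (Matrix.SpecialLinearGroup (Fin n) R) where
  carrier := {g | IsUni (g : Matrix (Fin n) (Fin n) R)ᵀ}
  one_mem' := by
    rw [Set.mem_ofPred_eq, Matrix.SpecialLinearGroup.coe_one, Matrix.transpose_one]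
    exact fun i j _ => rfl
  mul_mem' {a b} ha hb := by
    simp only [Set.mem_ofPred_eq, Matrix.SpecialLinearGroup.coe_mul, Matrix.transpose_mul] at *
    exact hb.mul ha
  inv_mem' {a} ha := by
    refine IsUni.of_mul_left (A := (a : Matrix (Fin n) (Fin n) R)ᵀ) ha ?_
    rw [← Matrix.transpose_mul, ← Matrix.SpecialLinearGroup.coe_mul, inv_mul_cancel,
      Matrix.SpecialLinearGroup.coe_one, Matrix.transpose_one]
    exact fun i j _ => rfl

theorem IsUni.sub_one_pow_apply {M : Matrix (Fin n) (Fin n) R} (h : IsUni M) (k : ℕ) (i j : Fin n)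
    (hij : j.val < i.val + k) : ((M - 1) ^ k) i j = 0 := by
  induction k generalizing i j with
  | zero =>
    have : j < i := by simpa using hij
    simp [this.ne']
  | succ k ih =>
    rw [pow_succ', Matrix.mul_apply]
    refine Finset.sum_eq_zero fun l _ => ?_
    rcases le_or_gt l i with hl | hl
    · rw [Matrix.sub_apply, h i l hl, sub_self, zero_mul]
    · have : i.val < l.val := hl
      rw [ih l j (by omega), mul_zero]

theorem IsUni.pow_eq_one {p : ℕ} [Fact p.Prime] [CharP R p] {M : Matrix (Fin n) (Fin n) R}
    (h : IsUni M) : M ^ p ^ n = 1 := by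
  rcases Nat.eq_zero_or_pos n with rfl | hn
  · exact Subsingleton.elim _ _
  have : Nonempty (Fin n) := ⟨⟨0, hn⟩⟩
  have h0 : (M - 1) ^ n = 0 := by
    ext i j
    exact h.sub_one_pow_apply n i j (by omega)
  have h1 : (M - 1) ^ p ^ n = 0 :=
    pow_eq_zero_of_le (Nat.lt_pow_self (Fact.out : p.Prime).one_lt).le h0
  rw [sub_pow_char_pow_of_commute (p := p) (h := Commute.one_right M), one_pow, sub_eq_zero] at h1
  exact h1

theorem isPGroup_upperU (p : ℕ) [Fact p.Prime] [CharP R p] : IsPGroup p (upperU n R) := by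
  rintro ⟨g, hg⟩
  refine ⟨n, Subtype.ext (Subtype.ext ?_)⟩
  exact (Matrix.SpecialLinearGroup.coe_pow g _).trans (IsUni.pow_eq_one hg)

theorem isPGroup_lowerU (p : ℕ) [Fact p.Prime] [CharP R p] : IsPGroup p (lowerU n R) := by
  rintro ⟨g, hg⟩
  refine ⟨n, Subtype.ext (Subtype.ext ?_)⟩
  refine (Matrix.SpecialLinearGroup.coe_pow g _).trans (Matrix.transpose_injective ?_)
  rw [Matrix.transpose_pow, IsUni.pow_eq_one hg]
  exact Matrix.transpose_one.symm

end Unitriangular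

section Simple

variable {N : ℕ} {R : Type*} [CommRing R]

theorem sx_mem_upperU (k : Fin N) (t : R) : sx k t ∈ upperU (N + 1) R := by
  intro i j hij
  rw [sx, transvection_coe, Matrix.add_apply, Matrix.single_apply, if_neg, add_zero]
  rintro ⟨rfl, rfl⟩
  exact absurd hij (not_le.2 Fin.castSucc_lt_succ)

theorem sy_mem_lowerU (k : Fin N) (t : R) : sy k t ∈ lowerU (N + 1) R := by
  intro i j hij
  rw [sy, transvection_coe, Matrix.transpose_apply, Matrix.add_apply, Matrix.single_apply, if_neg,
    add_zero, Matrix.one_apply, Matrix.one_apply]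
  · simp [eq_comm]
  · rintro ⟨rfl, rfl⟩
    exact absurd hij (not_le.2 Fin.castSucc_lt_succ)

/-- The simple transposition. -/
def sw (k : Fin N) : Equiv.Perm (Fin (N + 1)) := Equiv.swap k.castSucc k.succ

/-- The signs occurring in the representative of a simple reflection. -/
def sgn (R : Type*) [CommRing R] (k : Fin N) (j : Fin (N + 1)) : R :=
  if j = k.castSucc then -1 else 1

theorem sgn_mul_self (k : Fin N) (j : Fin (N + 1)) : sgn R k j * sgn R k j = 1 := by
  unfold sgn; split_ifs <;> simp

theorem coe_sn_apply (k : Fin N) (i j : Fin (N + 1)) :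
    (sn R k : Matrix (Fin (N + 1)) (Fin (N + 1)) R) i j =
      if i = sw k j then sgn R k j else 0 := by
  have hne := castSucc_ne_succ k
  have hne' := hne.symm
  rw [sn, coe_weyl]
  simp only [blockEmb, sgn, Matrix.add_apply, Matrix.single_apply, Matrix.one_apply]
  by_cases hj : j = k.castSucc
  · subst hj
    have hs : sw k k.castSucc = k.succ := Equiv.swap_apply_left _ _
    simp only [hs]
    by_cases hi : i = k.castSucc
    · subst hi; simp [hne, hne']
    · by_cases hi' : i = k.succ
      · subst hi'; simp [hne, hne']
      · simp [hi, hi', Ne.symm hi, Ne.symm hi']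
  · by_cases hj' : j = k.succ
    · subst hj'
      have hs : sw k k.succ = k.castSucc := Equiv.swap_apply_right _ _
      simp only [hs]
      by_cases hi : i = k.castSucc
      · subst hi; simp [hne, hne']
      · by_cases hi' : i = k.succ
        · subst hi'; simp [hne, hne']
        · simp [hi, hi', Ne.symm hi, Ne.symm hi']
    · have hs : sw k j = j := Equiv.swap_apply_of_ne_of_ne hj hj'
      simp only [hs]
      simp [hj, Ne.symm hj, Ne.symm hj']

theorem mul_sn_apply (k : Fin N) (M : Matrix (Fin (N + 1)) (Fin (N + 1)) R) (i j : Fin (N + 1)) :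
    (M * (sn R k : Matrix (Fin (N + 1)) (Fin (N + 1)) R)) i j = M i (sw k j) * sgn R k j := by
  simp [Matrix.mul_apply, coe_sn_apply]

theorem sw_sw (k : Fin N) (j : Fin (N + 1)) : sw k (sw k j) = j := Equiv.swap_apply_self _ _ _

theorem sn_mul_apply (k : Fin N) (M : Matrix (Fin (N + 1)) (Fin (N + 1)) R) (i j : Fin (N + 1)) :
    ((sn R k : Matrix (Fin (N + 1)) (Fin (N + 1)) R) * M) i j =
      sgn R k (sw k i) * M (sw k i) j := by
  have : ∀ l, i = sw k l ↔ l = sw k i := fun l => by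
    constructor
    · rintro rfl; rw [sw_sw]
    · rintro rfl; rw [sw_sw]
  simp [Matrix.mul_apply, coe_sn_apply, this]

theorem sw_lt {k : Fin N} {i j : Fin (N + 1)} (hij : j < i)
    (h : ¬ (j = k.castSucc ∧ i = k.succ)) : sw k j < sw k i := by
  unfold sw
  rw [Equiv.swap_apply_def, Equiv.swap_apply_def]
  simp only [Fin.lt_def, Fin.ext_iff, Fin.val_castSucc, Fin.val_succ] at *
  split_ifs <;> (try simp only [Fin.val_castSucc, Fin.val_succ] at *) <;> omega

theorem inv_sn_mul_mul_sn_apply (k : Fin N) (g : Matrix.SpecialLinearGroup (Fin (N + 1)) R)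
    (i j : Fin (N + 1)) : ((sn R k)⁻¹ * g * sn R k : Matrix.SpecialLinearGroup (Fin (N + 1)) R) i j =
      sgn R k i * (g (sw k i) (sw k j)) * sgn R k j := by
  set h := (sn R k)⁻¹ * g * sn R k with hh
  have h1 : sn R k * h = g * sn R k := by rw [hh]; group
  have h2 := congrArg (fun x : Matrix.SpecialLinearGroup (Fin (N + 1)) R => x (sw k i) j) h1
  simp only [Matrix.SpecialLinearGroup.coe_mul, sn_mul_apply, mul_sn_apply, sw_sw] at h2
  calc h i j = (sgn R k i * sgn R k i) * h i j := by rw [sgn_mul_self, one_mul]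
    _ = _ := by rw [mul_assoc, h2, mul_assoc]

theorem sn_mul_mul_inv_sn_apply (k : Fin N) (g : Matrix.SpecialLinearGroup (Fin (N + 1)) R)
    (i j : Fin (N + 1)) : (sn R k * g * (sn R k)⁻¹ : Matrix.SpecialLinearGroup (Fin (N + 1)) R) i j =
      sgn R k (sw k i) * (g (sw k i) (sw k j)) * sgn R k (sw k j) := by
  set h := sn R k * g * (sn R k)⁻¹ with hh
  have h1 : h * sn R k = sn R k * g := by rw [hh]; group
  have h2 := congrArg (fun x : Matrix.SpecialLinearGroup (Fin (N + 1)) R => x i (sw k j)) h1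
  simp only [Matrix.SpecialLinearGroup.coe_mul, sn_mul_apply, mul_sn_apply, sw_sw] at h2
  calc h i j = h i j * (sgn R k (sw k j) * sgn R k (sw k j)) := by rw [sgn_mul_self, mul_one]
    _ = _ := by rw [← mul_assoc, h2]

theorem inv_sn_mul_mul_sn_mem_upperU {k : Fin N} {g : Matrix.SpecialLinearGroup (Fin (N + 1)) R}
    (hg : g ∈ upperU (N + 1) R) (hk : g k.castSucc k.succ = 0) :
    (sn R k)⁻¹ * g * sn R k ∈ upperU (N + 1) R := by
  intro i j hij
  rw [inv_sn_mul_mul_sn_apply]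
  rcases hij.lt_or_eq with h | rfl
  · rw [Matrix.one_apply_ne h.ne']
    by_cases hc : j = k.castSucc ∧ i = k.succ
    · rw [hc.1, hc.2, sw, Equiv.swap_apply_left, Equiv.swap_apply_right, hk]; simp
    · rw [IsUni.apply_lt hg (sw_lt h hc)]; simp
  · rw [IsUni.apply_self hg, mul_one, sgn_mul_self, Matrix.one_apply_eq]

theorem sn_mul_mul_inv_sn_mem_lowerU {k : Fin N} {g : Matrix.SpecialLinearGroup (Fin (N + 1)) R}
    (hg : g ∈ lowerU (N + 1) R) (hk : g k.succ k.castSucc = 0) :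
    sn R k * g * (sn R k)⁻¹ ∈ lowerU (N + 1) R := by
  intro j i hij
  rw [Matrix.transpose_apply, sn_mul_mul_inv_sn_apply]
  rcases hij.lt_or_eq with h | rfl
  · rw [Matrix.one_apply_ne h.ne']
    by_cases hc : i = k.castSucc ∧ j = k.succ
    · rw [hc.1, hc.2, sw, Equiv.swap_apply_left, Equiv.swap_apply_right, hk]; simp
    · have := IsUni.apply_lt hg (sw_lt h hc)
      rw [Matrix.transpose_apply] at this
      rw [this]; simp
  · have := IsUni.apply_self hg (sw k i)
    rw [Matrix.transpose_apply] at this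
    rw [this, mul_one, sgn_mul_self, Matrix.one_apply_eq]

theorem IsUni.mul_apply_simple {A B : Matrix (Fin (N + 1)) (Fin (N + 1)) R} (hA : IsUni A)
    (hB : IsUni B) (k : Fin N) :
    (A * B) k.castSucc k.succ = A k.castSucc k.succ + B k.castSucc k.succ := by
  have hne := castSucc_ne_succ k
  rw [Matrix.mul_apply, ← Finset.sum_subset (Finset.subset_univ {k.castSucc, k.succ}),
    Finset.sum_pair hne, hA.apply_self, hB.apply_self, one_mul, mul_one, add_comm]
  intro l _ hl
  simp only [Finset.mem_insert, Finset.mem_singleton, not_or] at hl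
  rcases lt_or_ge l k.castSucc with h | h
  · rw [hA.apply_lt h, zero_mul]
  · rw [hB.apply_lt (i := l), mul_zero]
    have h1 := hl.1
    have h2 := hl.2
    simp only [Fin.lt_def, Fin.le_def, Fin.ext_iff, Fin.val_castSucc, Fin.val_succ] at *
    omega

theorem sx_apply (k : Fin N) (t : R) : sx k t k.castSucc k.succ = t := by
  simp [sx, transvection_coe, castSucc_ne_succ k]

theorem sy_apply (k : Fin N) (t : R) : sy k t k.succ k.castSucc = t := by
  simp [sy, transvection_coe, (castSucc_ne_succ k).symm]

end Simple

/-- A finite `p`-group acting on a nonzero module of characteristic `p` fixes a nonzero vector. -/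
theorem exists_ne_zero_fixed {p : ℕ} [Fact p.Prime] {P V R : Type*} [Group P] [Finite P]
    (hP : IsPGroup p P) [Ring R] [CharP R p] [AddCommGroup V] [Module R V] (π : P →* Module.End R V)
    (S : Submodule R V) (hS : ∀ g, ∀ v ∈ S, π g v ∈ S) {x : V} (hxS : x ∈ S) (hx : x ≠ 0) :
    ∃ y ∈ S, y ≠ 0 ∧ ∀ g, π g y = y := by
  let T : AddSubgroup V := AddSubgroup.closure (Set.range fun g => π g x)
  have hpV : ∀ v : V, p • v = 0 := fun v => by
    rw [← Nat.cast_smul_eq_nsmul R, CharP.cast_eq_zero, zero_smul]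
  have hTS : ∀ v ∈ T, v ∈ S := by
    have : T ≤ S.toAddSubgroup := by
      rw [AddSubgroup.closure_le]
      rintro _ ⟨g, rfl⟩
      exact hS g x hxS
    exact fun v hv => this hv
  have hT : ∀ g, ∀ v ∈ T, π g v ∈ T := by
    intro g
    have : T ≤ T.comap (π g).toAddMonoidHom := by
      rw [AddSubgroup.closure_le]
      rintro _ ⟨h, rfl⟩
      refine AddSubgroup.subset_closure ⟨g * h, ?_⟩
      simp
    exact fun v hv => this hv
  have hxT : x ∈ T := AddSubgroup.subset_closure ⟨1, by simp⟩
  have hfg : AddGroup.FG T := by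
    rw [AddGroup.fg_iff_addSubgroup_fg]
    exact (AddSubgroup.fg_iff _).2 ⟨_, rfl, Set.finite_range _⟩
  have hfin : Finite T := by
    have : Module.Finite ℤ T := Module.Finite.iff_addGroup_fg.2 hfg
    refine Module.finite_of_fg_torsion T fun v => ?_
    refine ⟨⟨(p : ℤ), mem_nonZeroDivisors_of_ne_zero ?_⟩, ?_⟩
    · exact_mod_cast (Fact.out : p.Prime).ne_zero
    · refine Subtype.ext ?_
      have := hpV v
      rw [← natCast_zsmul] at this
      exact this
  let _ : MulAction P T :=
    { smul := fun g v => ⟨π g v, hT g v v.2⟩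
      one_smul := fun v => Subtype.ext (by change π 1 (v : V) = v; simp)
      mul_smul := fun g h v => Subtype.ext (by
        change π (g * h) (v : V) = π g (π h (v : V)); simp) }
  have hsm : ∀ (g : P) (v : T), ((g • v : T) : V) = π g v := fun _ _ => rfl
  have hdvd : p ∣ Nat.card T := by
    have h1 : addOrderOf (⟨x, hxT⟩ : T) = p := addOrderOf_eq_prime (Subtype.ext (hpV x))
      (fun h => hx (congrArg Subtype.val h))
    rw [← h1]
    exact addOrderOf_dvd_natCard _
  obtain ⟨y, hy, hy0⟩ := hP.exists_fixed_point_of_prime_dvd_card_of_fixed_point T hdvd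
    (a := 0) (fun g => Subtype.ext (by rw [hsm]; simp))
  refine ⟨y, hTS y y.2, fun h => hy0 (Subtype.ext h.symm), fun g => ?_⟩
  exact congrArg Subtype.val (hy g)

section Unique

variable {N : ℕ} {k Ω : Type*} [Field k] [Field Ω]

theorem eq_zero_of_forall_lowerU (hN : 0 < N)
    (d : Matrix.SpecialLinearGroup (Fin (N + 1)) k → Ω)
    (hx : ∀ g i t, d (g * sx i t) = d g)
    (hh : ∀ g i t, d g = 0 → d (g * sh i t) = 0)
    (hn : ∀ g i, (∀ t, d (g * sy i t) = 0) → d (g * sn k i) = 0)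
    (h0 : ∀ u ∈ lowerU (N + 1) k, d u = 0) (g : Matrix.SpecialLinearGroup (Fin (N + 1)) k) :
    d g = 0 := by
  let Y : Set (Matrix.SpecialLinearGroup (Fin (N + 1)) k) :=
    {g | ∀ a, (∀ u ∈ lowerU (N + 1) k, d (a * u) = 0) → d (a * g) = 0}
  have hYl : ∀ u ∈ lowerU (N + 1) k, ∀ g ∈ Y, u * g ∈ Y := by
    intro u hu g hg a ha
    rw [← mul_assoc]
    refine hg _ fun v hv => ?_
    rw [mul_assoc]
    exact ha _ (mul_mem hu hv)
  have hYn : ∀ i, ∀ g ∈ Y, sn k i * g ∈ Y := by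
    intro i g hg a ha
    rw [← mul_assoc]
    refine hg _ fun u hu => ?_
    obtain ⟨t, ht⟩ : ∃ t : k, t = u i.succ i.castSucc := ⟨_, rfl⟩
    obtain ⟨v, hv, hv0, rfl⟩ : ∃ v ∈ lowerU (N + 1) k, v i.succ i.castSucc = 0 ∧
        u = v * sy i t := by
      refine ⟨u * sy i (-t), mul_mem hu (sy_mem_lowerU _ _), ?_, ?_⟩
      · have h1 := (sy_mem_lowerU (R := k) i (-t))
        have := IsUni.mul_apply_simple h1 hu i
        rw [← Matrix.transpose_mul, Matrix.transpose_apply, Matrix.transpose_apply,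
          Matrix.transpose_apply, sy_apply, ← ht, ← Matrix.SpecialLinearGroup.coe_mul] at this
        rw [this]; ring
      · rw [mul_assoc, ← sy_add]; simp
    have hw := sn_mul_mul_inv_sn_mem_lowerU hv hv0
    set w := sn k i * v * (sn k i)⁻¹ with hwd
    have hcomm : sn k i * (v * sy i t) = w * (sn k i * sy i t) := by rw [hwd]; group
    rw [mul_assoc, hcomm]
    by_cases ht0 : t = 0
    · rw [ht0, sy_zero, mul_one, ← mul_assoc]
      refine hn _ _ fun s => ?_
      rw [mul_assoc]
      exact ha _ (mul_mem hw (sy_mem_lowerU _ _))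
    · have := sn_mul_sy i (Units.mk0 t ht0)
      rw [Units.val_mk0] at this
      rw [this, ← mul_assoc, ← mul_assoc, hx, ← mul_assoc]
      refine hh _ _ _ ?_
      rw [mul_assoc]
      exact ha _ (mul_mem hw (sy_mem_lowerU _ _))
  let H : Subgroup (Matrix.SpecialLinearGroup (Fin (N + 1)) k) :=
    { carrier := {g | (∀ y ∈ Y, g * y ∈ Y) ∧ ∀ y ∈ Y, g⁻¹ * y ∈ Y}
      one_mem' := ⟨fun y hy => by simpa using hy, fun y hy => by simpa using hy⟩
      mul_mem' := fun {a b} ha hb => ⟨fun y hy => by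
          rw [mul_assoc]; exact ha.1 _ (hb.1 _ hy), fun y hy => by
          rw [_root_.mul_inv_rev, mul_assoc]; exact hb.2 _ (ha.2 _ hy)⟩
      inv_mem' := fun {a} ha => ⟨ha.2, by simpa using ha.1⟩ }
  have hHl : ∀ u ∈ lowerU (N + 1) k, u ∈ H := fun u hu => ⟨hYl u hu, hYl _ (inv_mem hu)⟩
  have hsh : ∀ i, (sh i (-1) : Matrix.SpecialLinearGroup (Fin (N + 1)) k) * sh i (-1) = 1 := by
    intro i
    apply Subtype.ext
    rw [Matrix.SpecialLinearGroup.coe_mul, sh, coe_diag2n_eq_blockEmb,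
      ← blockEmb_mul (castSucc_ne_succ i), Matrix.SpecialLinearGroup.coe_one,
      ← blockEmb_one i.castSucc i.succ]
    congr 1
    ext a b
    fin_cases a <;> fin_cases b <;> simp
  have hHn : ∀ i, sn k i ∈ H := by
    intro i
    refine ⟨hYn i, fun y hy => ?_⟩
    have : (sn k i)⁻¹ = sn k i * (sn k i * sn k i) := by
      rw [inv_eq_iff_mul_eq_one]
      rw [← mul_assoc, sn_mul_sn, ← hsh i]
    rw [this, mul_assoc, mul_assoc]
    exact hYn _ _ (hYn _ _ (hYn _ _ hy))
  have hHx : ∀ i t, sx i t ∈ H := by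
    intro i t
    have := sx_mul_sn i t
    rw [← eq_mul_inv_iff_mul_eq] at this
    rw [this]
    exact mul_mem (mul_mem (hHn i) (hHl _ (sy_mem_lowerU _ _))) (inv_mem (hHn i))
  have hH := eq_top_of_simple_mem hN H hHx fun i t => hHl _ (sy_mem_lowerU _ _)
  have hg : g ∈ H := hH ▸ Subgroup.mem_top g
  have h1 : (1 : Matrix.SpecialLinearGroup (Fin (N + 1)) k) ∈ Y := fun a ha => ha _ (one_mem _)
  have := hg.1 _ h1 1 (fun u hu => by rw [one_mul]; exact h0 u hu)
  simpa using this

end Unique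

/-- Operators satisfying quadratic, commutation and braid relations on a set of vectors have a
joint eigenvector. -/
theorem exists_joint_eigenvector {Ω V : Type*} [Field Ω] [AddCommGroup V] [Module Ω V] (N : ℕ)
    (T : ℕ → Module.End Ω V) (B : Set V)
    (hB : ∀ i < N, ∀ v ∈ B, T i v ∈ B)
    (hq : ∀ i < N, ∀ v ∈ B, ∃ κ : Ω, T i (T i v) = κ • T i v)
    (hc : ∀ i j, i + 1 < j → j < N → ∀ v, T i (T j v) = T j (T i v))
    (hb : ∀ i, i + 1 < N → ∀ v, T i (T (i + 1) (T i v)) = T (i + 1) (T i (T (i + 1) v)))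
    {v : V} (hv : v ∈ B) (hv0 : v ≠ 0) :
    ∃ w ∈ B, w ≠ 0 ∧ ∀ i < N, ∃ c : Ω, T i w = c • w := by
  suffices h : ∀ k ≤ N, ∃ w ∈ B, w ≠ 0 ∧ ∀ i < k, ∃ c : Ω, T i w = c • w from h N le_rfl
  intro k
  induction k with
  | zero => exact fun _ => ⟨v, hv, hv0, by simp⟩
  | succ k ih =>
    intro hk
    obtain ⟨w, hw, hw0, hcw⟩ := ih (by omega)
    choose! c hcw using hcw
    by_cases h0 : T k w = 0
    · refine ⟨w, hw, hw0, fun i hi => ?_⟩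
      rcases Nat.lt_succ_iff_lt_or_eq.1 hi with h | rfl
      · exact ⟨_, hcw i h⟩
      · exact ⟨0, by rw [h0, zero_smul]⟩
    have key : ∀ l ≤ k, ∀ u ∈ B, ∀ w ∈ B, u ≠ 0 → u = T l w →
        (∀ i, i + 1 = l → T i w = c i • w) → (∀ i, l < i → i ≤ k → T i u = c (i - 1) • u) →
        (∀ i, i + 1 < l → T i u = c i • u) →
        ∃ w ∈ B, w ≠ 0 ∧ ∀ i < k + 1, ∃ c : Ω, T i w = c • w := by
      intro l
      induction l with
      | zero =>
        intro _ u hu w hw hu0 huw _ h2 _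
        refine ⟨u, hu, hu0, fun i hi => ?_⟩
        rcases Nat.eq_zero_or_pos i with rfl | h
        · rw [huw]; exact hq 0 (by omega) w hw
        · exact ⟨_, h2 i h (by omega)⟩
      | succ l ihl =>
        intro hl u hu w hw hu0 huw h1 h2 h3
        obtain ⟨κ, hκ⟩ := hq (l + 1) (by omega) w hw
        rw [← huw] at hκ
        by_cases h0 : T l u = 0
        · refine ⟨u, hu, hu0, fun i hi => ?_⟩
          rcases lt_trichotomy i l with h | rfl | h
          · exact ⟨_, h3 i (by omega)⟩
          · exact ⟨0, by rw [h0, zero_smul]⟩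
          · rcases Nat.lt_or_ge (l + 1) i with h' | h'
            · exact ⟨_, h2 i h' (by omega)⟩
            · obtain rfl : i = l + 1 := by omega
              exact ⟨κ, hκ⟩
        · refine ihl (by omega) (T l u) (hB l (by omega) u hu) u hu h0 rfl
            (fun i hi => h3 i (by omega)) (fun i hi hik => ?_) (fun i hi => ?_)
          · rcases Nat.lt_or_ge (l + 1) i with h' | h'
            · rw [← hc l i h' (by omega), h2 i h' hik, map_smul]
            · obtain rfl : i = l + 1 := by omega
              have h4 := hb l (by omega) w
              rw [h1 l rfl, map_smul, map_smul, ← huw] at h4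
              rw [← h4, Nat.add_sub_cancel]
          · rw [hc i l hi (by omega), h3 i (by omega), map_smul]
    refine key k le_rfl (T k w) (hB k (by omega) w hw) w hw h0 rfl
      (fun i hi => hcw i (by omega)) (fun i hi hik => by omega) (fun i hi => ?_)
    rw [hc i k hi (by omega), hcw i (by omega), map_smul]

section Diagonalizable

theorem prod_X_sub_C_eq_X_pow_card_sub_X (F : Type*) [Field F] [Fintype F] :
    ∏ c : F, (Polynomial.X - Polynomial.C c) = Polynomial.X ^ Fintype.card F - Polynomial.X := by
  have h1 := FiniteField.X_pow_card_sub_X_natDegree_eq F (Fintype.one_lt_card (α := F))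
  have h2 := FiniteField.roots_X_pow_card_sub_X F
  have h3 := Polynomial.prod_multiset_X_sub_C_of_monic_of_roots_card_eq
    (p := (Polynomial.X ^ Fintype.card F - Polynomial.X : Polynomial F))
    (Polynomial.monic_X_pow_sub (by
      rw [Polynomial.degree_X]; exact_mod_cast Fintype.one_lt_card (α := F)))
    (by rw [h1, h2]; rfl)
  rw [h2] at h3
  exact h3

variable {Ω V : Type*} [Field Ω] [AddCommGroup V] [Module Ω V]

theorem exists_eigenvector_of_prod_eq_zero (a : Module.End Ω V) (E : Submodule Ω V)
    (hE : ∀ v ∈ E, a v ∈ E) (s : Multiset Ω) {w : V} (hw : w ∈ E) (hw0 : w ≠ 0)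
    (h : Polynomial.aeval a (s.map fun c => Polynomial.X - Polynomial.C c).prod w = 0) :
    ∃ u ∈ E, u ≠ 0 ∧ ∃ c : Ω, a u = c • u := by
  induction s using Multiset.induction generalizing w with
  | empty => simp at h; exact absurd h hw0
  | cons c s ih =>
    rw [Multiset.map_cons, Multiset.prod_cons, mul_comm, map_mul] at h
    by_cases h0 : a w = c • w
    · exact ⟨w, hw, hw0, c, h0⟩
    · refine ih (w := a w - c • w) (E.sub_mem (hE w hw) (E.smul_mem c hw)) (sub_ne_zero.2 h0) ?_
      simpa [Module.algebraMap_end_apply] using h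

theorem exists_joint_eigenvector_of_pow_card {F : Type*} [Field F] [Fintype F] [Algebra F Ω]
    {ι : Type*} (A : ι → Module.End Ω V) (hA : ∀ i j, Commute (A i) (A j))
    (hp : ∀ i, A i ^ Fintype.card F = A i) (s : Finset ι) (E : Submodule Ω V)
    (hE : ∀ i, ∀ v ∈ E, A i v ∈ E) {w : V} (hw : w ∈ E) (hw0 : w ≠ 0) :
    ∃ u ∈ E, u ≠ 0 ∧ ∀ i ∈ s, ∃ c : Ω, A i u = c • u := by
  classical
  induction s using Finset.induction with
  | empty => exact ⟨w, hw, hw0, by simp⟩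
  | insert a s _ ih =>
    obtain ⟨v, hv, hv0, hc⟩ := ih
    choose! c hc using hc
    let E' : Submodule Ω V := E ⊓ ⨅ i ∈ s, LinearMap.ker (A i - c i • LinearMap.id)
    have hE' : ∀ {u}, u ∈ E' ↔ u ∈ E ∧ ∀ i ∈ s, A i u = c i • u := by
      intro u
      simp [E', sub_eq_zero]
    obtain ⟨u, hu, hu0, hu'⟩ := exists_eigenvector_of_prod_eq_zero (A a) E' (fun u hu => by
        rw [hE'] at hu ⊢
        refine ⟨hE a u hu.1, fun i hi => ?_⟩
        have := congrArg (fun f : Module.End Ω V => f u) (hA i a).eq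
        simp only [Module.End.mul_apply] at this
        rw [this, hu.2 i hi, map_smul])
      ((Finset.univ : Finset F).val.map (algebraMap F Ω)) (hE'.2 ⟨hv, hc⟩) hv0 (by
        have h1 : (Polynomial.X ^ Fintype.card F - Polynomial.X : Polynomial Ω) =
            (((Finset.univ : Finset F).val.map (algebraMap F Ω)).map
              fun c => Polynomial.X - Polynomial.C c).prod := by
          have h2 := congrArg (Polynomial.map (algebraMap F Ω)) (prod_X_sub_C_eq_X_pow_card_sub_X F)
          rw [Polynomial.map_sub, Polynomial.map_pow, Polynomial.map_X] at h2
          rw [← h2, Polynomial.map_prod, Multiset.map_map]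
          simp only [Polynomial.map_sub, Polynomial.map_X, Polynomial.map_C]
          rfl
        rw [← h1]
        simp [hp a])
    rw [hE'] at hu
    refine ⟨u, hu.1, hu0, fun i hi => ?_⟩
    rcases Finset.mem_insert.1 hi with rfl | h
    · exact hu'
    · exact ⟨_, hu.2 i h⟩

end Diagonalizable

section Relations

variable {N : ℕ} {R : Type*} [Field R]

theorem sn_mul_transvection (k : Fin N) {i j : Fin (N + 1)} (hij : i ≠ j) (a : R) :
    sn R k * transvection hij a =
      transvection ((sw k).injective.ne hij) (sgn R k i * sgn R k j * a) * sn R k := by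
  rw [← mul_inv_eq_iff_eq_mul]
  apply Subtype.ext
  ext x y
  rw [sn_mul_mul_inv_sn_apply, transvection_coe, transvection_coe]
  have h1 : ∀ x y, sw k x = y ↔ x = sw k y := fun x y => by
    constructor
    · rintro rfl; rw [sw_sw]
    · rintro rfl; rw [sw_sw]
  simp only [Matrix.add_apply, Matrix.single_apply, Matrix.one_apply, h1, sw_sw]
  by_cases hxy : x = y
  · subst hxy
    have : ¬ (sw k i = x ∧ sw k j = x) := by
      rintro ⟨h, h'⟩
      exact hij ((sw k).injective (h.trans h'.symm))
    have h2 : ¬ (i = sw k x ∧ j = sw k x) := by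
      rintro ⟨h, h'⟩
      exact hij (h.trans h'.symm)
    simp [this, h2, sgn_mul_self]
  · have h3 : ∀ x y, x = sw k y ↔ sw k x = y := fun x y => (h1 x y).symm
    by_cases h2 : i = sw k x ∧ j = sw k y
    · obtain ⟨rfl, rfl⟩ := h2
      simp [sw_sw, hxy]
      ring
    · have : ¬ (sw k i = x ∧ sw k j = y) := by rwa [h1, h1]
      simp [h2, hxy, h1]

theorem sgn_mul_sgn_sq (k : Fin N) (i j : Fin (N + 1)) :
    (sgn R k i * sgn R k j) * (sgn R k i * sgn R k j) = 1 := by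
  rw [mul_mul_mul_comm, sgn_mul_self, sgn_mul_self, one_mul]

theorem commute_sn {i j : Fin N} (hij : i.val + 1 < j.val) : Commute (sn R i) (sn R j) := by
  have h1 : i.castSucc ≠ j.castSucc := by simp [Fin.ext_iff]; omega
  have h2 : i.castSucc ≠ j.succ := by simp [Fin.ext_iff]; omega
  have h3 : i.succ ≠ j.castSucc := by simp [Fin.ext_iff]; omega
  have h4 : i.succ ≠ j.succ := by simp [Fin.ext_iff]; omega
  have c1 : ∀ a b : R, Commute (sx i a) (sx j b) := fun a b => transvection_commute _ _ h3 h2 a b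
  have c2 : ∀ a b : R, Commute (sx i a) (sy j b) := fun a b => transvection_commute _ _ h4 h1 a b
  have c3 : ∀ a b : R, Commute (sy i a) (sx j b) := fun a b => transvection_commute _ _ h1 h4 a b
  have c4 : ∀ a b : R, Commute (sy i a) (sy j b) := fun a b => transvection_commute _ _ h2 h3 a b
  rw [sn_eq, sn_eq]
  have c5 : ∀ a : R, Commute (sx i a) (sx j 1 * sy j (-1) * sx j 1) := fun a =>
    ((c1 _ _).mul_right (c2 _ _)).mul_right (c1 _ _)
  have c6 : ∀ a : R, Commute (sy i a) (sx j 1 * sy j (-1) * sx j 1) := fun a =>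
    ((c3 _ _).mul_right (c4 _ _)).mul_right (c3 _ _)
  exact ((c5 _).mul_left (c6 _)).mul_left (c5 _)

theorem sn_mul_sx_of_lt {i j : Fin N} (hij : i.val + 1 < j.val) (t : R) :
    Commute (sn R i) (sx j t) := by
  have h1 : i.castSucc ≠ j.castSucc := by simp [Fin.ext_iff]; omega
  have h2 : i.castSucc ≠ j.succ := by simp [Fin.ext_iff]; omega
  have h3 : i.succ ≠ j.castSucc := by simp [Fin.ext_iff]; omega
  have h4 : i.succ ≠ j.succ := by simp [Fin.ext_iff]; omega
  have c1 : ∀ a b : R, Commute (sx i a) (sx j b) := fun a b => transvection_commute _ _ h3 h2 a b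
  have c3 : ∀ a b : R, Commute (sy i a) (sx j b) := fun a b => transvection_commute _ _ h1 h4 a b
  rw [sn_eq]
  exact ((c1 _ _).mul_left (c3 _ _)).mul_left (c1 _ _)

theorem sn_mul_sx_of_gt {i j : Fin N} (hij : i.val + 1 < j.val) (t : R) :
    Commute (sn R j) (sx i t) := by
  have h1 : i.castSucc ≠ j.castSucc := by simp [Fin.ext_iff]; omega
  have h2 : i.castSucc ≠ j.succ := by simp [Fin.ext_iff]; omega
  have h3 : i.succ ≠ j.castSucc := by simp [Fin.ext_iff]; omega
  have h4 : i.succ ≠ j.succ := by simp [Fin.ext_iff]; omega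
  have c1 : ∀ a b : R, Commute (sx i a) (sx j b) := fun a b => transvection_commute _ _ h3 h2 a b
  have c2 : ∀ a b : R, Commute (sx i a) (sy j b) := fun a b => transvection_commute _ _ h4 h1 a b
  rw [sn_eq]
  exact (((c1 _ _).mul_right (c2 _ _)).mul_right (c1 _ _)).symm

theorem sn_braid {i j : Fin N} (hij : i.val + 1 = j.val) :
    sn R i * sn R j * sn R i = sn R j * sn R i * sn R j := by
  have h1 : ∀ x y, x = sw i y ↔ sw i x = y := fun x y => by
    constructor
    · rintro rfl; rw [sw_sw]
    · rintro rfl; rw [sw_sw]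
  have e : i.succ = j.castSucc := Fin.ext (by simp [hij])
  have hi1 : sw i i.castSucc = i.succ := Equiv.swap_apply_left _ _
  have hi2 : sw i i.succ = i.castSucc := Equiv.swap_apply_right _ _
  have hj1 : sw j j.castSucc = j.succ := Equiv.swap_apply_left _ _
  have hj2 : sw j j.succ = j.castSucc := Equiv.swap_apply_right _ _
  have hn1 : i.castSucc ≠ j.castSucc := fun h => by
    have := congrArg Fin.val h
    simp only [Fin.val_castSucc] at this
    omega
  have hn2 : i.castSucc ≠ j.succ := fun h => by
    have := congrArg Fin.val h
    simp only [Fin.val_castSucc, Fin.val_succ] at this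
    omega
  have hn3 := castSucc_ne_succ j
  rw [e] at hi1 hi2
  have hi3 : sw i j.succ = j.succ :=
    Equiv.swap_apply_of_ne_of_ne hn2.symm (by rw [e]; exact hn3.symm)
  have hj3 : sw j i.castSucc = i.castSucc := Equiv.swap_apply_of_ne_of_ne hn1 hn2
  have hi4 : ∀ y, y ≠ i.castSucc → y ≠ j.castSucc → sw i y = y := fun y h h' =>
    Equiv.swap_apply_of_ne_of_ne h (by rwa [e])
  have hj4 : ∀ y, y ≠ j.castSucc → y ≠ j.succ → sw j y = y := fun y h h' =>
    Equiv.swap_apply_of_ne_of_ne h h'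
  have hbr : ∀ y, sw i (sw j (sw i y)) = sw j (sw i (sw j y)) := by
    intro y
    by_cases y1 : y = i.castSucc
    · subst y1; simp only [hi1, hi2, hi3, hj1, hj2, hj3]
    by_cases y2 : y = j.castSucc
    · subst y2; simp only [hi1, hi2, hi3, hj1, hj2, hj3]
    by_cases y3 : y = j.succ
    · subst y3; simp only [hi1, hi2, hi3, hj1, hj2, hj3]
    simp only [hi4 y y1 y2, hj4 y y2 y3]
  apply Subtype.ext
  ext x y
  simp only [Matrix.SpecialLinearGroup.coe_mul, mul_sn_apply, coe_sn_apply]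
  rw [hbr]
  by_cases hx : x = sw j (sw i (sw j y))
  · rw [if_pos hx, if_pos hx]
    by_cases y1 : y = i.castSucc
    · subst y1
      simp [sgn, hi1, hi2, hi3, hj1, hj2, hj3, hn1, hn2, hn3, hn1.symm, hn2.symm, hn3.symm]
    by_cases y2 : y = j.castSucc
    · subst y2
      simp [sgn, hi1, hi2, hi3, hj1, hj2, hj3, hn1, hn2, hn3, hn1.symm, hn2.symm, hn3.symm]
    by_cases y3 : y = j.succ
    · subst y3
      simp [sgn, hi1, hi2, hi3, hj1, hj2, hj3, hn1, hn2, hn3, hn1.symm, hn2.symm, hn3.symm]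
    simp [sgn, hi4 y y1 y2, hj4 y y2 y3, y1, y2]
  · rw [if_neg hx, if_neg hx]; simp

end Relations

section Diag

variable {n : ℕ} {F : Type*} [Field F]

/-- Diagonal elements of the special linear group. -/
def IsDiagSL (g : Matrix.SpecialLinearGroup (Fin n) F) : Prop := ∀ i j, i ≠ j → g i j = 0

theorem IsDiagSL.coe_eq {g : Matrix.SpecialLinearGroup (Fin n) F} (h : IsDiagSL g) :
    (g : Matrix (Fin n) (Fin n) F) = diagonal fun i => g i i := by
  ext i j
  rw [diagonal_apply]
  split_ifs with hij
  · rw [hij]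
  · exact h i j hij

theorem IsDiagSL.apply_self_ne_zero {g : Matrix.SpecialLinearGroup (Fin n) F} (h : IsDiagSL g)
    (i : Fin n) : g i i ≠ 0 := by
  intro hi
  have h1 : (g : Matrix (Fin n) (Fin n) F).det = 1 := g.2
  have h2 : ∏ i, g i i = 0 := Finset.prod_eq_zero (Finset.mem_univ i) hi
  rw [h.coe_eq, det_diagonal, h2] at h1
  exact zero_ne_one h1

theorem IsDiagSL.commute {g h : Matrix.SpecialLinearGroup (Fin n) F} (hg : IsDiagSL g)
    (hh : IsDiagSL h) : Commute g h := by
  apply Subtype.ext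
  rw [Matrix.SpecialLinearGroup.coe_mul, Matrix.SpecialLinearGroup.coe_mul, hg.coe_eq, hh.coe_eq,
    diagonal_mul_diagonal, diagonal_mul_diagonal]
  simp only [mul_comm]

theorem IsDiagSL.pow_card [Fintype F] {g : Matrix.SpecialLinearGroup (Fin n) F} (hg : IsDiagSL g) :
    g ^ Fintype.card F = g := by
  apply Subtype.ext
  rw [Matrix.SpecialLinearGroup.coe_pow, hg.coe_eq, diagonal_pow]
  congr 1
  ext i
  simp [FiniteField.pow_card]

theorem IsDiagSL.inv_mul_mul_mem_upperU {h u : Matrix.SpecialLinearGroup (Fin n) F}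
    (hh : IsDiagSL h) (hu : u ∈ upperU n F) : h⁻¹ * u * h ∈ upperU n F := by
  obtain ⟨x, hx⟩ : ∃ x, x = h⁻¹ * u * h := ⟨_, rfl⟩
  have h1 : h * x = u * h := by rw [hx]; group
  have h2 : ∀ i j, h i i * x i j = u i j * h j j := by
    intro i j
    have := congrArg (fun z : Matrix.SpecialLinearGroup (Fin n) F => z i j) h1
    simp only [Matrix.SpecialLinearGroup.coe_mul] at this
    rwa [hh.coe_eq, diagonal_mul, mul_diagonal] at this
  rw [← hx]
  intro i j hij
  refine mul_left_cancel₀ (hh.apply_self_ne_zero i) ?_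
  rw [h2]
  rcases hij.lt_or_eq with hlt | rfl
  · rw [IsUni.apply_lt hu hlt, Matrix.one_apply_ne hlt.ne']; simp
  · rw [IsUni.apply_self hu, Matrix.one_apply_eq]; ring

theorem IsDiagSL.mul_transvection {h : Matrix.SpecialLinearGroup (Fin n) F} (hh : IsDiagSL h)
    {i j : Fin n} (hij : i ≠ j) (t : F) :
    h * transvection hij t = transvection hij (h i i / h j j * t) * h := by
  apply Subtype.ext
  rw [Matrix.SpecialLinearGroup.coe_mul, Matrix.SpecialLinearGroup.coe_mul, transvection_coe,
    transvection_coe]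
  have h0 := hh.apply_self_ne_zero j
  have h1 := hh.coe_eq
  obtain ⟨d, hd⟩ : ∃ d : Fin n → F, ∀ i, h i i = d i := ⟨_, fun _ => rfl⟩
  simp only [hd] at h0 h1 ⊢
  rw [mul_add, add_mul, mul_one, one_mul]
  congr 1
  rw [h1]
  ext x y
  rw [diagonal_mul, mul_diagonal, Matrix.single_apply, Matrix.single_apply]
  split_ifs with hxy
  · obtain ⟨rfl, rfl⟩ := hxy
    field_simp
  · simp

variable {N : ℕ}

theorem IsDiagSL.inv_sn_mul_mul_sn {h : Matrix.SpecialLinearGroup (Fin (N + 1)) F}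
    (hh : IsDiagSL h) (k : Fin N) : IsDiagSL ((sn F k)⁻¹ * h * sn F k) := by
  intro i j hij
  rw [inv_sn_mul_mul_sn_apply, hh _ _ ((sw k).injective.ne hij)]
  simp

theorem isDiagSL_sh (k : Fin N) (t : Fˣ) : IsDiagSL (sh k t) := by
  intro i j hij
  rw [sh, diag2n_coe, diagonal_apply_ne _ hij]

theorem sh_mul (k : Fin N) (s t : Fˣ) : sh k (s * t) = sh k s * sh k t := by
  apply Subtype.ext
  rw [Matrix.SpecialLinearGroup.coe_mul, sh, sh, sh, coe_diag2n_eq_blockEmb,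
    coe_diag2n_eq_blockEmb, coe_diag2n_eq_blockEmb, ← blockEmb_mul (castSucc_ne_succ k)]
  congr 1
  ext a b
  fin_cases a <;> fin_cases b <;> simp [mul_comm]

end Diag

section Hecke

variable {N : ℕ} {F : Type*} [Field F] [Fintype F] [DecidableEq F] {Ω V : Type*} [Field Ω]
  [AddCommGroup V] [Module Ω V] (π : Matrix.SpecialLinearGroup (Fin (N + 1)) F →* Module.End Ω V)

/-- The Hecke operator of a simple reflection. -/
noncomputable def hecke (k : Fin N) : Module.End Ω V := ∑ t : F, π (sx k t * sn F k)

theorem hecke_apply (k : Fin N) (v : V) : hecke π k v = ∑ t : F, π (sx k t * sn F k) v := by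
  simp [hecke]

theorem map_hecke_apply {v : V} (hv : ∀ u ∈ upperU (N + 1) F, π u v = v) (k : Fin N)
    {u : Matrix.SpecialLinearGroup (Fin (N + 1)) F} (hu : u ∈ upperU (N + 1) F) :
    π u (hecke π k v) = hecke π k v := by
  rw [hecke_apply, map_sum]
  refine Fintype.sum_equiv (Equiv.addLeft (u k.castSucc k.succ)) _ _ fun t => ?_
  set s := u k.castSucc k.succ with hs
  have h1 : sx k (-(s + t)) * u * sx k t ∈ upperU (N + 1) F :=
    mul_mem (mul_mem (sx_mem_upperU _ _) hu) (sx_mem_upperU _ _)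
  have h2 := inv_sn_mul_mul_sn_mem_upperU (k := k) h1 (by
    rw [Matrix.SpecialLinearGroup.coe_mul, IsUni.mul_apply_simple
      (mul_mem (sx_mem_upperU _ _) hu : _ ∈ upperU (N + 1) F) (sx_mem_upperU _ _),
      Matrix.SpecialLinearGroup.coe_mul, IsUni.mul_apply_simple
      (sx_mem_upperU _ _) hu, sx_apply, sx_apply, ← hs]
    ring)
  rw [Equiv.coe_addLeft, ← Module.End.mul_apply, ← map_mul]
  have h3 : u * (sx k t * sn F k) = sx k (s + t) * sn F k *
      ((sn F k)⁻¹ * (sx k (-(s + t)) * u * sx k t) * sn F k) := by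
    rw [← sx_inv]; group
  rw [h3, map_mul, Module.End.mul_apply, hv _ h2]

theorem map_diag_hecke_apply {v : V} {h : Matrix.SpecialLinearGroup (Fin (N + 1)) F}
    (hh : IsDiagSL h) (k : Fin N) {c : Ω} (hc : π ((sn F k)⁻¹ * h * sn F k) v = c • v) :
    π h (hecke π k v) = c • hecke π k v := by
  rw [hecke_apply, map_sum, Finset.smul_sum]
  have h0 : h k.castSucc k.castSucc / h k.succ k.succ ≠ 0 :=
    div_ne_zero (hh.apply_self_ne_zero _) (hh.apply_self_ne_zero _)
  refine Fintype.sum_equiv (Equiv.mulLeft₀ _ h0) _ _ fun t => ?_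
  rw [Equiv.mulLeft₀_apply, ← Module.End.mul_apply, ← map_mul, ← mul_assoc, sx,
    hh.mul_transvection (castSucc_ne_succ k), ← map_smul, ← hc, ← Module.End.mul_apply, ← map_mul,
    sx]
  congr 2
  group

theorem hecke_hecke_apply {p : ℕ} [CharP F p] [CharP Ω p] {v : V}
    (hv : ∀ u ∈ upperU (N + 1) F, π u v = v) (k : Fin N)
    {χ : Fˣ → Ω} (hχ : ∀ t, π (sh k t) v = χ t • v) :
    hecke π k (hecke π k v) = (∑ t, χ t) • hecke π k v := by
  have hx : ∀ t, π (sx k t) v = v := fun t => hv _ (sx_mem_upperU _ _)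
  have hsplit : ∀ f : F → V, ∑ t, f t = f 0 + ∑ t : Fˣ, f t := by
    intro f
    rw [← Finset.add_sum_erase _ _ (Finset.mem_univ (0 : F))]
    congr 1
    refine (Finset.sum_bij' (fun (t : Fˣ) _ => (t : F))
      (fun t ht => Units.mk0 t (Finset.ne_of_mem_erase ht)) ?_ ?_ ?_ ?_ ?_).symm
    · intro t _; simp
    · simp
    · intro t _; simp
    · intro t _; simp
    · simp
  calc hecke π k (hecke π k v)
      = ∑ b : F, ∑ a : F, π (sx k a * sn F k * (sx k b * sn F k)) v := by
        rw [hecke_apply π k v, map_sum]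
        refine Finset.sum_congr rfl fun b _ => ?_
        rw [hecke_apply]
        refine Finset.sum_congr rfl fun a _ => ?_
        rw [map_mul π (sx k a * sn F k), Module.End.mul_apply]
    _ = 0 + ∑ b : Fˣ, χ (-b) • hecke π k v := by
        rw [hsplit]
        congr 1
        · have : ∀ a : F, π (sx k a * sn F k * (sx k 0 * sn F k)) v = χ (-1) • v := by
            intro a
            rw [sx_zero, one_mul, mul_assoc, sn_mul_sn, map_mul, Module.End.mul_apply, hχ,
              map_smul, hx]
          simp only [this]
          rw [Finset.sum_const, Finset.card_univ, ← Nat.cast_smul_eq_nsmul Ω]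
          have h0 : ((Fintype.card F : ℕ) : Ω) = 0 := by
            rw [CharP.cast_eq_zero_iff Ω p, ← CharP.cast_eq_zero_iff F p]
            exact Nat.cast_card_eq_zero F
          rw [h0, zero_smul]
        · refine Finset.sum_congr rfl fun b _ => ?_
          rw [hecke_apply, Finset.smul_sum]
          refine Fintype.sum_equiv (Equiv.addRight (-(b : F)⁻¹)) _ _ fun a => ?_
          have h1 : sx k a * sn F k * (sx k (b : F) * sn F k) =
              sx k (a + -(b : F)⁻¹) * sn F k * sh k (-b) * sx k (-(b : F)⁻¹) := by
            have := sn_mul_sx_mul_sn k b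
            rw [sx_add]
            calc _ = sx k a * (sn F k * sx k (b : F) * sn F k) := by group
              _ = _ := by rw [this]; group
          rw [Equiv.coe_addRight, h1, map_mul, Module.End.mul_apply, hx, map_mul,
            Module.End.mul_apply, hχ, map_smul]
    _ = _ := by
        rw [zero_add, ← Finset.sum_smul]
        congr 1
        exact Fintype.sum_equiv (Equiv.neg Fˣ) _ _ fun _ => rfl

theorem hecke_mul (i j : Fin N) :
    hecke π i * hecke π j = ∑ a : F, ∑ b : F, π (sx i a * sn F i * (sx j b * sn F j)) := by
  rw [hecke, hecke, Finset.sum_mul_sum]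
  simp only [map_mul]

theorem hecke_commute {i j : Fin N} (hij : i.val + 1 < j.val) :
    hecke π i * hecke π j = hecke π j * hecke π i := by
  rw [hecke_mul, hecke_mul, Finset.sum_comm]
  refine Finset.sum_congr rfl fun b _ => Finset.sum_congr rfl fun a _ => ?_
  have h1 := (sn_mul_sx_of_lt hij b).eq
  have h2 := (sn_mul_sx_of_gt hij a).eq
  have h3 := (commute_sn (R := F) hij).eq
  have h4 : Commute (sx i a) (sx j b) := transvection_commute _ _
    (fun h => by have := congrArg Fin.val h; simp at this; omega)
    (fun h => by have := congrArg Fin.val h; simp at this; omega) _ _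
  congr 1
  calc sx i a * sn F i * (sx j b * sn F j) = sx i a * (sn F i * sx j b) * sn F j := by group
    _ = (sx i a * sx j b) * (sn F i * sn F j) := by rw [h1]; group
    _ = sx j b * (sx i a * sn F j) * sn F i := by rw [h3, h4.eq]; group
    _ = _ := by rw [← h2]; group

theorem hecke_mul_hecke_mul_hecke (i j : Fin N) :
    hecke π i * hecke π j * hecke π i = ∑ a : F, ∑ c : F, ∑ b : F,
      π (sx i a * sn F i * (sx j b * sn F j) * (sx i c * sn F i)) := by
  rw [hecke_mul, hecke, Finset.sum_mul]
  refine Finset.sum_congr rfl fun a _ => ?_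
  rw [Finset.sum_mul_sum, Finset.sum_comm]
  simp only [map_mul]

theorem hecke_braid {i j : Fin N} (hij : i.val + 1 = j.val) :
    hecke π i * hecke π j * hecke π i = hecke π j * hecke π i * hecke π j := by
  have e : i.succ = j.castSucc := Fin.ext (by simp [hij])
  have hn1 : i.castSucc ≠ j.castSucc := fun h => by
    have := congrArg Fin.val h
    simp only [Fin.val_castSucc] at this
    omega
  have hn2 : i.castSucc ≠ j.succ := fun h => by
    have := congrArg Fin.val h
    simp only [Fin.val_castSucc, Fin.val_succ] at this
    omega
  have hn3 := castSucc_ne_succ j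
  have hi1 : sw i i.castSucc = i.succ := Equiv.swap_apply_left _ _
  have hi2 : sw i i.succ = i.castSucc := Equiv.swap_apply_right _ _
  have hj1 : sw j j.castSucc = j.succ := Equiv.swap_apply_left _ _
  have hj2 : sw j j.succ = j.castSucc := Equiv.swap_apply_right _ _
  have hi1' : sw i i.castSucc = j.castSucc := by rw [hi1, e]
  have hi2' : sw i j.castSucc = i.castSucc := by rw [← e, hi2]
  have hi3 : sw i j.succ = j.succ :=
    Equiv.swap_apply_of_ne_of_ne hn2.symm (by rw [e]; exact hn3.symm)
  have hj3 : sw j i.castSucc = i.castSucc := Equiv.swap_apply_of_ne_of_ne hn1 hn2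
  have tcongr : ∀ {x y x' y' : Fin (N + 1)} (h : x ≠ y) (h' : x' ≠ y') (a : F), x = x' → y = y' →
      transvection h a = transvection h' a := by
    rintro x y _ _ h h' a rfl rfl; rfl
  have hxi : ∀ a : F, sx i a = transvection hn1 a := fun a => tcongr _ _ a rfl e
  let z : F → Matrix.SpecialLinearGroup (Fin (N + 1)) F := fun a => transvection hn2 a
  obtain ⟨ε, hε⟩ : ∃ ε : Fin N → Fin (N + 1) → Fin (N + 1) → F,
    ε = fun k i j => sgn F k i * sgn F k j := ⟨_, rfl⟩
  have hε1 : ∀ k i j, ε k i j * ε k i j = 1 := fun k i j => by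
    rw [hε]; exact sgn_mul_sgn_sq _ _ _
  have hε' : ∀ (k : Fin N) {i j : Fin (N + 1)} (hij : i ≠ j) (a : F),
      sn F k * transvection hij a =
      transvection ((sw k).injective.ne hij) (ε k i j * a) * sn F k := fun k i j hij a => by
    rw [hε]; exact sn_mul_transvection _ _ _
  have p1 : ∀ b, sn F i * sx j b = z (ε i j.castSucc j.succ * b) * sn F i := fun b => by
    rw [sx, hε']; congr 1
    exact tcongr _ _ _ (by rw [hi2']) hi3
  have p2 : ∀ b, sn F i * z b = sx j (ε i i.castSucc j.succ * b) * sn F i := fun b => by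
    rw [hε']; congr 1
    exact tcongr _ _ _ hi1' hi3
  have p3 : ∀ b, sn F j * sx i b = z (ε j i.castSucc j.castSucc * b) * sn F j := fun b => by
    rw [hxi, hε']; congr 1
    exact tcongr _ _ _ hj3 hj1
  have p4 : ∀ b, sn F j * z b = sx i (ε j i.castSucc j.succ * b) * sn F j := fun b => by
    rw [hε', hxi]; congr 1
    exact tcongr _ _ _ hj3 hj2
  have hsum : ∀ (k : Fin N) (x y : Fin (N + 1)) (f : F → Module.End Ω V),
      ∑ b, f (ε k x y * b) = ∑ b, f b := fun k x y f =>
    Fintype.sum_equiv (Equiv.mulLeft₀ (ε k x y) (left_ne_zero_of_mul_eq_one (hε1 k x y))) _ _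
      fun b => rfl
  have hsum2 : ∀ (k l m : Fin N) (x y x' y' x'' y'' : Fin (N + 1)) (f : F → F → Module.End Ω V),
      ∑ c, ∑ b, f (ε k x y * (ε l x' y' * c)) (ε m x'' y'' * b) = ∑ c, ∑ b, f c b := by
    intro k l m x y x' y' x'' y'' f
    simp only [fun c => hsum m x'' y'' (f c)]
    rw [hsum l x' y' fun c => ∑ b, f (ε k x y * c) b, hsum k x y fun c => ∑ b, f c b]
  have hz1 : ∀ a b, Commute (z a) (sx j b) := fun a b =>
    transvection_commute hn2 _ (castSucc_ne_succ j).symm hn2 a b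
  have hz2 : ∀ a b, Commute (z a) (sx i b) := fun a b => by
    rw [hxi]; exact transvection_commute hn2 _ hn2.symm hn1 a b
  have hzadd : ∀ a b, z (a + b) = z a * z b := fun a b => transvection_add _ _ _
  have hcomm : ∀ a c, sx i c * sx j a = z (c * a) * (sx j a * sx i c) := fun a c => by
    rw [hxi]; exact transvection_mul_transvection hn1 (castSucc_ne_succ j) hn2 c a
  have L : ∀ a c b : F, sx i a * sn F i * (sx j b * sn F j) * (sx i c * sn F i) =
      sx i a * z (ε i j.castSucc j.succ * b) *
        sx j (ε i i.castSucc j.succ * (ε j i.castSucc j.castSucc * c)) *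
        (sn F i * sn F j * sn F i) := fun a c b => by
    calc _ = sx i a * (sn F i * sx j b) * (sn F j * sx i c) * sn F i := by group
      _ = sx i a * z (ε i j.castSucc j.succ * b) *
          (sn F i * z (ε j i.castSucc j.castSucc * c)) * sn F j * sn F i := by
        rw [p1, p3]; group
      _ = _ := by rw [p2]; group
  have L' : ∀ a c b : F, sx j a * sn F j * (sx i b * sn F i) * (sx j c * sn F j) =
      sx j a * z (ε j i.castSucc j.castSucc * b) *
        sx i (ε j i.castSucc j.succ * (ε i j.castSucc j.succ * c)) *
        (sn F j * sn F i * sn F j) := fun a c b => by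
    calc _ = sx j a * (sn F j * sx i b) * (sn F i * sx j c) * sn F j := by group
      _ = sx j a * z (ε j i.castSucc j.castSucc * b) *
          (sn F j * z (ε i j.castSucc j.succ * c)) * sn F i * sn F j := by
        rw [p3, p1]; group
      _ = _ := by rw [p4]; group
  rw [hecke_mul_hecke_mul_hecke, hecke_mul_hecke_mul_hecke]
  simp only [L, L', ← sn_braid hij]
  calc _ = ∑ a, ∑ c, ∑ b, π (sx i a * z b * sx j c * (sn F i * sn F j * sn F i)) := by
        refine Finset.sum_congr rfl fun a _ => ?_
        exact hsum2 _ _ _ _ _ _ _ _ _ fun c b =>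
          π (sx i a * z b * sx j c * (sn F i * sn F j * sn F i))
    _ = ∑ c, ∑ a, ∑ b, π (sx j c * z b * sx i a * (sn F i * sn F j * sn F i)) := by
        rw [Finset.sum_comm]
        refine Finset.sum_congr rfl fun c _ => Finset.sum_congr rfl fun a _ => ?_
        refine Fintype.sum_equiv (Equiv.addRight (a * c)) _ _ fun b => ?_
        congr 2
        rw [Equiv.coe_addRight, ← (hz2 _ _).eq, mul_assoc (z b), hcomm, ← (hz1 _ _).eq, hzadd]
        group
    _ = _ := by
        refine Finset.sum_congr rfl fun c _ => ?_
        exact (hsum2 _ _ _ _ _ _ _ _ _ fun a b =>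
          π (sx j c * z b * sx i a * (sn F i * sn F j * sn F i))).symm

end Hecke

theorem exists_exponent {F Ω : Type*} [Field F] [Fintype F] [Field Ω] [Algebra F Ω]
    (χ : Fˣ →* Ω) : ∃ a < Fintype.card F - 1, ∀ t : Fˣ, χ t = algebraMap F Ω (t : F) ^ a := by
  classical
  obtain ⟨g, hg⟩ := IsCyclic.exists_generator (α := Fˣ)
  have hcard : orderOf g = Fintype.card F - 1 := by
    rw [orderOf_eq_card_of_forall_mem_zpowers hg, Nat.card_eq_fintype_card, Fintype.card_units]
  have h1 : χ g ^ Fintype.card F = χ g := by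
    rw [← map_pow]
    congr 1
    ext
    simp [FiniteField.pow_card]
  obtain ⟨ζ, hζ⟩ : ∃ ζ : F, χ g = algebraMap F Ω ζ := by
    have h2 := congrArg (Polynomial.aeval (χ g)) (prod_X_sub_C_eq_X_pow_card_sub_X F)
    rw [map_prod, map_sub, map_pow, Polynomial.aeval_X, h1, sub_self] at h2
    obtain ⟨c, -, hc⟩ := Finset.prod_eq_zero_iff.1 h2
    exact ⟨c, by simpa [sub_eq_zero] using hc⟩
  have hζ0 : ζ ≠ 0 := by
    rintro rfl
    rw [map_zero] at hζ
    have : χ (g * g⁻¹) = 0 := by rw [map_mul, hζ, zero_mul]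
    rw [mul_inv_cancel, map_one] at this
    exact one_ne_zero this
  have h3 : Units.mk0 ζ hζ0 ∈ Submonoid.powers g := by
    rw [mem_powers_iff_mem_zpowers]; exact hg _
  rw [mem_powers_iff_mem_range_orderOf] at h3
  obtain ⟨a, ha, hga⟩ := Finset.mem_image.1 h3
  refine ⟨a, by rw [← hcard]; exact Finset.mem_range.1 ha, fun t => ?_⟩
  have ht : t ∈ Submonoid.powers g := by rw [mem_powers_iff_mem_zpowers]; exact hg _
  obtain ⟨m, rfl⟩ := ht
  have h4 : (g : F) ^ a = ζ := by
    have := congrArg Units.val hga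
    simpa using this
  change χ (g ^ m) = algebraMap F Ω ((g ^ m : Fˣ) : F) ^ a
  rw [map_pow, hζ, ← h4, Units.val_pow_eq_pow_val, map_pow, map_pow, ← pow_mul, ← pow_mul, mul_comm]

section Weight

variable {N : ℕ} {F : Type*} [Field F] [Fintype F] [DecidableEq F] {Ω V : Type*} [Field Ω]
  [Algebra F Ω] [AddCommGroup V] [Module Ω V]
  (π : Matrix.SpecialLinearGroup (Fin (N + 1)) F →* Module.End Ω V)

/-- Every nonzero module contains a highest weight vector. -/
theorem exists_weight_vector {p : ℕ} [Fact p.Prime] [CharP F p] [CharP Ω p] {v : V} (hv : v ≠ 0) :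
    ∃ w : V, w ≠ 0 ∧ (∀ u ∈ upperU (N + 1) F, π u w = w) ∧ ∃ a : Fin N → ℕ, ∀ k,
      a k ≤ Fintype.card F - 1 ∧ (∀ t : Fˣ, π (sh k t) w = algebraMap F Ω (t : F) ^ a k • w) ∧
      hecke π k w = (if a k = Fintype.card F - 1 then -1 else 0 : Ω) • w := by
  classical
  have hP : IsPGroup p (upperU (N + 1) F) := isPGroup_upperU p
  obtain ⟨v₁, -, hv₁, hfix⟩ := exists_ne_zero_fixed hP (π.comp (upperU (N + 1) F).subtype)
    ⊤ (by simp) (Submodule.mem_top (x := v)) hv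
  let E : Submodule Ω V := ⨅ u ∈ upperU (N + 1) F, LinearMap.ker (π u - LinearMap.id)
  have hE : ∀ {w}, w ∈ E ↔ ∀ u ∈ upperU (N + 1) F, π u w = w := by
    intro w
    simp [E, sub_eq_zero]
  obtain ⟨v₂, hv₂E, hv₂, hdiag⟩ := exists_joint_eigenvector_of_pow_card (F := F)
    (fun h : {g : Matrix.SpecialLinearGroup (Fin (N + 1)) F // IsDiagSL g} => π h.1)
    (fun g h => by
      change π g.1 * π h.1 = π h.1 * π g.1
      rw [← map_mul, (g.2.commute h.2).eq, map_mul])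
    (fun g => by rw [← map_pow, g.2.pow_card]) Finset.univ E
    (fun h w hw => by
      rw [hE] at hw ⊢
      intro u hu
      have : u * h.1 = h.1 * (h.1⁻¹ * u * h.1) := by group
      rw [← Module.End.mul_apply, ← map_mul, this, map_mul, Module.End.mul_apply,
        hw _ (h.2.inv_mul_mul_mem_upperU hu)])
    (hE.2 fun u hu => hfix ⟨u, hu⟩) hv₁
  let B : Set V := {w | (∀ u ∈ upperU (N + 1) F, π u w = w) ∧ ∀ h, IsDiagSL h → ∃ c : Ω, π h w = c • w}
  have hBchar : ∀ w ∈ B, w ≠ 0 → ∀ k, ∃ χ : Fˣ →* Ω, ∀ t, π (sh k t) w = χ t • w := by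
    intro w hw hw0 k
    choose χ hχ using fun t => hw.2 (sh k t) (isDiagSL_sh k t)
    have inj : ∀ {c d : Ω}, c • w = d • w → c = d := fun h => smul_left_injective Ω hw0 h
    refine ⟨⟨⟨χ, inj ?_⟩, fun s t => inj ?_⟩, hχ⟩
    · rw [← hχ, one_smul]
      have : sh k (1 : Fˣ) = 1 := by
        have := sh_mul k (1 : Fˣ) 1
        rw [one_mul] at this
        exact (mul_eq_left.1 this.symm)
      rw [this, map_one, Module.End.one_apply]
    · change χ (s * t) • w = (χ s * χ t) • w
      rw [← hχ, sh_mul, map_mul, Module.End.mul_apply, hχ, map_smul, hχ, smul_smul, mul_comm]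
  have hBq : ∀ k, ∀ w ∈ B, ∃ κ : Ω, hecke π k (hecke π k w) = κ • hecke π k w := by
    intro k w hw
    by_cases hw0 : w = 0
    · exact ⟨0, by simp [hw0]⟩
    obtain ⟨χ, hχ⟩ := hBchar w hw hw0 k
    exact ⟨_, hecke_hecke_apply π (p := p) hw.1 k hχ⟩
  have hBs : ∀ k, ∀ w ∈ B, hecke π k w ∈ B := by
    intro k w hw
    refine ⟨fun u hu => map_hecke_apply π hw.1 k hu, fun h hh => ?_⟩
    obtain ⟨c, hc⟩ := hw.2 _ (hh.inv_sn_mul_mul_sn k)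
    exact ⟨c, map_diag_hecke_apply π hh k hc⟩
  let T : ℕ → Module.End Ω V := fun i => if h : i < N then hecke π ⟨i, h⟩ else 0
  have hT : ∀ i (h : i < N), T i = hecke π ⟨i, h⟩ := fun i h => dif_pos h
  obtain ⟨w, hwB, hw0, hc⟩ := exists_joint_eigenvector N T B
    (fun i hi w hw => by rw [hT i hi]; exact hBs _ w hw)
    (fun i hi w hw => by rw [hT i hi]; exact hBq _ w hw)
    (fun i j hij hj w => by
      rw [hT i (by omega), hT j hj]
      exact congrArg (fun f : Module.End Ω V => f w) (hecke_commute π (i := ⟨i, _⟩) (j := ⟨j, _⟩) hij))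
    (fun i hi w => by
      rw [hT i (by omega), hT (i + 1) hi]
      exact congrArg (fun f : Module.End Ω V => f w)
        (hecke_braid π (i := ⟨i, by omega⟩) (j := ⟨i + 1, hi⟩) rfl))
    (v := v₂) ⟨hE.1 hv₂E, fun h hh => hdiag ⟨h, hh⟩ (Finset.mem_univ _)⟩ hv₂
  refine ⟨w, hw0, hwB.1, ?_⟩
  have hk : ∀ k : Fin N, ∃ a : ℕ, a ≤ Fintype.card F - 1 ∧
      (∀ t : Fˣ, π (sh k t) w = algebraMap F Ω (t : F) ^ a • w) ∧
      hecke π k w = (if a = Fintype.card F - 1 then -1 else 0 : Ω) • w := by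
    intro k
    obtain ⟨c, hc⟩ := hc k k.2
    rw [hT k k.2] at hc
    obtain ⟨χ, hχ⟩ := hBchar w hwB hw0 k
    have hq := hecke_hecke_apply π (p := p) hwB.1 k hχ
    rw [hc, map_smul, hc, smul_smul, smul_smul] at hq
    have hq' := smul_left_injective Ω hw0 hq
    by_cases hc0 : c = 0
    · obtain ⟨a, ha, haχ⟩ := exists_exponent χ
      refine ⟨a, ha.le, fun t => by rw [hχ, haχ], ?_⟩
      rw [hc, hc0, if_neg ha.ne]
    · have h1 := mul_right_cancel₀ hc0 hq'
      by_cases hχ1 : χ = 1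
      · refine ⟨Fintype.card F - 1, le_rfl, fun t => ?_, ?_⟩
        · rw [hχ, hχ1, ← map_pow, ← Units.val_pow_eq_pow_val, ← Fintype.card_units, pow_card_eq_one]
          simp
        · rw [if_pos rfl, hc, h1, sum_hom_units, if_pos hχ1, Fintype.card_units,
            Nat.cast_sub Fintype.card_pos]
          have h0 : ((Fintype.card F : ℕ) : Ω) = 0 := by
            rw [CharP.cast_eq_zero_iff Ω p, ← CharP.cast_eq_zero_iff F p]
            exact Nat.cast_card_eq_zero F
          rw [h0]; simp
      · rw [sum_hom_units, if_neg hχ1, Nat.cast_zero] at h1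
        exact absurd h1 hc0
  choose a ha using hk
  exact ⟨a, ha⟩

end Weight

section Minor

variable {N : ℕ} {R : Type*} [CommRing R]

/-- The leading block of size `k + 1`. -/
def lead (k : Fin N) (M : Matrix (Fin (N + 1)) (Fin (N + 1)) R) :
    Matrix (Fin (k + 1)) (Fin (k + 1)) R :=
  M.submatrix (Fin.castLE (by omega)) (Fin.castLE (by omega))

/-- The leading principal minor of size `k + 1`. -/
def minor (k : Fin N) (M : Matrix (Fin (N + 1)) (Fin (N + 1)) R) : R := (lead k M).det

/-- The minor of size `k + 1` where the last column is replaced by the following one. -/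
def nextMinor (k : Fin N) (M : Matrix (Fin (N + 1)) (Fin (N + 1)) R) : R :=
  ((lead k M).updateCol (Fin.last k) fun i => M (Fin.castLE (by omega) i) k.succ).det

theorem lead_mul (k : Fin N) (M B : Matrix (Fin (N + 1)) (Fin (N + 1)) R)
    (hB : ∀ i j : Fin (N + 1), k.val < i.val → j.val ≤ k.val → B i j = 0) :
    lead k (M * B) = lead k M * lead k B := by
  ext i j
  simp only [lead, Matrix.submatrix_apply, Matrix.mul_apply]
  have hinj : Function.Injective (Fin.castLE (by omega : k.val + 1 ≤ N + 1)) :=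
    Fin.castLE_injective _
  rw [← Finset.sum_image (f := fun l => M (Fin.castLE _ i) l * B l (Fin.castLE _ j))
    (fun a _ b _ h => hinj h)]
  refine (Finset.sum_subset (Finset.subset_univ _) fun l _ hl => ?_).symm
  rw [hB l, mul_zero]
  · by_contra h
    exact hl (Finset.mem_image.2 ⟨⟨l, by omega⟩, Finset.mem_univ _, Fin.ext rfl⟩)
  · have := j.2
    simp only [Fin.val_castLE]
    omega

theorem minor_mul (k : Fin N) (M B : Matrix (Fin (N + 1)) (Fin (N + 1)) R)
    (hB : ∀ i j : Fin (N + 1), k.val < i.val → j.val ≤ k.val → B i j = 0) :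
    minor k (M * B) = minor k M * minor k B := by
  rw [minor, lead_mul k M B hB, det_mul, minor, minor]

theorem minor_transpose (k : Fin N) (M : Matrix (Fin (N + 1)) (Fin (N + 1)) R) :
    minor k Mᵀ = minor k M := by
  rw [minor, ← det_transpose]; rfl

theorem minor_eq_one_of_isUni (k : Fin N) {M : Matrix (Fin (N + 1)) (Fin (N + 1)) R}
    (hM : IsUni M) : minor k M = 1 := by
  rw [minor, det_of_isUpperTriangular]
  · exact Finset.prod_eq_one fun i _ => hM.apply_self _
  · intro i j hij
    exact hM.apply_lt hij

theorem minor_mul_of_isUni (k : Fin N) (M : Matrix (Fin (N + 1)) (Fin (N + 1)) R)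
    {B : Matrix (Fin (N + 1)) (Fin (N + 1)) R} (hB : IsUni B) : minor k (M * B) = minor k M := by
  rw [minor_mul, minor_eq_one_of_isUni k hB, mul_one]
  intro i j hi hj
  exact hB.apply_lt (lt_of_le_of_lt hj hi : j.val < i.val)

theorem minor_mul_sx (j k : Fin N) (M : Matrix (Fin (N + 1)) (Fin (N + 1)) R) (t : R) :
    minor j (M * (sx k t : Matrix.SpecialLinearGroup (Fin (N + 1)) R).1) = minor j M :=
  minor_mul_of_isUni _ _ (sx_mem_upperU k t)

theorem minor_mul_sy_of_ne {j k : Fin N} (hjk : j ≠ k) (M : Matrix (Fin (N + 1)) (Fin (N + 1)) R)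
    (t : R) : minor j (M * (sy k t : Matrix.SpecialLinearGroup (Fin (N + 1)) R).1) = minor j M := by
  have h := sy_mem_lowerU k t
  rw [minor_mul, ← minor_transpose j (sy k t).1, minor_eq_one_of_isUni _ h, mul_one]
  intro x y hx hy
  rw [sy, transvection_coe, Matrix.add_apply, Matrix.single_apply, Matrix.one_apply_ne, if_neg,
    zero_add]
  · rintro ⟨rfl, rfl⟩
    simp only [Fin.val_succ, Fin.val_castSucc] at hx hy
    exact hjk (Fin.ext (by omega))
  · rintro rfl; omega

theorem mul_sy_apply (k : Fin N) (M : Matrix (Fin (N + 1)) (Fin (N + 1)) R) (t : R)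
    (i j : Fin (N + 1)) : (M * (sy k t : Matrix.SpecialLinearGroup (Fin (N + 1)) R).1) i j =
      M i j + if j = k.castSucc then t * M i k.succ else 0 := by
  rw [sy, transvection_coe, mul_add, mul_one, Matrix.add_apply]
  congr 1
  rw [Matrix.mul_apply, Finset.sum_eq_single k.succ]
  · by_cases h : j = k.castSucc
    · subst h; simp [mul_comm]
    · simp [h, Ne.symm h]
  · intro l _ hl
    simp [Ne.symm hl]
  · simp

theorem mul_sx_apply (k : Fin N) (M : Matrix (Fin (N + 1)) (Fin (N + 1)) R) (t : R)
    (i j : Fin (N + 1)) : (M * (sx k t : Matrix.SpecialLinearGroup (Fin (N + 1)) R).1) i j =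
      M i j + if j = k.succ then t * M i k.castSucc else 0 := by
  rw [sx, transvection_coe, mul_add, mul_one, Matrix.add_apply]
  congr 1
  rw [Matrix.mul_apply, Finset.sum_eq_single k.castSucc]
  · by_cases h : j = k.succ
    · subst h; simp [mul_comm]
    · simp [h, Ne.symm h]
  · intro l _ hl
    simp [Ne.symm hl]
  · simp

theorem minor_mul_sy (k : Fin N) (M : Matrix (Fin (N + 1)) (Fin (N + 1)) R) (t : R) :
    minor k (M * (sy k t : Matrix.SpecialLinearGroup (Fin (N + 1)) R).1) =
      minor k M + t * nextMinor k M := by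
  have h1 : lead k (M * (sy k t : Matrix.SpecialLinearGroup (Fin (N + 1)) R).1) =
      (lead k M).updateCol (Fin.last k) ((lead k M).col (Fin.last k) +
        t • fun i => M (Fin.castLE (by omega) i) k.succ) := by
    ext i j
    simp only [lead, Matrix.submatrix_apply, mul_sy_apply, Matrix.updateCol_apply]
    by_cases hj : j = Fin.last k
    · subst hj
      rw [if_pos (Fin.ext (by simp)), if_pos rfl]
      simp
    · rw [if_neg, if_neg hj, add_zero]
      rintro h
      have := congrArg Fin.val h
      exact hj (Fin.ext (by simpa using this))
  rw [minor, h1, det_updateCol_add, det_updateCol_smul, minor, nextMinor]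
  congr 2
  ext i j
  simp only [Matrix.updateCol_apply]
  split_ifs with h
  · rw [h]; rfl
  · rfl

theorem nextMinor_mul_sx (k : Fin N) (M : Matrix (Fin (N + 1)) (Fin (N + 1)) R) (t : R) :
    nextMinor k (M * (sx k t : Matrix.SpecialLinearGroup (Fin (N + 1)) R).1) =
      nextMinor k M + t * minor k M := by
  have h1 : lead k (M * (sx k t : Matrix.SpecialLinearGroup (Fin (N + 1)) R).1) = lead k M := by
    ext i j
    simp only [lead, Matrix.submatrix_apply, mul_sx_apply]
    rw [if_neg, add_zero]
    rintro h
    have := congrArg Fin.val h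
    have := j.2
    simp at *
    omega
  have h2 : (fun i : Fin (k + 1) => (M * (sx k t : Matrix.SpecialLinearGroup (Fin (N + 1)) R).1)
      (Fin.castLE (by omega) i) k.succ) = (fun i => M (Fin.castLE (by omega) i) k.succ) +
        t • (lead k M).col (Fin.last k) := by
    ext i
    simp only [mul_sx_apply, if_pos rfl, Pi.add_apply, Pi.smul_apply, smul_eq_mul]
    rfl
  rw [nextMinor, h1, h2, det_updateCol_add, det_updateCol_smul, minor, nextMinor]
  congr 3
  ext i j
  simp only [Matrix.updateCol_apply]
  split_ifs with h
  · rw [h]; rfl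
  · rfl

theorem minor_mul_diagonal (k : Fin N) (M : Matrix (Fin (N + 1)) (Fin (N + 1)) R)
    (d : Fin (N + 1) → R) : minor k (M * diagonal d) =
      minor k M * ∏ i : Fin (k + 1), d (Fin.castLE (by omega) i) := by
  rw [minor_mul]
  · congr 1
    rw [minor, ← det_diagonal]
    congr 1
    ext i j
    simp [lead, diagonal_apply]
  · intro i j hi hj
    rw [diagonal_apply_ne]
    rintro rfl
    omega

theorem prod_castLE_eq (k j : Fin N) {F : Type*} [Field F] {t : F} (ht : t ≠ 0) :
    (∏ i : Fin (j + 1), if (Fin.castLE (by omega) i : Fin (N + 1)) = k.castSucc then t else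
      if (Fin.castLE (by omega) i : Fin (N + 1)) = k.succ then t⁻¹ else 1) =
      if j = k then t else 1 := by
  have hp : ∀ m : ℕ, (∏ i ∈ Finset.range m, if i = k.val then t else if i = k.val + 1 then t⁻¹ else 1)
      = if m = k.val + 1 then t else 1 := by
    intro m
    induction m with
    | zero => simp
    | succ m ih =>
      rw [Finset.prod_range_succ, ih]
      split_ifs <;> first | omega | simp [ht]
  have := hp (j + 1)
  rw [Finset.prod_range] at this
  simp only [Fin.ext_iff, Fin.val_castLE, Fin.val_castSucc, Fin.val_succ]
  rw [this]
  split_ifs <;> first | omega | rfl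

theorem minor_mul_sx_mul_sn_of_ne {j k : Fin N} (hjk : j ≠ k)
    (M : Matrix (Fin (N + 1)) (Fin (N + 1)) R) (t : R) :
    minor j (M * (sx k t * sn R k : Matrix.SpecialLinearGroup (Fin (N + 1)) R).1) = minor j M := by
  rw [sn_eq, Matrix.SpecialLinearGroup.coe_mul, Matrix.SpecialLinearGroup.coe_mul,
    Matrix.SpecialLinearGroup.coe_mul, ← mul_assoc, ← mul_assoc, ← mul_assoc, minor_mul_sx,
    minor_mul_sy_of_ne hjk, minor_mul_sx, minor_mul_sx]

theorem minor_mul_sx_mul_sn (k : Fin N) (M : Matrix (Fin (N + 1)) (Fin (N + 1)) R) (t : R) :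
    minor k (M * (sx k t * sn R k : Matrix.SpecialLinearGroup (Fin (N + 1)) R).1) =
      -nextMinor k M - t * minor k M := by
  rw [sn_eq, Matrix.SpecialLinearGroup.coe_mul, Matrix.SpecialLinearGroup.coe_mul,
    Matrix.SpecialLinearGroup.coe_mul, ← mul_assoc, ← mul_assoc, ← mul_assoc, minor_mul_sx,
    minor_mul_sy, minor_mul_sx, minor_mul_sx, nextMinor_mul_sx, nextMinor_mul_sx, minor_mul_sx]
  ring

/-- The product of powers of leading principal minors. -/
def minorProd (a : Fin N → ℕ) (M : Matrix (Fin (N + 1)) (Fin (N + 1)) R) : R :=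
  ∏ k, minor k M ^ a k

theorem minorProd_transpose (a : Fin N → ℕ) (M : Matrix (Fin (N + 1)) (Fin (N + 1)) R) :
    minorProd a Mᵀ = minorProd a M := by
  simp only [minorProd, minor_transpose]

theorem minorProd_mul_of_isUni (a : Fin N → ℕ) (M : Matrix (Fin (N + 1)) (Fin (N + 1)) R)
    {B : Matrix (Fin (N + 1)) (Fin (N + 1)) R} (hB : IsUni B) :
    minorProd a (M * B) = minorProd a M := by
  simp only [minorProd, minor_mul_of_isUni _ _ hB]

theorem minorProd_eq_one_of_isUni (a : Fin N → ℕ) {M : Matrix (Fin (N + 1)) (Fin (N + 1)) R}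
    (hM : IsUni M) : minorProd a M = 1 := by
  simp only [minorProd, minor_eq_one_of_isUni _ hM, one_pow, Finset.prod_const_one]

end Minor

theorem sum_add_mul_pow {F Ω : Type*} [Field F] [Fintype F] [Field Ω] [Algebra F Ω] (A B : Ω)
    {a : ℕ} (ha : a ≤ Fintype.card F - 1) :
    ∑ t : F, (A + algebraMap F Ω t * B) ^ a =
      if a = Fintype.card F - 1 then -B ^ a else 0 := by
  have hs : ∀ i ≤ a, (∑ t : F, algebraMap F Ω t ^ i) =
      if i = Fintype.card F - 1 then -1 else 0 := by
    intro i hi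
    simp only [← map_pow, ← map_sum]
    split_ifs with h
    · classical
      have h1 : ∀ t : F, t ^ i = 1 - if t = 0 then 1 else 0 := by
        intro t
        split_ifs with ht
        · have := Fintype.one_lt_card (α := F)
          rw [ht, zero_pow (by omega), sub_self]
        · rw [h, FiniteField.pow_card_sub_one_eq_one t ht, sub_zero]
      simp [h1]
    · rw [FiniteField.sum_pow_lt_card_sub_one _ _ (by omega), map_zero]
  simp only [add_comm A, add_pow, mul_pow]
  rw [Finset.sum_comm]
  have : ∀ i ∈ Finset.range (a + 1), ∑ t : F, algebraMap F Ω t ^ i * B ^ i * A ^ (a - i) *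
      (a.choose i : Ω) = if i = Fintype.card F - 1 then -(B ^ i * A ^ (a - i) * (a.choose i : Ω))
        else 0 := by
    intro i hi
    simp only [mul_assoc]
    rw [← Finset.sum_mul, hs i (Nat.lt_succ_iff.1 (Finset.mem_range.1 hi))]
    split_ifs <;> ring
  rw [Finset.sum_congr rfl this]
  split_ifs with h
  · subst h
    rw [Finset.sum_ite_eq']
    simp
  · refine Finset.sum_eq_zero fun i hi => if_neg ?_
    have := Finset.mem_range.1 hi
    omega

section

variable {N : ℕ} {F Ω : Type*} [Field F] [Field Ω] [Algebra F Ω]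

/-- Base change of matrices of determinant one. -/
def baseChange (n : ℕ) (F Ω : Type*) [Field F] [Field Ω] [Algebra F Ω] :
    Matrix.SpecialLinearGroup (Fin n) F →* Matrix.SpecialLinearGroup (Fin n) Ω :=
  Matrix.SpecialLinearGroup.map (algebraMap F Ω)

theorem baseChange_apply {n : ℕ} (g : Matrix.SpecialLinearGroup (Fin n) F) (i j : Fin n) :
    (baseChange n F Ω g) i j = algebraMap F Ω (g i j) := rfl

theorem baseChange_transvection {n : ℕ} {i j : Fin n} (hij : i ≠ j) (t : F) :
    baseChange n F Ω (transvection hij t) = transvection hij (algebraMap F Ω t) := by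
  ext x y
  rw [baseChange_apply, transvection_coe, transvection_coe, Matrix.add_apply, Matrix.add_apply,
    map_add, Matrix.one_apply, Matrix.one_apply, Matrix.single_apply, Matrix.single_apply]
  split_ifs <;> simp

@[simp] theorem baseChange_sx (k : Fin N) (t : F) :
    baseChange (N + 1) F Ω (sx k t) = sx k (algebraMap F Ω t) := baseChange_transvection _ _

@[simp] theorem baseChange_sy (k : Fin N) (t : F) :
    baseChange (N + 1) F Ω (sy k t) = sy k (algebraMap F Ω t) := baseChange_transvection _ _

@[simp] theorem baseChange_sn (k : Fin N) : baseChange (N + 1) F Ω (sn F k) = sn Ω k := by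
  rw [sn_eq, sn_eq, map_mul, map_mul, baseChange_sx, baseChange_sy, map_neg, map_one]

theorem sh_coe (k : Fin N) (t : Fˣ) : (sh k t).1 =
    diagonal fun i => if i = k.castSucc then (t : F) else if i = k.succ then (t : F)⁻¹ else 1 :=
  diag2n_coe _ _ _

theorem minor_baseChange_mul_sh (j k : Fin N) (M : Matrix (Fin (N + 1)) (Fin (N + 1)) Ω) (t : Fˣ) :
    minor j (M * (baseChange (N + 1) F Ω (sh k t)).1) =
      if j = k then algebraMap F Ω t * minor j M else minor j M := by
  have : (baseChange (N + 1) F Ω (sh k t)).1 = diagonal fun i => if i = k.castSucc then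
      algebraMap F Ω (t : F) else if i = k.succ then (algebraMap F Ω (t : F))⁻¹ else 1 := by
    ext i j
    change algebraMap F Ω ((sh k t).1 i j) = _
    rw [sh_coe, diagonal_apply, diagonal_apply]
    split_ifs <;> simp
  rw [this, minor_mul_diagonal, prod_castLE_eq k j (by simp)]
  split_ifs <;> ring

theorem baseChange_mem_lowerU {n : ℕ} {u : Matrix.SpecialLinearGroup (Fin n) F}
    (hu : u ∈ lowerU n F) : baseChange n F Ω u ∈ lowerU n Ω := by
  intro i j hij
  have := hu i j hij
  rw [Matrix.transpose_apply] at this ⊢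
  rw [baseChange_apply, this, Matrix.one_apply, Matrix.one_apply]
  split_ifs <;> simp

theorem minorProd_mul_sx (a : Fin N → ℕ) (M : Matrix (Fin (N + 1)) (Fin (N + 1)) Ω) (k : Fin N)
    (t : Ω) : minorProd a (M * (sx k t).1) = minorProd a M :=
  minorProd_mul_of_isUni _ _ (sx_mem_upperU k t)

theorem minorProd_mul_sh (a : Fin N → ℕ) (M : Matrix (Fin (N + 1)) (Fin (N + 1)) Ω) (k : Fin N)
    (t : Fˣ) : minorProd a (M * (baseChange (N + 1) F Ω (sh k t)).1) =
      algebraMap F Ω t ^ a k * minorProd a M := by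
  simp only [minorProd, minor_baseChange_mul_sh]
  rw [← Finset.mul_prod_erase _ _ (Finset.mem_univ k),
    ← Finset.mul_prod_erase (a := k) _ _ (Finset.mem_univ k), if_pos rfl, mul_pow, mul_assoc]
  congr 2
  exact Finset.prod_congr rfl fun j hj => by rw [if_neg (Finset.ne_of_mem_erase hj)]

theorem minorProd_mul_sx_mul_sn [Fintype F] {a : Fin N → ℕ} {k : Fin N}
    (ha : a k ≤ Fintype.card F - 1) (M : Matrix (Fin (N + 1)) (Fin (N + 1)) Ω) :
    ∑ t : F, minorProd a (M * (sx k (algebraMap F Ω t) * sn Ω k).1) =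
      (if a k = Fintype.card F - 1 then -1 else 0) * minorProd a M := by
  have h1 : ∀ t : F, minorProd a (M * (sx k (algebraMap F Ω t) * sn Ω k).1) =
      (-nextMinor k M + algebraMap F Ω t * (-minor k M)) ^ a k *
        ∏ j ∈ Finset.univ.erase k, minor j M ^ a j := by
    intro t
    rw [minorProd, ← Finset.mul_prod_erase _ _ (Finset.mem_univ k), minor_mul_sx_mul_sn]
    congr 1
    · ring
    · exact Finset.prod_congr rfl fun j hj => by
        rw [minor_mul_sx_mul_sn_of_ne (Finset.ne_of_mem_erase hj)]
  simp only [h1]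
  rw [← Finset.sum_mul, sum_add_mul_pow _ _ ha, minorProd,
    ← Finset.mul_prod_erase _ _ (Finset.mem_univ k)]
  split_ifs with h
  · have : (-1 : Ω) ^ a k = 1 := by
      have := FiniteField.pow_card_sub_one_eq_one (-1 : F) (by simp)
      rw [h]
      simpa using congrArg (algebraMap F Ω) this
    rw [neg_pow, this]
    ring
  · ring

theorem exists_minorProd_mem [Fintype F] {p : ℕ} [Fact p.Prime] [CharP F p] [CharP Ω p]
    (hN : 0 < N) (C : Submodule Ω (Matrix.SpecialLinearGroup (Fin (N + 1)) F → Ω)) (hC : C ≠ ⊥)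
    (hl : ∀ b, ∀ h ∈ C, (fun g => h (b * g)) ∈ C) (hr : ∀ b, ∀ h ∈ C, (fun g => h (g * b)) ∈ C) :
    ∃ a : Fin N → ℕ, (∀ k, a k ≤ Fintype.card F - 1) ∧
      (fun g => minorProd a (baseChange (N + 1) F Ω g).1) ∈ C := by
  classical
  let π : Matrix.SpecialLinearGroup (Fin (N + 1)) F →* Module.End Ω C :=
    { toFun := fun b => (LinearMap.funLeft Ω Ω (· * b)).restrict (hr b)
      map_one' := by
        ext h g
        simp [LinearMap.funLeft]
      map_mul' := fun b b' => by
        ext h g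
        simp [LinearMap.funLeft, mul_assoc] }
  have hπ : ∀ b (h : C) g, (π b h).1 g = h.1 (g * b) := fun b h g => rfl
  obtain ⟨x, hxC, hx⟩ := Submodule.exists_mem_ne_zero_of_ne_bot hC
  obtain ⟨w, hw, hwU, a, ha⟩ := exists_weight_vector (p := p) π (v := (⟨x, hxC⟩ : C))
    (by simpa using hx)
  refine ⟨a, fun k => (ha k).1, ?_⟩
  let c : Fin N → Ω := fun k => if a k = Fintype.card F - 1 then -1 else 0
  let D : Submodule Ω (Matrix.SpecialLinearGroup (Fin (N + 1)) F → Ω) :=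
    { carrier := {d | (∀ g k t, d (g * sx k t) = d g) ∧
        (∀ g k (t : Fˣ), d (g * sh k t) = algebraMap F Ω t ^ a k * d g) ∧
        ∀ g k, ∑ t : F, d (g * (sx k t * sn F k)) = c k * d g}
      zero_mem' := by simp
      add_mem' := by
        rintro d d' ⟨h1, h2, h3⟩ ⟨h1', h2', h3'⟩
        refine ⟨fun g k t => ?_, fun g k t => ?_, fun g k => ?_⟩
        · simp [h1, h1']
        · simp [h2, h2', mul_add]
        · simp [Finset.sum_add_distrib, h3, h3', mul_add]
      smul_mem' := by
        rintro r d ⟨h1, h2, h3⟩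
        refine ⟨fun g k t => ?_, fun g k t => ?_, fun g k => ?_⟩
        · simp [h1]
        · simp [h2, mul_left_comm]
        · simp [← Finset.mul_sum, h3, mul_left_comm] }
  have hDl : ∀ b, ∀ d ∈ D, (fun g => d (b * g)) ∈ D := by
    rintro b d ⟨h1, h2, h3⟩
    refine ⟨fun g k t => ?_, fun g k t => ?_, fun g k => ?_⟩
    · beta_reduce; rw [← mul_assoc, h1]
    · beta_reduce; rw [← mul_assoc, h2]
    · simp only [← mul_assoc] at h3 ⊢
      exact h3 (b * g) k
  have hwD : w.1 ∈ D := by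
    refine ⟨fun g k t => ?_, fun g k t => ?_, fun g k => ?_⟩
    · rw [← hπ, hwU _ (sx_mem_upperU k t)]
    · rw [← hπ, (ha k).2.1]; rfl
    · have := congrFun (congrArg Subtype.val (ha k).2.2) g
      rw [hecke_apply] at this
      rw [AddSubmonoidClass.coe_finsetSum, Finset.sum_apply] at this
      exact this
  let lam : Matrix.SpecialLinearGroup (Fin (N + 1)) F →*
      Module.End Ω (Matrix.SpecialLinearGroup (Fin (N + 1)) F → Ω) :=
    { toFun := fun b => LinearMap.funLeft Ω Ω (b⁻¹ * ·)
      map_one' := by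
        ext h g
        simp [LinearMap.funLeft]
      map_mul' := fun b b' => by
        ext h g
        simp [LinearMap.funLeft, mul_assoc] }
  have hlam : ∀ b h g, lam b h g = h (b⁻¹ * g) := fun b h g => rfl
  obtain ⟨d, ⟨hdC, hdD⟩, hd, hfix⟩ := exists_ne_zero_fixed
    (isPGroup_lowerU (n := N + 1) (R := F) p) (lam.comp (lowerU (N + 1) F).subtype) (C ⊓ D)
    (fun g v hv => ⟨hl _ v hv.1, hDl _ v hv.2⟩) (x := w.1) ⟨w.2, hwD⟩ (by simpa using hw)
  have hdl : ∀ u ∈ lowerU (N + 1) F, d u = d 1 := by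
    intro u hu
    have := congrFun (hfix ⟨u, hu⟩) u
    change d (u⁻¹ * u) = d u at this
    rw [← this, inv_mul_cancel]
  have key : ∀ e ∈ D, (∀ u ∈ lowerU (N + 1) F, e u = 0) → e = 0 := by
    rintro e ⟨h1, h2, h3⟩ h0
    funext g
    refine eq_zero_of_forall_lowerU hN e h1 (fun g k t h => by rw [h2, h, mul_zero]) ?_ h0 g
    intro g k hy
    have h4 := h3 g k
    rw [show e g = 0 by simpa using hy 0, mul_zero, ← Finset.add_sum_erase _ _ (Finset.mem_univ 0),
      sx_zero, one_mul, Finset.sum_eq_zero, add_zero] at h4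
    · exact h4
    · intro t ht
      have ht : t ≠ 0 := Finset.ne_of_mem_erase ht
      have := sx_mul_sn' k (Units.mk0 t ht)
      rw [Units.val_mk0] at this
      rw [this, ← mul_assoc, ← mul_assoc, h1, h2, hy, mul_zero]
  let f : Matrix.SpecialLinearGroup (Fin (N + 1)) F → Ω :=
    fun g => minorProd a (baseChange (N + 1) F Ω g).1
  have hfD : f ∈ D := by
    refine ⟨fun g k t => ?_, fun g k t => ?_, fun g k => ?_⟩
    · simp only [f, map_mul, baseChange_sx]
      exact minorProd_mul_sx _ _ _ _
    · simp only [f, map_mul]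
      exact minorProd_mul_sh _ _ _ _
    · simp only [f, map_mul, baseChange_sx, baseChange_sn]
      exact minorProd_mul_sx_mul_sn (ha k).1 _
  have hf1 : ∀ u ∈ lowerU (N + 1) F, f u = 1 := by
    intro u hu
    have : IsUni (baseChange (N + 1) F Ω u).1ᵀ := baseChange_mem_lowerU hu
    simp only [f]
    rw [← minorProd_transpose, minorProd_eq_one_of_isUni _ this]
  have hd1 : d 1 ≠ 0 := fun h => hd (key d hdD fun u hu => by rw [hdl u hu, h])
  have heq : d = d 1 • f := by
    rw [← sub_eq_zero]
    refine key _ (D.sub_mem hdD (D.smul_mem _ hfD)) fun u hu => ?_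
    simp [hdl u hu, hf1 u hu]
  change f ∈ C
  rw [show f = (d 1)⁻¹ • d by rw [heq]; simp [hd1, hf1 1 (one_mem _)]]
  exact C.smul_mem _ hdC

end

theorem mul_transvection_apply {n : ℕ} {R : Type*} [CommRing R]
    (g : Matrix.SpecialLinearGroup (Fin n) R) {i j : Fin n} (hij : i ≠ j) (c : R) (x y : Fin n) :
    (g * transvection hij c) x y = g x y + if y = j then c * g x i else 0 := by
  rw [Matrix.SpecialLinearGroup.coe_mul, transvection_coe, mul_add, mul_one, Matrix.add_apply]
  congr 1
  rw [Matrix.mul_apply, Finset.sum_eq_single i]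
  · by_cases h : y = j
    · subst h; simp [mul_comm]
    · simp [h, Ne.symm h]
  · intro l _ hl
    simp [Ne.symm hl]
  · simp

theorem lowerU_le_of_sy_mem {N : ℕ} {F : Type*} [Field F]
    (H : Subgroup (Matrix.SpecialLinearGroup (Fin (N + 1)) F)) (h : ∀ k t, sy k t ∈ H) :
    lowerU (N + 1) F ≤ H := by
  classical
  intro u hu
  induction hc : (Finset.univ.filter fun x : Fin (N + 1) × Fin (N + 1) =>
    x.2 < x.1 ∧ u x.1 x.2 ≠ 0).card using Nat.strong_induction_on generalizing u with
  | _ c ih =>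
  set S := Finset.univ.filter fun x : Fin (N + 1) × Fin (N + 1) => x.2 < x.1 ∧ u x.1 x.2 ≠ 0 with hS
  have hu' : ∀ i j, i ≤ j → u i j = (1 : Matrix (Fin (N + 1)) (Fin (N + 1)) F) i j := by
    intro i j hij
    have := hu j i hij
    rw [Matrix.transpose_apply] at this
    rw [this, Matrix.one_apply, Matrix.one_apply]
    simp only [eq_comm]
  rcases S.eq_empty_or_nonempty with h0 | hne
  · have : u = 1 := by
      ext i j
      rcases le_or_gt i j with hij | hij
      · exact hu' i j hij
      · have : (i, j) ∉ S := by rw [h0]; simp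
        simp only [hS, Finset.mem_filter, Finset.mem_univ, true_and, not_and, not_not] at this
        rw [this hij, Matrix.SpecialLinearGroup.coe_one, Matrix.one_apply_ne hij.ne']
    rw [this]
    exact H.one_mem
  · obtain ⟨⟨i, m⟩, him, hmax⟩ := S.exists_max_image (fun x => x.2) hne
    have him' : m < i ∧ u i m ≠ 0 := by simpa [hS] using him
    have hcol : ∀ x, u x i = (1 : Matrix (Fin (N + 1)) (Fin (N + 1)) F) x i := by
      intro x
      rcases le_or_gt x i with hxi | hxi
      · exact hu' x i hxi
      · rw [Matrix.one_apply_ne hxi.ne']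
        by_contra hne
        have := hmax (x, i) (by simp [hS, hxi, hne])
        exact absurd him'.1 (not_lt.2 this)
    have ht := transvection_mem_of_sy_mem H h him'.1 (-u i m)
    have htU : transvection him'.1.ne' (-u i m) ∈ lowerU (N + 1) F := by
      intro x y hxy
      rw [Matrix.transpose_apply, transvection_coe, Matrix.add_apply, Matrix.single_apply, if_neg,
        add_zero, Matrix.one_apply, Matrix.one_apply]
      · simp only [eq_comm]
      · rintro ⟨rfl, rfl⟩
        exact absurd him'.1 (not_lt.2 hxy)
    rw [← H.mul_mem_cancel_right ht]
    have happ : ∀ x y, (u * transvection him'.1.ne' (-u i m)) x y =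
        if x = i ∧ y = m then 0 else u x y := by
      intro x y
      rw [mul_transvection_apply, hcol, Matrix.one_apply]
      by_cases hy : y = m
      · by_cases hx : x = i
        · subst hx hy; simp
        · simp [hx]
      · simp [hy]
    refine ih _ ?_ (mul_mem hu htU) rfl
    rw [← hc]
    refine Finset.card_lt_card ⟨?_, fun hsub => ?_⟩
    · intro x
      simp only [Finset.mem_filter, Finset.mem_univ, true_and, happ, hS]
      rintro ⟨h1, h2⟩
      exact ⟨h1, fun h3 => h2 (by rw [h3]; simp)⟩
    · have := hsub him
      simp [happ] at this

section EvalMatrix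

variable {n : ℕ} {Ω A B : Type*} [Field Ω] [CommRing A] [Algebra Ω A] [CommRing B] [Algebra Ω B]

/-- Evaluation of a polynomial in matrix entries. -/
noncomputable def evM (M : Matrix (Fin n) (Fin n) A) :
    MvPolynomial (Fin n × Fin n) Ω →ₐ[Ω] A := MvPolynomial.aeval fun x => M x.1 x.2

theorem map_evM (φ : A →ₐ[Ω] B) (M : Matrix (Fin n) (Fin n) A)
    (w : MvPolynomial (Fin n × Fin n) Ω) : φ (evM M w) = evM (M.map φ) w := by
  have : φ.comp (evM M) = evM (M.map φ) := by
    ext x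
    simp [evM]
  rw [← this]; rfl

theorem evM_ext [Infinite Ω] {w w' : MvPolynomial (Fin n × Fin n) Ω}
    (h : ∀ M : Matrix (Fin n) (Fin n) Ω, evM M w = evM M w') : w = w' := by
  refine MvPolynomial.funext fun x => ?_
  have := h (Matrix.of fun i j => x (i, j))
  have h2 : ∀ w : MvPolynomial (Fin n × Fin n) Ω,
      evM (Matrix.of fun i j => x (i, j)) w = MvPolynomial.eval x w := fun w => by
    rw [evM, MvPolynomial.aeval_eq_eval]
    rfl
  rw [← h2, ← h2, this]

/-- Substitution of the left multiplication by a matrix. -/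
noncomputable def leftT (T : Matrix (Fin n) (Fin n) Ω) :
    MvPolynomial (Fin n × Fin n) Ω →ₐ[Ω] MvPolynomial (Fin n × Fin n) Ω :=
  evM (T.map (algebraMap Ω _) * mvPolynomialX (Fin n) (Fin n) Ω)

theorem map_mvPolynomialX_evM (M : Matrix (Fin n) (Fin n) A) :
    (mvPolynomialX (Fin n) (Fin n) Ω).map (evM M) = M := by
  ext i j
  simp [evM]

theorem map_algebraMap_map (φ : A →ₐ[Ω] B) (T : Matrix (Fin n) (Fin n) Ω) :
    (T.map (algebraMap Ω A)).map φ = T.map (algebraMap Ω B) := by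
  ext i j
  simp

theorem evM_leftT (T : Matrix (Fin n) (Fin n) Ω) (M : Matrix (Fin n) (Fin n) A)
    (w : MvPolynomial (Fin n × Fin n) Ω) :
    evM M (leftT T w) = evM (T.map (algebraMap Ω A) * M) w := by
  rw [leftT, map_evM]
  congr 2
  refine (Matrix.map_mul (f := (evM M).toRingHom)).trans ?_
  congr 1
  · exact map_algebraMap_map (evM M) T
  · exact map_mvPolynomialX_evM M

end EvalMatrix

section Leading

variable {N : ℕ} {Ω : Type*} [Field Ω]

theorem map_minorProd {A B : Type*} [CommRing A] [CommRing B] (φ : A →+* B) (a : Fin N → ℕ)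
    (M : Matrix (Fin (N + 1)) (Fin (N + 1)) A) :
    φ (minorProd a M) = minorProd a (M.map φ) := by
  rw [minorProd, map_prod, minorProd]
  refine Finset.prod_congr rfl fun k _ => ?_
  rw [map_pow, minor, RingHom.map_det]
  rfl

/-- The product of powers of leading minors of the generic matrix multiplied by `T`. -/
noncomputable def minorPoly (a : Fin N → ℕ) (T : Matrix (Fin (N + 1)) (Fin (N + 1)) Ω) :
    MvPolynomial (Fin (N + 1) × Fin (N + 1)) Ω :=
  leftT T (minorProd a (mvPolynomialX (Fin (N + 1)) (Fin (N + 1)) Ω))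

theorem evM_minorPoly {A : Type*} [CommRing A] [Algebra Ω A] (a : Fin N → ℕ)
    (T : Matrix (Fin (N + 1)) (Fin (N + 1)) Ω) (M : Matrix (Fin (N + 1)) (Fin (N + 1)) A) :
    evM M (minorPoly a T) = minorProd a (T.map (algebraMap Ω A) * M) := by
  rw [minorPoly, evM_leftT]
  refine (map_minorProd (evM _).toRingHom a _).trans ?_
  congr 1
  exact map_mvPolynomialX_evM _

open Polynomial in
/-- The polynomials in matrix entries which are highest weight vectors for right translations. -/
noncomputable def weightSpace (a : Fin N → ℕ) :
    Submodule Ω (MvPolynomial (Fin (N + 1) × Fin (N + 1)) Ω) where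
  carrier := {w | (∀ (M : Matrix (Fin (N + 1)) (Fin (N + 1)) Ω) k (t : Ω),
      evM (M * (sx k t).1) w = evM M w) ∧
    (∀ (M : Matrix (Fin (N + 1)) (Fin (N + 1)) Ω) d,
      evM (M * diagonal d) w = minorProd a (diagonal d) * evM M w) ∧
    ∀ (M : Matrix (Fin (N + 1)) (Fin (N + 1)) Ω) k,
      (evM (M.map (algebraMap Ω (Polynomial Ω)) * (sy k (X : (Polynomial Ω))).1) w).natDegree ≤ a k}
  zero_mem' := by simp
  add_mem' := by
    rintro w w' ⟨h1, h2, h3⟩ ⟨h1', h2', h3'⟩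
    refine ⟨fun M k t => ?_, fun M d => ?_, fun M k => ?_⟩
    · rw [map_add, map_add, h1, h1']
    · rw [map_add, map_add, h2, h2', mul_add]
    · rw [map_add]
      exact natDegree_add_le_of_degree_le (h3 M k) (h3' M k)
  smul_mem' := by
    rintro r w ⟨h1, h2, h3⟩
    refine ⟨fun M k t => ?_, fun M d => ?_, fun M k => ?_⟩
    · rw [map_smul, map_smul, h1]
    · rw [map_smul, map_smul, h2, smul_eq_mul, smul_eq_mul, mul_left_comm]
    · rw [map_smul]
      exact (natDegree_smul_le _ _).trans (h3 M k)

theorem leftT_mem_weightSpace {a : Fin N → ℕ} {w : MvPolynomial (Fin (N + 1) × Fin (N + 1)) Ω}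
    (hw : w ∈ weightSpace a) (T : Matrix (Fin (N + 1)) (Fin (N + 1)) Ω) :
    leftT T w ∈ weightSpace a := by
  obtain ⟨h1, h2, h3⟩ := hw
  refine ⟨fun M k t => ?_, fun M d => ?_, fun M k => ?_⟩
  · rw [evM_leftT, evM_leftT, ← mul_assoc, h1]
  · rw [evM_leftT, evM_leftT, ← mul_assoc, h2]
  · rw [evM_leftT, ← mul_assoc, ← Matrix.map_mul]
    exact h3 _ k

open Polynomial in
theorem minorPoly_mem_weightSpace (a : Fin N → ℕ) (T : Matrix (Fin (N + 1)) (Fin (N + 1)) Ω) :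
    minorPoly a T ∈ weightSpace a := by
  refine leftT_mem_weightSpace ?_ T
  have hev : ∀ {A : Type _} [CommRing A] [Algebra Ω A] (M : Matrix (Fin (N + 1)) (Fin (N + 1)) A),
      evM M (minorProd a (mvPolynomialX (Fin (N + 1)) (Fin (N + 1)) Ω)) = minorProd a M := by
    intro A _ _ M
    refine (map_minorProd (evM M).toRingHom a _).trans ?_
    congr 1
    exact map_mvPolynomialX_evM M
  refine ⟨fun M k t => ?_, fun M d => ?_, fun M k => ?_⟩
  · rw [hev, hev]
    exact minorProd_mul_of_isUni _ _ (sx_mem_upperU k t)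
  · rw [hev, hev, mul_comm, minorProd, minorProd, minorProd, ← Finset.prod_mul_distrib]
    refine Finset.prod_congr rfl fun k _ => ?_
    rw [← mul_pow, minor_mul]
    intro i j hi hj
    rw [diagonal_apply_ne]
    rintro rfl
    omega
  · rw [hev, minorProd, ← Finset.mul_prod_erase _ _ (Finset.mem_univ k)]
    have h1 : ∀ j, minor j (M.map (algebraMap Ω (Polynomial Ω))) = C (minor j M) := by
      intro j
      rw [minor, minor, RingHom.map_det]
      rfl
    have h2 : nextMinor k (M.map (algebraMap Ω (Polynomial Ω))) = C (nextMinor k M) := by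
      rw [nextMinor, nextMinor, RingHom.map_det]
      congr 1
      ext i j
      simp only [Matrix.updateCol_apply, RingHom.mapMatrix_apply, Matrix.map_apply]
      split_ifs <;> rfl
    have h3 : ∀ j ∈ Finset.univ.erase k, minor j (M.map (algebraMap Ω (Polynomial Ω)) *
        (sy k (X : (Polynomial Ω))).1) ^ a j = C (minor j M ^ a j) := by
      intro j hj
      rw [minor_mul_sy_of_ne (Finset.ne_of_mem_erase hj), h1, C_pow]
    rw [Finset.prod_congr rfl h3, ← map_prod, minor_mul_sy, h1, h2]
    refine natDegree_mul_C_le _ _ |>.trans (natDegree_pow_le.trans ?_)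
    refine (Nat.mul_le_mul_left _ (?_ : _ ≤ 1)).trans (mul_one _).le
    compute_degree

end Leading

section Degeneration

variable {N : ℕ} {Ω : Type*} [Field Ω]

/-- The expansion of a polynomial in matrix entries along a left one-parameter subgroup. -/
noncomputable def expansion (w : MvPolynomial (Fin (N + 1) × Fin (N + 1)) Ω) :
    Polynomial (MvPolynomial (Fin (N + 1) × Fin (N + 1)) Ω) :=
  evM (diagonal (fun i : Fin (N + 1) => (Polynomial.X ^ (N - i.val) : Polynomial _)) *
    (mvPolynomialX (Fin (N + 1)) (Fin (N + 1)) Ω).map Polynomial.C) w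

theorem evM_diagonal_mul {A : Type*} [CommRing A] [Algebra Ω A]
    (w : MvPolynomial (Fin (N + 1) × Fin (N + 1)) Ω) (σ : A)
    (M : Matrix (Fin (N + 1)) (Fin (N + 1)) A) :
    evM (diagonal (fun i : Fin (N + 1) => σ ^ (N - i.val)) * M) w =
      ∑ j ∈ Finset.range ((expansion w).natDegree + 1),
        evM M ((expansion w).coeff j) * σ ^ j := by
  have hφ := map_evM (Polynomial.eval₂AlgHom (evM M) σ fun a => Commute.all _ _)
    (diagonal (fun i : Fin (N + 1) => (Polynomial.X ^ (N - i.val) : Polynomial _)) *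
    (mvPolynomialX (Fin (N + 1)) (Fin (N + 1)) Ω).map Polynomial.C) w
  have h2 : Polynomial.eval₂AlgHom (evM M) σ (fun a => Commute.all _ _) (expansion w) =
      ∑ j ∈ Finset.range ((expansion w).natDegree + 1),
        evM M ((expansion w).coeff j) * σ ^ j := by
    rw [Polynomial.eval₂AlgHom_apply, Polynomial.eval₂_eq_sum_range]
    rfl
  rw [← h2, expansion, hφ]
  congr 2
  ext i j
  simp [Matrix.diagonal_mul, evM]
  exact mul_comm _ _

theorem transvection_mul_diagonal_pow {A : Type*} [CommRing A] {i j : Fin (N + 1)} (hij : j < i)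
    (c σ : A) : (1 + Matrix.single i j c) * diagonal (fun i : Fin (N + 1) => σ ^ (N - i.val)) =
      diagonal (fun i : Fin (N + 1) => σ ^ (N - i.val)) *
        (1 + Matrix.single i j (c * σ ^ (i.val - j.val))) := by
  rw [add_mul, mul_add, one_mul, mul_one]
  congr 1
  ext x y
  rw [mul_diagonal, diagonal_mul, Matrix.single_apply, Matrix.single_apply]
  split_ifs with h
  · obtain ⟨rfl, rfl⟩ := h
    rw [mul_left_comm, ← pow_add]
    congr 2
    have := i.2
    have : j.val < i.val := hij
    omega
  · simp

theorem expansion_ne_zero {w : MvPolynomial (Fin (N + 1) × Fin (N + 1)) Ω} [Infinite Ω]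
    (hw : w ≠ 0) : expansion w ≠ 0 := by
  intro h
  refine hw (evM_ext fun M => ?_)
  have := evM_diagonal_mul w (1 : Ω) M
  simpa [h] using this

theorem coeff_mem_of_forall_eval_mem [Infinite Ω] {R : Type*} [CommRing R] [Algebra Ω R]
    (V : Submodule Ω R) (P : Polynomial R) (h : ∀ σ : Ω, P.eval (algebraMap Ω R σ) ∈ V) (j : ℕ) :
    P.coeff j ∈ V := by
  by_contra hj
  obtain ⟨φ, hφ, hV⟩ := Submodule.exists_le_ker_of_notMem hj
  let Q : Polynomial Ω := ∑ i ∈ Finset.range (P.natDegree + 1),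
    Polynomial.monomial i (φ (P.coeff i))
  have hQ : Q = 0 := by
    refine Polynomial.funext fun σ => ?_
    have h1 : φ (P.eval (algebraMap Ω R σ)) = 0 := hV (h σ)
    rw [Polynomial.eval_eq_sum_range, map_sum] at h1
    rw [Polynomial.eval_zero, Polynomial.eval_finsetSum, ← h1]
    refine Finset.sum_congr rfl fun i _ => ?_
    rw [Polynomial.eval_monomial, ← map_pow, mul_comm (P.coeff i), ← Algebra.smul_def, map_smul,
      smul_eq_mul, mul_comm]
  have h2 : Q.coeff j = φ (P.coeff j) := by
    simp only [Q, Polynomial.finsetSum_coeff, Polynomial.coeff_monomial]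
    rw [Finset.sum_ite_eq']
    split_ifs with h3
    · rfl
    · rw [Polynomial.coeff_eq_zero_of_natDegree_lt, map_zero]
      simpa [Nat.lt_succ_iff] using h3
  rw [hQ, Polynomial.coeff_zero] at h2
  exact hφ h2.symm

theorem coeff_expansion_mem [Infinite Ω] {a : Fin N → ℕ}
    {w : MvPolynomial (Fin (N + 1) × Fin (N + 1)) Ω} (hw : w ∈ weightSpace a) (j : ℕ) :
    (expansion w).coeff j ∈ weightSpace a := by
  refine coeff_mem_of_forall_eval_mem _ _ (fun σ => ?_) j
  have : (expansion w).eval (algebraMap Ω _ σ) =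
      leftT (diagonal fun i : Fin (N + 1) => σ ^ (N - i.val)) w := by
    refine evM_ext fun M => ?_
    rw [evM_leftT, Polynomial.eval_eq_sum_range, map_sum]
    have h2 : (diagonal fun i : Fin (N + 1) => σ ^ (N - i.val)).map (algebraMap Ω Ω) =
      diagonal fun i : Fin (N + 1) => σ ^ (N - i.val) := by
      ext; simp
    rw [h2, evM_diagonal_mul]
    refine Finset.sum_congr rfl fun i _ => ?_
    rw [map_mul, map_pow]
    simp
  rw [this]
  exact leftT_mem_weightSpace hw _

theorem coeff_eq_zero_of_const_on {F R : Type*} [Field F] [Fintype F] [CommRing R] [IsDomain R]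
    [Algebra F R] (G : Polynomial R) (hG : G.natDegree < Fintype.card F)
    (h : ∀ a : F, G.eval (algebraMap F R a) = G.eval 0) {r : ℕ} (hr : r ≠ 0) : G.coeff r = 0 := by
  have h1 : G - Polynomial.C (G.eval 0) = 0 := by
    refine Polynomial.eq_zero_of_natDegree_lt_card_of_eval_eq_zero _
      (f := algebraMap F R) (algebraMap F R).injective (fun a => by simp [h a]) ?_
    refine lt_of_le_of_lt ?_ hG
    exact (Polynomial.natDegree_sub_C).le
  have := congrArg (fun P => P.coeff r) h1
  simpa [Polynomial.coeff_C, hr] using this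

theorem coeff_lowest_eq_zero {F R : Type*} [Field F] [Fintype F] [CommRing R] [IsDomain R]
    [Algebra F R] (P : ℕ → Polynomial R) (J m δ : ℕ) (hδ : 0 < δ)
    (hP : ∀ j < m, P j = 0)
    (h : ∀ a : F, ∑ j ∈ Finset.range J, (P j).eval₂ Polynomial.C
        (Polynomial.C (algebraMap F R a) * Polynomial.X ^ δ) * Polynomial.X ^ j =
      ∑ j ∈ Finset.range J, Polynomial.C ((P j).coeff 0) * Polynomial.X ^ j)
    (hmJ : m < J) {r : ℕ} (hr : r ≠ 0) (hrF : r < Fintype.card F) : (P m).coeff r = 0 := by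
  let e := m + δ * r
  have hcoeff : ∀ a : R, ∀ j, ((P j).eval₂ Polynomial.C
        (Polynomial.C a * Polynomial.X ^ δ) * Polynomial.X ^ j).coeff e =
      ∑ s ∈ Finset.range ((P j).natDegree + 1), if e = j + δ * s then (P j).coeff s * a ^ s else 0 := by
    intro a j
    rw [Polynomial.eval₂_eq_sum_range, Finset.sum_mul, Polynomial.finsetSum_coeff]
    refine Finset.sum_congr rfl fun s _ => ?_
    rw [mul_pow, ← Polynomial.C_pow, ← mul_assoc, ← Polynomial.C_mul, ← pow_mul, mul_assoc,
      ← pow_add, Polynomial.coeff_C_mul_X_pow, add_comm]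
  let G : Polynomial R := ∑ j ∈ Finset.range J, ∑ s ∈ Finset.range ((P j).natDegree + 1),
    if e = j + δ * s then Polynomial.monomial s ((P j).coeff s) else 0
  have hGe : ∀ a : R, G.eval a = (∑ j ∈ Finset.range J, (P j).eval₂ Polynomial.C
        (Polynomial.C a * Polynomial.X ^ δ) * Polynomial.X ^ j).coeff e := by
    intro a
    rw [Polynomial.finsetSum_coeff, Polynomial.eval_finsetSum]
    refine Finset.sum_congr rfl fun j _ => ?_
    rw [hcoeff, Polynomial.eval_finsetSum]
    refine Finset.sum_congr rfl fun s _ => ?_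
    split_ifs <;> simp
  have hle : ∀ j s, e = j + δ * s → P j ≠ 0 → s ≤ r ∧ (s = r → j = m) := by
    intro j s hjs hj
    have hmj : m ≤ j := by
      by_contra hlt
      exact hj (hP j (not_le.1 hlt))
    constructor
    · by_contra hlt
      have := Nat.mul_lt_mul_of_pos_left (not_le.1 hlt) hδ
      simp only [e] at hjs
      omega
    · rintro rfl
      simp only [e] at hjs
      omega
  have hdeg : G.natDegree ≤ r := by
    refine Polynomial.natDegree_sum_le_of_forall_le _ _ fun j _ => ?_
    refine Polynomial.natDegree_sum_le_of_forall_le _ _ fun s _ => ?_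
    split_ifs with hjs
    · by_cases hj : P j = 0
      · simp [hj]
      · exact (Polynomial.natDegree_monomial_le _).trans (hle j s hjs hj).1
    · simp
  have h0 : G.coeff r = (P m).coeff r := by
    simp only [G, Polynomial.finsetSum_coeff]
    rw [Finset.sum_eq_single m]
    · rw [Finset.sum_eq_single r]
      · rw [if_pos rfl, Polynomial.coeff_monomial, if_pos rfl]
      · intro s _ hs
        split_ifs
        · rw [Polynomial.coeff_monomial, if_neg hs]
        · simp
      · intro hr
        rw [if_pos rfl, Polynomial.coeff_monomial, if_pos rfl,
          Polynomial.coeff_eq_zero_of_natDegree_lt]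
        simpa [Nat.lt_succ_iff] using hr
    · intro j _ hj
      refine Finset.sum_eq_zero fun s _ => ?_
      split_ifs with hjs
      · by_cases hPj : P j = 0
        · simp [hPj]
        · rw [Polynomial.coeff_monomial, if_neg]
          exact fun hs => hj ((hle j s hjs hPj).2 hs)
      · simp
    · simp [hmJ]
  rw [← h0]
  refine coeff_eq_zero_of_const_on (F := F) G (hdeg.trans_lt hrF) (fun a => ?_) hr
  rw [hGe, hGe, h]
  congr 1
  refine Finset.sum_congr rfl fun j _ => ?_
  simp [Polynomial.eval₂_at_zero]

end Degeneration

section Leading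

variable {N : ℕ} {F Ω : Type*} [Field F] [Fintype F] [Field Ω] [Algebra F Ω]

theorem pow_card_dvd_of_leading {w : MvPolynomial (Fin (N + 1) × Fin (N + 1)) Ω}
    (hinv : ∀ u ∈ lowerU (N + 1) F, leftT (baseChange (N + 1) F Ω u).1 w = w)
    {R : Type*} [CommRing R] [IsDomain R] [Algebra Ω R] {i j : Fin (N + 1)} (hij : j < i) (τ : R)
    (M : Matrix (Fin (N + 1)) (Fin (N + 1)) R) :
    τ ^ Fintype.card F ∣ evM ((1 + Matrix.single i j τ) * M) (expansion w).trailingCoeff -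
      evM M (expansion w).trailingCoeff := by
  let P : ℕ → Polynomial R := fun l =>
    evM ((1 + Matrix.single i j Polynomial.X) * M.map Polynomial.C) ((expansion w).coeff l)
  have hPev : ∀ {B : Type _} [CommRing B] [Algebra Ω B] [Algebra R B] [IsScalarTower Ω R B] (τ : B)
      (l : ℕ), (P l).eval₂ (algebraMap R B) τ = evM ((1 + Matrix.single i j τ) *
        M.map (algebraMap R B)) ((expansion w).coeff l) := by
    intro B _ _ _ _ τ l
    let φ : Polynomial R →ₐ[Ω] B :=
      Polynomial.eval₂AlgHom (IsScalarTower.toAlgHom Ω R B) τ fun _ => Commute.all _ _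
    have h1 : (P l).eval₂ (algebraMap R B) τ = φ (P l) := rfl
    rw [h1, map_evM]
    congr 2
    refine (Matrix.map_mul (f := φ.toRingHom)).trans ?_
    have hX : φ Polynomial.X = τ := Polynomial.eval₂_X _ _
    congr 1
    · ext x y
      simp only [Matrix.map_apply, Matrix.add_apply, Matrix.one_apply, Matrix.single_apply]
      change φ _ = _
      split_ifs <;> simp [hX]
    · ext x y
      exact Polynomial.eval₂_C _ _
  let : Algebra F R := ((algebraMap Ω R).comp (algebraMap F Ω)).toAlgebra
  have hFR : ∀ a : F, algebraMap F R a = algebraMap Ω R (algebraMap F Ω a) := fun a => rfl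
  have hcoeff0 : ∀ l, (P l).coeff 0 = evM M ((expansion w).coeff l) := by
    intro l
    have := hPev (0 : R) l
    rw [Polynomial.eval₂_at_zero] at this
    rw [Algebra.algebraMap_self, RingHom.id_apply] at this
    rw [this, Matrix.single_zero, add_zero, one_mul]
    congr 2
  have hmain : ∀ r, r ≠ 0 → r < Fintype.card F →
      (P (expansion w).natTrailingDegree).coeff r = 0 := by
    intro r hr hrF
    refine coeff_lowest_eq_zero (F := F) P ((expansion w).natDegree + 1)
      (expansion w).natTrailingDegree (i.val - j.val) (Nat.sub_pos_of_lt hij) ?_ ?_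
      (Nat.lt_succ_of_le (Polynomial.natTrailingDegree_le_natDegree _)) hr hrF
    · intro l hl
      simp only [P]
      rw [Polynomial.coeff_eq_zero_of_lt_natTrailingDegree hl, map_zero]
    · intro a
      have h1 : ∀ l, (P l).eval₂ Polynomial.C (Polynomial.C (algebraMap F R a) *
          Polynomial.X ^ (i.val - j.val)) = evM ((1 + Matrix.single i j
            (Polynomial.C (algebraMap F R a) * Polynomial.X ^ (i.val - j.val))) *
              M.map Polynomial.C) ((expansion w).coeff l) := fun l =>
        hPev (B := Polynomial R) _ l
      have h2 : ∀ l, Polynomial.C ((P l).coeff 0) = evM (M.map Polynomial.C)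
          ((expansion w).coeff l) := by
        intro l
        have := hPev (B := Polynomial R) 0 l
        rw [Polynomial.eval₂_at_zero, Matrix.single_zero, add_zero, one_mul] at this
        exact this
      simp only [h1, h2]
      rw [← evM_diagonal_mul w Polynomial.X, ← evM_diagonal_mul w Polynomial.X, ← mul_assoc,
        ← transvection_mul_diagonal_pow hij, mul_assoc]
      have htU : transvection hij.ne' a ∈ lowerU (N + 1) F := by
        intro x y hxy
        rw [Matrix.transpose_apply, transvection_coe, Matrix.add_apply, Matrix.single_apply, if_neg,
          add_zero, Matrix.one_apply, Matrix.one_apply]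
        · simp only [eq_comm]
        · rintro ⟨rfl, rfl⟩
          exact absurd hij (not_lt.2 hxy)
      have h3 := hinv _ htU
      conv_rhs => rw [← h3]
      rw [evM_leftT]
      congr 2
      rw [baseChange_transvection, transvection_coe]
      congr 1
      ext x y
      simp only [Matrix.map_apply, Matrix.add_apply, Matrix.one_apply, Matrix.single_apply]
      split_ifs <;> simp [hFR]
  have hdvd : Polynomial.X ^ Fintype.card F ∣ P (expansion w).natTrailingDegree -
      Polynomial.C ((P (expansion w).natTrailingDegree).coeff 0) := by
    rw [Polynomial.X_pow_dvd_iff]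
    intro d hd
    rcases eq_or_ne d 0 with rfl | h0
    · simp
    · rw [Polynomial.coeff_sub, hmain d h0 hd, Polynomial.coeff_C, if_neg h0, sub_zero]
  have := map_dvd (Polynomial.evalRingHom τ) hdvd
  rw [map_pow, map_sub, Polynomial.coe_evalRingHom, Polynomial.eval_X, Polynomial.eval_C,
    hcoeff0] at this
  have h4 := hPev τ (expansion w).natTrailingDegree
  rw [Algebra.algebraMap_self] at h4
  have h5 : M.map (RingHom.id R) = M := by ext; simp
  rw [h5] at h4
  rw [Polynomial.trailingCoeff, ← h4]
  exact this

end Leading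

section Density

variable {N : ℕ} {F Ω : Type*} [Field F] [Fintype F] [Field Ω] [Algebra F Ω]

theorem X_pow_dvd_evM_one_add {n : ℕ} (v : MvPolynomial (Fin n × Fin n) Ω) (q : ℕ)
    (hdvd : ∀ (i j : Fin n), j < i → ∀ (τ : Polynomial Ω) (M : Matrix (Fin n) (Fin n) (Polynomial Ω)),
      τ ^ q ∣ evM ((1 + Matrix.single i j τ) * M) v - evM M v) (k : ℕ)
    (M : Matrix (Fin n) (Fin n) (Polynomial Ω)) (D : Matrix (Fin n) (Fin n) Ω)
    (hD : ∀ i j, D i j ≠ 0 → j.val ≤ k ∧ k < i.val) :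
    Polynomial.X ^ q ∣ evM ((1 + (Polynomial.X : Polynomial Ω) • D.map Polynomial.C) * M) v -
      evM M v := by
  classical
  have key : ∀ s : Finset (Fin n × Fin n), Polynomial.X ^ q ∣ evM ((1 + ∑ x ∈ s,
      Matrix.single x.1 x.2 ((Polynomial.X : Polynomial Ω) * Polynomial.C (D x.1 x.2))) * M) v -
      evM M v := by
    intro s
    induction s using Finset.induction_on with
    | empty => simp
    | insert x s hx ih =>
      rw [Finset.sum_insert hx]
      by_cases h0 : D x.1 x.2 = 0
      · simpa [h0] using ih
      have hx' := hD _ _ h0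
      have h1 : (1 + (Matrix.single x.1 x.2 (Polynomial.X * Polynomial.C (D x.1 x.2)) +
          ∑ x ∈ s, Matrix.single x.1 x.2 (Polynomial.X * Polynomial.C (D x.1 x.2)))) =
          (1 + Matrix.single x.1 x.2 (Polynomial.X * Polynomial.C (D x.1 x.2))) *
          (1 + ∑ x ∈ s, Matrix.single x.1 x.2 (Polynomial.X * Polynomial.C (D x.1 x.2))) := by
        have hz : Matrix.single x.1 x.2 ((Polynomial.X : Polynomial Ω) * Polynomial.C (D x.1 x.2)) *
            ∑ x ∈ s, Matrix.single x.1 x.2 (Polynomial.X * Polynomial.C (D x.1 x.2)) = 0 := by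
          rw [Finset.mul_sum]
          refine Finset.sum_eq_zero fun y _ => ?_
          by_cases hy0 : D y.1 y.2 = 0
          · simp [hy0]
          have hy' := hD _ _ hy0
          refine Matrix.single_mul_single_of_ne _ _ _ _ ?_ _
          rintro h
          have := congrArg Fin.val h
          omega
        rw [add_mul, one_mul, mul_add, mul_one, hz]
        abel
      rw [h1, mul_assoc]
      have h2 := (pow_dvd_pow_of_dvd (dvd_mul_right Polynomial.X (Polynomial.C (D x.1 x.2))) q).trans
        (hdvd x.1 x.2 (by rw [Fin.lt_def]; omega)
        (Polynomial.X * Polynomial.C (D x.1 x.2)) ((1 + ∑ x ∈ s, Matrix.single x.1 x.2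
          (Polynomial.X * Polynomial.C (D x.1 x.2))) * M))
      simpa using dvd_add h2 ih
  have h3 : (Polynomial.X : Polynomial Ω) • D.map Polynomial.C = ∑ x : Fin n × Fin n,
      Matrix.single x.1 x.2 ((Polynomial.X : Polynomial Ω) * Polynomial.C (D x.1 x.2)) := by
    conv_lhs => rw [matrix_eq_sum_single ((Polynomial.X : Polynomial Ω) • D.map Polynomial.C)]
    rw [Fintype.sum_prod_type]
    rfl
  rw [h3]
  exact key _

theorem evM_mul_sy_eq [Infinite Ω] {a : Fin N → ℕ} {q : ℕ}
    {v : MvPolynomial (Fin (N + 1) × Fin (N + 1)) Ω} (hv : v ∈ weightSpace a) (ha : ∀ k, a k < q)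
    (hdvd : ∀ (i j : Fin (N + 1)), j < i → ∀ (τ : Polynomial Ω)
      (M : Matrix (Fin (N + 1)) (Fin (N + 1)) (Polynomial Ω)),
      τ ^ q ∣ evM ((1 + Matrix.single i j τ) * M) v - evM M v)
    {u : Matrix.SpecialLinearGroup (Fin (N + 1)) Ω} (hu : u ∈ lowerU (N + 1) Ω) (k : Fin N) (t : Ω) :
    evM (u * sy k t).1 v = evM u.1 v := by
  let D : Matrix (Fin (N + 1)) (Fin (N + 1)) Ω :=
    u.1 * Matrix.single k.succ k.castSucc 1 * (u⁻¹).1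
  have hD : ∀ i j, D i j ≠ 0 → j.val ≤ k.val ∧ k.val < i.val := by
    intro i j hij
    have h1 : D i j = u i k.succ * u⁻¹ k.castSucc j := by
      simp only [D]
      rw [Matrix.mul_assoc, Matrix.mul_apply, Finset.sum_eq_single k.succ]
      · rw [Matrix.single_mul_apply_same, one_mul]
      · intro x _ hx
        rw [Matrix.single_mul_apply_of_ne, mul_zero]
        exact hx
      · simp
    constructor
    · by_contra hlt
      refine hij ?_
      have := IsUni.apply_lt (inv_mem hu) (i := j) (j := k.castSucc)
        (by rw [Fin.lt_def]; simpa using hlt)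
      rw [Matrix.transpose_apply] at this
      rw [h1, this, mul_zero]
    · by_contra hlt
      refine hij ?_
      have := IsUni.apply_lt hu (i := k.succ) (j := i) (by
        rw [Fin.lt_def, Fin.val_succ]; omega)
      rw [Matrix.transpose_apply] at this
      rw [h1, this, zero_mul]
  let P : Polynomial Ω := evM (u.1.map (algebraMap Ω (Polynomial Ω)) *
    (sy k (Polynomial.X : Polynomial Ω)).1) v
  have hP : P.natDegree < q := (hv.2.2 u.1 k).trans_lt (ha k)
  have huu : u.1 * (u⁻¹).1 = 1 := by
    rw [← Matrix.SpecialLinearGroup.coe_mul, mul_inv_cancel]; rfl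
  have huu' : (u⁻¹).1 * u.1 = 1 := by
    rw [← Matrix.SpecialLinearGroup.coe_mul, inv_mul_cancel]; rfl
  have h1 : (1 + (Polynomial.X : Polynomial Ω) • D.map Polynomial.C) * u.1.map Polynomial.C =
      u.1.map (algebraMap Ω (Polynomial Ω)) * (sy k (Polynomial.X : Polynomial Ω)).1 := by
    have h2 : D * u.1 = u.1 * Matrix.single k.succ k.castSucc 1 := by
      simp only [D]
      rw [Matrix.mul_assoc, huu', Matrix.mul_one]
    rw [add_mul, one_mul, smul_mul_assoc, ← Matrix.map_mul, h2, sy, transvection_coe, mul_add,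
      mul_one, Matrix.map_mul]
    congr 1
    rw [← mul_smul_comm]
    congr 1
    ext x y
    simp [Matrix.single_apply]
  have h2 := X_pow_dvd_evM_one_add v q hdvd k.val (u.1.map Polynomial.C) D hD
  have h3 : evM (u.1.map (Polynomial.C : Ω → Polynomial Ω)) v = Polynomial.C (evM u.1 v) :=
    (map_evM (Polynomial.CAlgHom (R := Ω) (A := Ω)) u.1 v).symm
  rw [h1, h3] at h2
  have h4 : P - Polynomial.C (evM u.1 v) = 0 := by
    refine Polynomial.eq_zero_of_dvd_of_natDegree_lt h2 ?_
    rwa [Polynomial.natDegree_sub_C, Polynomial.natDegree_X_pow]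
  have h5 : Polynomial.aeval t P = evM (u * sy k t).1 v := by
    rw [map_evM]
    congr 2
    refine (Matrix.map_mul (f := (Polynomial.aeval t).toRingHom)).trans ?_
    congr 1
    · ext x y
      exact Polynomial.aeval_C _ _
    · rw [sy, sy, transvection_coe, transvection_coe]
      ext x y
      simp only [Matrix.map_apply, Matrix.add_apply, Matrix.one_apply, Matrix.single_apply]
      change Polynomial.aeval t _ = _
      split_ifs <;> simp
  rw [← h5, sub_eq_zero.1 h4, Polynomial.aeval_C]
  rfl

theorem weightSpace_eq_zero [Infinite Ω] (hN : 0 < N) {a : Fin N → ℕ}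
    {v : MvPolynomial (Fin (N + 1) × Fin (N + 1)) Ω} (hv : v ∈ weightSpace a)
    (h0 : ∀ u ∈ lowerU (N + 1) Ω, evM u.1 v = 0) : v = 0 := by
  have hsy : ∀ (g : Matrix.SpecialLinearGroup (Fin (N + 1)) Ω) k, ∃ P : Polynomial Ω,
      ∀ t, P.eval t = evM (g * sy k t).1 v := by
    intro g k
    refine ⟨evM (g.1.map (algebraMap Ω (Polynomial Ω)) *
      (sy k (Polynomial.X : Polynomial Ω)).1) v, fun t => ?_⟩
    rw [← Polynomial.coe_aeval_eq_eval, map_evM]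
    congr 2
    refine (Matrix.map_mul (f := (Polynomial.aeval t).toRingHom)).trans ?_
    congr 1
    · ext x y
      exact Polynomial.aeval_C _ _
    · rw [sy, sy, transvection_coe, transvection_coe]
      ext x y
      simp only [Matrix.map_apply, Matrix.add_apply, Matrix.one_apply, Matrix.single_apply]
      change Polynomial.aeval t _ = _
      split_ifs <;> simp
  have hSL : ∀ g : Matrix.SpecialLinearGroup (Fin (N + 1)) Ω, evM g.1 v = 0 := by
    intro g
    have hdiag : ∀ (g : Matrix.SpecialLinearGroup (Fin (N + 1)) Ω) k (t : Ωˣ),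
        evM g.1 v = 0 → evM (g * sh k t).1 v = 0 := by
      intro g k t hg
      rw [Matrix.SpecialLinearGroup.coe_mul, sh_coe, hv.2.1, hg, mul_zero]
    refine eq_zero_of_forall_lowerU hN (fun g => evM g.1 v) (fun g k t => hv.1 _ _ _)
      hdiag (fun g k hy => ?_) h0 g
    obtain ⟨P, hP⟩ := hsy (g * sn Ω k) k
    have hP0 : P = 0 := by
      refine Polynomial.eq_zero_of_infinite_isRoot _ ?_
      refine Set.Infinite.mono (s := {0}ᶜ) ?_ (Set.finite_singleton 0).infinite_compl
      intro s hs
      have hs : s ≠ 0 := hs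
      change P.eval s = 0
      have h2 := sn_mul_sy k (Units.mk0 s hs)
      rw [Units.val_mk0] at h2
      rw [hP, mul_assoc, h2, ← mul_assoc, ← mul_assoc, Matrix.SpecialLinearGroup.coe_mul, hv.1]
      exact hdiag _ _ _ (hy _)
    have := hP 0
    rw [hP0, Polynomial.eval_zero, sy_zero, mul_one] at this
    exact this.symm
  have hprod : (mvPolynomialX (Fin (N + 1)) (Fin (N + 1)) Ω).det * v = 0 := by
    refine evM_ext fun M => ?_
    rw [map_mul, map_zero]
    have h1 : evM M (mvPolynomialX (Fin (N + 1)) (Fin (N + 1)) Ω).det = M.det := by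
      refine (RingHom.map_det (evM M).toRingHom _).trans ?_
      congr 1
      exact map_mvPolynomialX_evM M
    rw [h1]
    by_cases hM : M.det = 0
    · rw [hM, zero_mul]
    · let d : Fin (N + 1) → Ω := fun i => if i = 0 then M.det else 1
      have hd : (diagonal d).det = M.det := by simp [d, det_diagonal]
      let g : Matrix.SpecialLinearGroup (Fin (N + 1)) Ω := ⟨M * diagonal d⁻¹, by
        rw [det_mul, det_diagonal]
        simp [d, hM]⟩
      have hg : M = g.1 * diagonal d := by
        simp only [g]
        rw [Matrix.mul_assoc, diagonal_mul_diagonal]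
        have : (fun i => d⁻¹ i * d i) = 1 := by
          ext i
          simp only [d, Pi.inv_apply, Pi.one_apply]
          split_ifs <;> simp [hM]
        rw [this]
        exact (Matrix.mul_one _).symm
      rw [hg, hv.2.1, hSL, mul_zero, mul_zero]
  exact (mul_eq_zero.1 hprod).resolve_left (det_mvPolynomialX_ne_zero _ _)

end Density

section Density

variable {N : ℕ} {F Ω : Type*} [Field F] [Fintype F] [Field Ω] [Algebra F Ω]

theorem weightSpace_eq_zero_of_baseChange {p : ℕ} [Fact p.Prime] [CharP F p] [CharP Ω p]
    [Infinite Ω] (hN : 0 < N) {a : Fin N → ℕ} (ha : ∀ k, a k ≤ Fintype.card F - 1)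
    {w : MvPolynomial (Fin (N + 1) × Fin (N + 1)) Ω} (hw : w ∈ weightSpace a)
    (h : ∀ g : Matrix.SpecialLinearGroup (Fin (N + 1)) F, evM (baseChange (N + 1) F Ω g).1 w = 0) :
    w = 0 := by
  by_contra hw0
  let S : Submodule Ω (MvPolynomial (Fin (N + 1) × Fin (N + 1)) Ω) := weightSpace a ⊓
    ⨅ g : Matrix.SpecialLinearGroup (Fin (N + 1)) F,
      LinearMap.ker (evM (baseChange (N + 1) F Ω g).1).toLinearMap
  have hS : ∀ {w}, w ∈ S ↔ w ∈ weightSpace a ∧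
      ∀ g : Matrix.SpecialLinearGroup (Fin (N + 1)) F, evM (baseChange (N + 1) F Ω g).1 w = 0 := by
    intro w
    simp [S]
  have hcomp : ∀ (T : Matrix (Fin (N + 1)) (Fin (N + 1)) Ω) (M : Matrix (Fin (N + 1)) (Fin (N + 1)) Ω)
      (w : MvPolynomial (Fin (N + 1) × Fin (N + 1)) Ω), evM M (leftT T w) = evM (T * M) w := by
    intro T M w
    rw [evM_leftT]
    congr 3
  let π : Matrix.SpecialLinearGroup (Fin (N + 1)) F →*
      Module.End Ω (MvPolynomial (Fin (N + 1) × Fin (N + 1)) Ω) :=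
    { toFun := fun g => (leftT (baseChange (N + 1) F Ω g⁻¹).1).toLinearMap
      map_one' := by
        refine LinearMap.ext fun w => evM_ext fun M => ?_
        rw [AlgHom.toLinearMap_apply, hcomp, inv_one, map_one]
        congr 2
        exact Matrix.one_mul M
      map_mul' := fun g g' => by
        refine LinearMap.ext fun w => evM_ext fun M => ?_
        rw [Module.End.mul_apply, AlgHom.toLinearMap_apply, AlgHom.toLinearMap_apply,
          AlgHom.toLinearMap_apply, hcomp, hcomp, hcomp, _root_.mul_inv_rev, map_mul,
          Matrix.SpecialLinearGroup.coe_mul, Matrix.mul_assoc] }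
  have hπ : ∀ g w, π g w = leftT (baseChange (N + 1) F Ω g⁻¹).1 w := fun g w => rfl
  obtain ⟨y, hyS, hy0, hy⟩ := exists_ne_zero_fixed (isPGroup_lowerU (n := N + 1) (R := F) p)
    (π.comp (lowerU (N + 1) F).subtype) S (by
      intro g v hv
      rw [hS] at hv ⊢
      refine ⟨leftT_mem_weightSpace hv.1 _, fun b => ?_⟩
      change evM _ (π g v) = 0
      rw [hπ, hcomp, ← Matrix.SpecialLinearGroup.coe_mul, ← map_mul]
      exact hv.2 _) (hS.2 ⟨hw, h⟩) hw0
  rw [hS] at hyS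
  have hinv : ∀ u ∈ lowerU (N + 1) F, leftT (baseChange (N + 1) F Ω u).1 y = y := by
    intro u hu
    have := hy ⟨u⁻¹, inv_mem hu⟩
    rw [MonoidHom.comp_apply, hπ] at this
    simpa using this
  have hdvd := fun (i j : Fin (N + 1)) (hij : j < i) τ
    (M : Matrix (Fin (N + 1)) (Fin (N + 1)) (Polynomial Ω)) =>
    pow_card_dvd_of_leading hinv hij τ M
  have hv : (expansion y).trailingCoeff ∈ weightSpace a := coeff_expansion_mem hyS.1 _
  have haq : ∀ k, a k < Fintype.card F := fun k => by
    have := ha k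
    have := Fintype.card_pos (α := F)
    omega
  refine expansion_ne_zero hy0 (Polynomial.trailingCoeff_eq_zero.1
    (weightSpace_eq_zero hN hv fun u hu => ?_))
  have hone : evM (1 : Matrix (Fin (N + 1)) (Fin (N + 1)) Ω) (expansion y).trailingCoeff = 0 := by
    have h1 : evM (1 : Matrix (Fin (N + 1)) (Fin (N + 1)) Ω) y = 0 := by
      have := hyS.2 1
      rw [map_one] at this
      exact this
    have h2 : (expansion y).map (evM (1 : Matrix (Fin (N + 1)) (Fin (N + 1)) Ω)).toRingHom = 0 := by
      refine Polynomial.funext fun σ => ?_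
      have h3 := evM_diagonal_mul y σ (1 : Matrix (Fin (N + 1)) (Fin (N + 1)) Ω)
      rw [mul_one, ← one_mul (diagonal _), hyS.1.2.1, h1, mul_zero] at h3
      rw [Polynomial.eval_map, Polynomial.eval₂_eq_sum_range, Polynomial.eval_zero, h3]
      rfl
    have := congrArg (fun P => P.coeff (expansion y).natTrailingDegree) h2
    rw [Polynomial.coeff_map, Polynomial.coeff_zero] at this
    exact this
  let H : Subgroup (Matrix.SpecialLinearGroup (Fin (N + 1)) Ω) :=
    { carrier := {x | x ∈ lowerU (N + 1) Ω ∧ ∀ u ∈ lowerU (N + 1) Ω,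
        evM (u * x).1 (expansion y).trailingCoeff = evM u.1 (expansion y).trailingCoeff}
      one_mem' := ⟨one_mem _, fun u _ => by rw [mul_one]⟩
      mul_mem' := fun {x x'} hx hx' => ⟨mul_mem hx.1 hx'.1, fun u hu => by
        rw [← mul_assoc, hx'.2 _ (mul_mem hu hx.1), hx.2 _ hu]⟩
      inv_mem' := fun {x} hx => ⟨inv_mem hx.1, fun u hu => by
        rw [← hx.2 _ (mul_mem hu (inv_mem hx.1)), inv_mul_cancel_right]⟩ }
  have hH := lowerU_le_of_sy_mem H (fun k t => ⟨sy_mem_lowerU k t, fun u hu =>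
    evM_mul_sy_eq hv haq hdvd hu k t⟩) hu
  have := hH.2 1 (one_mem _)
  rw [one_mul] at this
  rw [this]
  exact hone

theorem sum_minorProd_eq_zero {p : ℕ} [Fact p.Prime] [CharP F p] [CharP Ω p]
    [Infinite Ω] (hN : 0 < N) {a : Fin N → ℕ} (ha : ∀ k, a k ≤ Fintype.card F - 1)
    {ι : Type*} (s : Finset ι) (A : ι → Matrix (Fin (N + 1)) (Fin (N + 1)) Ω)
    (h : ∀ g, ∑ i ∈ s, minorProd a (A i * (baseChange (N + 1) F Ω g).1) = 0)
    (M : Matrix (Fin (N + 1)) (Fin (N + 1)) Ω) : ∑ i ∈ s, minorProd a (A i * M) = 0 := by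
  have hev : ∀ (T M : Matrix (Fin (N + 1)) (Fin (N + 1)) Ω),
      evM M (minorPoly a T) = minorProd a (T * M) := by
    intro T M
    rw [evM_minorPoly]
    congr 2
  have h1 : ∑ i ∈ s, minorPoly a (A i) = 0 := by
    refine weightSpace_eq_zero_of_baseChange (F := F) (p := p) hN ha
      (Submodule.sum_mem _ fun i _ => minorPoly_mem_weightSpace a (A i)) fun g => ?_
    rw [map_sum, ← h g]
    exact Finset.sum_congr rfl fun i _ => hev _ _
  have := congrArg (evM M) h1
  rw [map_sum, map_zero] at this
  rw [← this]
  exact Finset.sum_congr rfl fun i _ => (hev _ _).symm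

theorem exists_addMonoidHom_apply_ne_zero_of_module {p : ℕ} [Fact p.Prime] [CharP Ω p] {W : Type*}
    [AddCommGroup W] [Module (ZMod p) W] {x : W} (hx : x ≠ 0) : ∃ φ : W →+ Ω, φ x ≠ 0 := by
  have : ∃ f : Module.Dual (ZMod p) W, f x ≠ 0 := by
    by_contra! h
    exact hx ((Module.forall_dual_apply_eq_zero_iff (ZMod p) x).1 h)
  obtain ⟨f, hf⟩ := this
  refine ⟨(ZMod.castHom dvd_rfl Ω : ZMod p →+* Ω).toAddMonoidHom.comp f.toAddMonoidHom, fun h => ?_⟩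
  have : (ZMod.castHom dvd_rfl Ω : ZMod p →+* Ω) (f x) = 0 := h
  rw [map_eq_zero] at this
  exact hf this

theorem exists_addMonoidHom_apply_ne_zero {p : ℕ} [Fact p.Prime] [CharP Ω p] {W : Type*}
    [AddCommGroup W] (hpW : ∀ w : W, p • w = 0) {x : W} (hx : x ≠ 0) : ∃ φ : W →+ Ω, φ x ≠ 0 :=
  let _ : Module (ZMod p) W := AddCommGroup.zmodModule hpW
  exists_addMonoidHom_apply_ne_zero_of_module hx

theorem exists_minorProd_sum_eq_zero {p : ℕ} [Fact p.Prime] [CharP F p] [CharP Ω p]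
    [Infinite Ω] (hN : 0 < N) {K W : Type*} [Field K] [CharP K p] [AddCommGroup W] [Module K W]
    [Nontrivial W] (ρ : Matrix.SpecialLinearGroup (Fin (N + 1)) F →* (W ≃ₗ[K] W)) :
    ∃ a : Fin N → ℕ, (∀ k, a k ≤ Fintype.card F - 1) ∧
      (∀ s l, (∀ w, ∑ i ∈ Finset.range l, ρ (s ^ i) w = 0) →
        ∀ A B : Matrix (Fin (N + 1)) (Fin (N + 1)) Ω, ∑ i ∈ Finset.range l,
          minorProd a (A * (baseChange (N + 1) F Ω s).1 ^ i * B) = 0) ∧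
      ∀ z, ρ z = 1 → minorProd a (baseChange (N + 1) F Ω z).1 = 1 := by
  let Gen : Set (Matrix.SpecialLinearGroup (Fin (N + 1)) F → Ω) :=
    {h | ∃ (φ : W →+ Ω) (x : W), h = fun g => φ (ρ g x)}
  let C := Submodule.span Ω Gen
  have hC : C ≠ ⊥ := by
    obtain ⟨x, hx⟩ := exists_ne (0 : W)
    have hpW : ∀ w : W, p • w = 0 := fun w => by
      rw [← Nat.cast_smul_eq_nsmul K, CharP.cast_eq_zero, zero_smul]
    obtain ⟨φ, hφ⟩ := exists_addMonoidHom_apply_ne_zero (Ω := Ω) hpW hx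
    intro hbot
    have : (fun g => φ (ρ g x)) ∈ C := Submodule.subset_span ⟨φ, x, rfl⟩
    rw [hbot, Submodule.mem_bot] at this
    have := congrFun this 1
    rw [map_one] at this
    exact hφ this
  have hl : ∀ b, ∀ h ∈ C, (fun g => h (b * g)) ∈ C := by
    intro b h hh
    have : C ≤ C.comap (LinearMap.funLeft Ω Ω (b * ·)) := by
      refine Submodule.span_le.2 ?_
      rintro _ ⟨φ, x, rfl⟩
      refine Submodule.subset_span ⟨φ.comp (ρ b : W →ₗ[K] W).toAddMonoidHom, x, ?_⟩
      funext g
      simp [LinearMap.funLeft]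
    exact this hh
  have hr : ∀ b, ∀ h ∈ C, (fun g => h (g * b)) ∈ C := by
    intro b h hh
    have : C ≤ C.comap (LinearMap.funLeft Ω Ω (· * b)) := by
      refine Submodule.span_le.2 ?_
      rintro _ ⟨φ, x, rfl⟩
      refine Submodule.subset_span ⟨φ, ρ b x, ?_⟩
      funext g
      simp [LinearMap.funLeft]
    exact this hh
  obtain ⟨a, ha, hf⟩ := exists_minorProd_mem (p := p) hN C hC hl hr
  refine ⟨a, ha, fun s l hs A B => ?_, fun z hz => ?_⟩
  · have h1 : ∀ h ∈ C, ∀ g g', ∑ i ∈ Finset.range l, h (g * s ^ i * g') = 0 := by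
      intro h hh
      induction hh using Submodule.span_induction with
      | mem h hh =>
        obtain ⟨φ, x, rfl⟩ := hh
        intro g g'
        have h2 : ∀ i, φ (ρ (g * s ^ i * g') x) = φ (ρ g (ρ (s ^ i) (ρ g' x))) := by
          intro i
          rw [map_mul, map_mul]; rfl
        simp only [h2]
        rw [← map_sum, ← map_sum, hs, map_zero, map_zero]
      | zero => simp
      | add h h' _ _ ih ih' =>
        intro g g'
        simp [Finset.sum_add_distrib, ih, ih']
      | smul r h _ ih =>
        intro g g'
        simp [← Finset.mul_sum, ih]
    have h2 : ∀ g (M : Matrix (Fin (N + 1)) (Fin (N + 1)) Ω), ∑ i ∈ Finset.range l,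
        minorProd a ((baseChange (N + 1) F Ω g).1 * (baseChange (N + 1) F Ω s).1 ^ i * M) = 0 := by
      intro g M
      refine sum_minorProd_eq_zero (F := F) (p := p) hN ha _ _ (fun g' => ?_) M
      rw [← h1 _ hf g g']
      refine Finset.sum_congr rfl fun i _ => ?_
      rw [map_mul, map_mul, map_pow, Matrix.SpecialLinearGroup.coe_mul,
        Matrix.SpecialLinearGroup.coe_mul, Matrix.SpecialLinearGroup.coe_pow]
    have h3 := sum_minorProd_eq_zero (F := F) (p := p) hN ha (Finset.range l)
      (fun i => Bᵀ * ((baseChange (N + 1) F Ω s).1 ^ i)ᵀ) (fun g => ?_) Aᵀ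
    · rw [← h3]
      refine Finset.sum_congr rfl fun i _ => ?_
      rw [← minorProd_transpose, Matrix.transpose_mul, Matrix.transpose_mul, ← Matrix.mul_assoc]
    · rw [← h2 g.transpose B]
      refine Finset.sum_congr rfl fun i _ => ?_
      rw [← minorProd_transpose, Matrix.transpose_mul, Matrix.transpose_mul,
        Matrix.transpose_transpose, Matrix.transpose_transpose, ← Matrix.mul_assoc]
      rfl
  · have h1 : ∀ h ∈ C, h z = h 1 := by
      intro h hh
      induction hh using Submodule.span_induction with
      | mem h hh =>
        obtain ⟨φ, x, rfl⟩ := hh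
        simp [hz]
      | zero => simp
      | add h h' _ _ ih ih' => simp [ih, ih']
      | smul r h _ ih => simp [ih]
    have := h1 _ hf
    simp only [map_one] at this
    rw [this]
    exact minorProd_eq_one_of_isUni a (fun _ _ _ => rfl)

end Density

section LeadingMinors

variable {R : Type*} [CommRing R]

/-- The leading principal minor of size `k` of an infinite matrix. -/
def lmin (M : ℕ → ℕ → R) (k : ℕ) : R := (Matrix.of fun i j : Fin k => M i j).det

theorem lmin_congr {M M' : ℕ → ℕ → R} {k : ℕ} (h : ∀ i < k, ∀ j < k, M i j = M' i j) :
    lmin M k = lmin M' k := by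
  unfold lmin
  congr 1
  ext i j
  exact h i i.2 j j.2

theorem lmin_zero (M : ℕ → ℕ → R) : lmin M 0 = 1 := by simp [lmin]

theorem lmin_one (M : ℕ → ℕ → R) : lmin M 1 = M 0 0 := by simp [lmin]

theorem lmin_two (M : ℕ → ℕ → R) : lmin M 2 = M 0 0 * M 1 1 - M 0 1 * M 1 0 := by
  simp [lmin, Matrix.det_fin_two]

theorem lmin_transpose (M : ℕ → ℕ → R) (k : ℕ) : lmin (fun i j => M j i) k = lmin M k := by
  unfold lmin
  rw [← Matrix.det_transpose]
  rfl

theorem map_lmin {S : Type*} [CommRing S] (φ : R →+* S) (M : ℕ → ℕ → R) (k : ℕ) :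
    φ (lmin M k) = lmin (fun i j => φ (M i j)) k := by
  unfold lmin
  rw [RingHom.map_det]
  rfl

theorem lmin_scale (D D' : ℕ → R) (M : ℕ → ℕ → R) (k : ℕ) :
    lmin (fun i j => D i * M i j * D' j) k =
      (∏ i ∈ Finset.range k, D i * D' i) * lmin M k := by
  have : (Matrix.of fun i j : Fin k => D i * M i j * D' j) =
      diagonal (fun i : Fin k => D i) * (Matrix.of fun i j : Fin k => M i j) *
        diagonal (fun i : Fin k => D' i) := by
    ext i j
    simp [Matrix.mul_diagonal, Matrix.diagonal_mul]
  rw [lmin, this, Matrix.det_mul, Matrix.det_mul, Matrix.det_diagonal, Matrix.det_diagonal,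
    Finset.prod_mul_distrib, Finset.prod_range, Finset.prod_range, lmin]
  ring

theorem lmin_succ_of_row {M : ℕ → ℕ → R} {k : ℕ} (h : ∀ j < k, M k j = 0) :
    lmin M (k + 1) = M k k * lmin M k := by
  unfold lmin
  rw [Matrix.det_succ_row _ (Fin.last k), Fin.sum_univ_castSucc, Finset.sum_eq_zero]
  · simp only [Matrix.of_apply, Fin.val_last, Fin.succAbove_last, zero_add]
    rw [← two_mul, pow_mul, neg_one_sq, one_pow, one_mul]
    rfl
  · intro j _
    simp [h j j.2]

theorem lmin_succ_of_col {M : ℕ → ℕ → R} {k : ℕ} (h : ∀ i < k, M i k = 0) :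
    lmin M (k + 1) = M k k * lmin M k := by
  rw [← lmin_transpose, lmin_succ_of_row (M := fun i j => M j i) h, lmin_transpose]

theorem lmin_swap (M : ℕ → ℕ → R) {k r s : ℕ} (hr : r < k) (hs : s < k) (hrs : r ≠ s) :
    lmin (fun i j => M (Equiv.swap r s i) j) k = - lmin M k := by
  have := Matrix.det_permute (Equiv.swap (⟨r, hr⟩ : Fin k) ⟨s, hs⟩)
    (Matrix.of fun i j : Fin k => M i j)
  rw [Equiv.Perm.sign_swap (by simpa [Fin.ext_iff] using hrs)] at this
  unfold lmin
  rw [← neg_one_mul]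
  convert this using 2
  · ext i j
    simp only [Matrix.of_apply, Matrix.submatrix_apply, id]
    congr 1
    rw [Equiv.swap_apply_def, Equiv.swap_apply_def]
    simp only [Fin.ext_iff]
    split_ifs <;> rfl
  · simp

theorem lmin_sub_row (M : ℕ → ℕ → R) {k r s : ℕ} (hr : r < k) (hs : s < k) (hrs : r ≠ s) (α : R) :
    lmin (fun i j => if i = r then M r j - α * M s j else M i j) k = lmin M k := by
  have := Matrix.det_updateRow_add_smul_self (Matrix.of fun i j : Fin k => M i j)
    (i := ⟨r, hr⟩) (j := ⟨s, hs⟩) (by simpa [Fin.ext_iff] using hrs) (-α)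
  unfold lmin
  rw [← this]
  congr 1
  ext i j
  simp only [Matrix.of_apply, Matrix.updateRow_apply, Fin.ext_iff, Pi.add_apply, Pi.smul_apply,
    smul_eq_mul]
  split_ifs
  · ring
  · rfl

theorem lmin_sub_col (M : ℕ → ℕ → R) {k r s : ℕ} (hr : r < k) (hs : s < k) (hrs : r ≠ s) (α : R) :
    lmin (fun i j => if j = r then M i r - α * M i s else M i j) k = lmin M k := by
  rw [← lmin_transpose, lmin_sub_row (fun i j => M j i) hr hs hrs, lmin_transpose]

/-- The minor of size `n` with row and column `c` removed, as a minor of size `n`. -/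
def eminor (M : ℕ → ℕ → R) (n c : ℕ) : R :=
  lmin (fun i j => if i = c ∨ j = c then (if i = j then 1 else 0) else M i j) n

theorem lmin_eq_mul_eminor {M : ℕ → ℕ → R} {n c : ℕ} (hc : c < n)
    (h : ∀ j < n, j ≠ c → M c j = 0) : lmin M n = M c c * eminor M n c := by
  obtain ⟨n, rfl⟩ : ∃ m, n = m + 1 := ⟨n - 1, by omega⟩
  unfold eminor lmin
  rw [Matrix.det_succ_row _ ⟨c, hc⟩, Matrix.det_succ_row _ ⟨c, hc⟩,
    Finset.sum_eq_single ⟨c, hc⟩, Finset.sum_eq_single ⟨c, hc⟩]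
  · simp only [Matrix.of_apply, true_or, if_true, mul_one]
    rw [mul_comm ((-1 : R) ^ _) (M c c), mul_assoc]
    congr 3
    ext i j
    have h1 := Fin.succAbove_ne (⟨c, hc⟩ : Fin (n + 1)) i
    have h2 := Fin.succAbove_ne (⟨c, hc⟩ : Fin (n + 1)) j
    rw [Ne, Fin.ext_iff] at h1 h2
    simp [h1, h2]
  · intro j _ hj
    have : (j : ℕ) ≠ c := fun h => hj (Fin.ext h)
    simp [this, this.symm]
  · simp
  · intro j _ hj
    have : (j : ℕ) ≠ c := fun h => hj (Fin.ext h)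
    simp [h j j.2 this]
  · simp

theorem eminor_congr {M M' : ℕ → ℕ → R} {n c : ℕ}
    (h : ∀ i < n, ∀ j < n, i ≠ c → j ≠ c → M i j = M' i j) : eminor M n c = eminor M' n c := by
  refine lmin_congr fun i hi j hj => ?_
  split_ifs with h1 h2
  · rfl
  · rfl
  · push Not at h1
    exact h i hi j hj h1.1 h1.2

theorem lmin_add_two {M : ℕ → ℕ → R} {y y' : R} (hy : y * y' = 1) (h01 : M 0 1 = y')
    (h10 : M 1 0 = y) (h0 : M 0 0 * M 1 1 = 0) (k : ℕ) :
    lmin M (k + 2) = - lmin (fun i j => M (i + 2) (j + 2) -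
      (M (i + 2) 0 * (y' * M 1 (j + 2) - M 1 1 * M 0 (j + 2)) +
        M (i + 2) 1 * (y * M 0 (j + 2) - M 0 0 * M 1 (j + 2)))) k := by
  let e : Fin 2 ⊕ Fin k ≃ Fin (k + 2) := finSumFinEquiv.trans (finCongr (Nat.add_comm 2 k))
  have hl : ∀ i : Fin 2, ((e (Sum.inl i) : Fin (k + 2)) : ℕ) = i := fun i => by simp [e]
  have hr : ∀ i : Fin k, ((e (Sum.inr i) : Fin (k + 2)) : ℕ) = i + 2 := fun i => by
    simp [e, Nat.add_comm]
  let A : Matrix (Fin 2) (Fin 2) R := Matrix.of fun i j => M i j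
  let A' : Matrix (Fin 2) (Fin 2) R := !![-M 1 1, y'; y, -M 0 0]
  have hAA' : A * A' = 1 := by
    ext i j
    fin_cases i <;> fin_cases j <;> simp [A, A', Matrix.mul_apply, Fin.sum_univ_two, h01, h10]
    · linear_combination hy - h0
    · ring
    · ring
    · linear_combination hy - h0
  have hA'A : A' * A = 1 := mul_eq_one_comm.1 hAA'
  let : Invertible A := ⟨A', hA'A, hAA'⟩
  have hdet : A.det = -1 := by
    simp only [A, Matrix.det_fin_two, Matrix.of_apply, Fin.val_zero, Fin.val_one, h01, h10]
    linear_combination h0 - hy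
  have hblock : (Matrix.of fun i j : Fin (k + 2) => M i j).submatrix e e =
      Matrix.fromBlocks A (Matrix.of fun (i : Fin 2) (j : Fin k) => M i (j + 2))
        (Matrix.of fun (i : Fin k) (j : Fin 2) => M (i + 2) j)
        (Matrix.of fun i j : Fin k => M (i + 2) (j + 2)) := by
    ext i j
    rcases i with i | i <;> rcases j with j | j <;>
      simp only [Matrix.submatrix_apply, Matrix.of_apply, hl, hr, Matrix.fromBlocks_apply₁₁,
        Matrix.fromBlocks_apply₁₂, Matrix.fromBlocks_apply₂₁, Matrix.fromBlocks_apply₂₂, A]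
  unfold lmin
  rw [← Matrix.det_submatrix_equiv_self e, hblock, Matrix.det_fromBlocks₁₁, hdet, neg_one_mul]
  congr 2
  ext i j
  have hinv : ⅟A = A' := rfl
  rw [hinv]
  simp [A', Matrix.mul_apply, Fin.sum_univ_two]
  ring

end LeadingMinors

section Step

variable {R : Type*} [CommRing R]

theorem lmin_add_two_of_antidiag {M : ℕ → ℕ → R} {n : ℕ} (hr : ∀ j < n + 1, M n j = 0)
    (hc : ∀ i < n + 1, M i n = 0) : lmin M (n + 2) = - (M n (n + 1) * M (n + 1) n * lmin M n) := by
  rw [← neg_eq_iff_eq_neg, ← lmin_swap M (show n < n + 2 by omega) (show n + 1 < n + 2 by omega)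
    (by omega), lmin_succ_of_row, lmin_succ_of_col]
  · rw [Equiv.swap_apply_right, Equiv.swap_apply_left, mul_assoc]
    congr 2
    refine lmin_congr fun i hi j hj => ?_
    rw [Equiv.swap_apply_of_ne_of_ne (by omega) (by omega)]
  · intro i hi
    rw [Equiv.swap_apply_of_ne_of_ne (by omega) (by omega)]
    exact hc i (by omega)
  · intro j hj
    rw [Equiv.swap_apply_right]
    exact hr j hj

theorem lmin_add_two_of_antidiag' {M : ℕ → ℕ → R} {n : ℕ} (hr : ∀ j < n + 2, j ≠ n → M (n + 1) j = 0)
    (hc : ∀ i < n + 2, i ≠ n → M i (n + 1) = 0) :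
    lmin M (n + 2) = - (M n (n + 1) * M (n + 1) n * lmin M n) := by
  rw [← neg_eq_iff_eq_neg, ← lmin_swap M (show n < n + 2 by omega) (show n + 1 < n + 2 by omega)
    (by omega), lmin_succ_of_col, lmin_succ_of_row]
  · rw [Equiv.swap_apply_right, Equiv.swap_apply_left, mul_assoc]
    congr 2
    refine lmin_congr fun i hi j hj => ?_
    rw [Equiv.swap_apply_of_ne_of_ne (by omega) (by omega)]
  · intro j hj
    rw [Equiv.swap_apply_left]
    exact hr j (by omega) (by omega)
  · intro i hi
    rcases eq_or_ne i n with rfl | hin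
    · rw [Equiv.swap_apply_left]
      exact hc _ (by omega) (by omega)
    · rw [Equiv.swap_apply_of_ne_of_ne (by omega) (by omega)]
      exact hc i (by omega) hin

theorem lmin_succ_bordered {M : ℕ → ℕ → R} {n c : ℕ} (hcn : c < n)
    (hr : ∀ j < n + 1, j ≠ c → M n j = 0) (hc : ∀ i < n + 1, i ≠ c → M i n = 0) :
    lmin M (n + 1) = - (M c n * M n c * eminor M n c) := by
  rw [← neg_eq_iff_eq_neg, ← lmin_swap M (show c < n + 1 by omega) (show n < n + 1 by omega)
    (by omega), lmin_succ_of_col, lmin_eq_mul_eminor hcn, Equiv.swap_apply_right,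
    Equiv.swap_apply_left, mul_assoc]
  · congr 2
    refine eminor_congr fun i hi j hj hic hjc => ?_
    rw [Equiv.swap_apply_of_ne_of_ne (by omega) (by omega)]
  · intro j hj hjc
    rw [Equiv.swap_apply_left]
    exact hr j (by omega) hjc
  · intro i hi
    rcases eq_or_ne i c with rfl | hic
    · rw [Equiv.swap_apply_left]
      exact hc _ (by omega) (by omega)
    · rw [Equiv.swap_apply_of_ne_of_ne (by omega) (by omega)]
      exact hc i (by omega) hic

/-- The matrix obtained from `M` by adjoining the coordinates `y, y', u, v`. -/
def zstep (M : ℕ → ℕ → R) (n c : ℕ) (y y' u v : R) : ℕ → ℕ → R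
  | 0, 0 => 0
  | 0, 1 => y'
  | 1, 0 => y
  | 1, 1 => M c c
  | 0, j + 2 => if j = c then u else if j = n + 1 then u + y' else 0
  | 1, j + 2 => if j = c ∨ n ≤ j then 0 else M c j
  | i + 2, 0 => if i = c then v else if i = n + 1 then v + y else 0
  | i + 2, 1 => if i = c ∨ n ≤ i then 0 else M i c
  | i + 2, j + 2 => if i = c then (if j = n then v else 0) else if i = n + 1 then
      (if j = n then v else 0) else if i = n then (if j = c ∨ j = n + 1 then u else 0) else
      if n ≤ j ∨ j = c then 0 else M i j

/-- The Schur complement of the leading block of size two in `zstep`. -/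
def zschur (M : ℕ → ℕ → R) (n c : ℕ) (y y' u v : R) (i j : ℕ) : R :=
  zstep M n c y y' u v (i + 2) (j + 2) -
    (zstep M n c y y' u v (i + 2) 0 * (y' * zstep M n c y y' u v 1 (j + 2) -
      M c c * zstep M n c y y' u v 0 (j + 2)) +
        zstep M n c y y' u v (i + 2) 1 * (y * zstep M n c y y' u v 0 (j + 2)))

variable (M : ℕ → ℕ → R) {n c : ℕ} {y y' u v : R}

theorem lmin_zstep (hy : y * y' = 1) (k : ℕ) :
    lmin (zstep M n c y y' u v) (k + 2) = - lmin (zschur M n c y y' u v) k := by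
  rw [lmin_add_two hy (by simp [zstep]) (by simp [zstep]) (by simp [zstep])]
  congr 1
  refine lmin_congr fun i _ j _ => ?_
  rw [zschur]
  simp only [show zstep M n c y y' u v 1 1 = M c c by simp [zstep],
    show zstep M n c y y' u v 0 0 = 0 by simp [zstep], zero_mul, sub_zero]

theorem zschur_of_lt (hy : y * y' = 1) {i j : ℕ} (hi : i < n) (hj : j < n) :
    zschur M n c y y' u v i j =
      (if i = c then -(v * y') else 1) * M i j * (if j = c then -(u * y) else 1) := by
  have h1 : i ≠ n := by omega
  have h2 : i ≠ n + 1 := by omega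
  have h3 : j ≠ n := by omega
  have h4 : j ≠ n + 1 := by omega
  have h5 : ¬ n ≤ j := by omega
  have h6 : ¬ n ≤ i := by omega
  by_cases hic : i = c <;> by_cases hjc : j = c <;> (try subst hic) <;> (try subst hjc) <;>
    simp [zschur, zstep, *]
  · linear_combination (-M j j * v * u) * hy
  · ring
  · ring

theorem lmin_zstep_of_le (hy : y * y' = 1) (hcn : c < n) {k : ℕ} (hk : k ≤ c) :
    lmin (zstep M n c y y' u v) (k + 2) = - lmin M k := by
  rw [lmin_zstep M hy]
  congr 1
  refine lmin_congr fun i hi j hj => ?_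
  rw [zschur_of_lt M hy (by omega) (by omega), if_neg (by omega), if_neg (by omega), one_mul, mul_one]

theorem lmin_zschur (hy : y * y' = 1) {k : ℕ} (hk : c < k) (hkn : k ≤ n) :
    lmin (zschur M n c y y' u v) k = u * v * lmin M k := by
  rw [lmin_congr (fun i hi j hj => zschur_of_lt M hy (by omega) (by omega)), lmin_scale]
  congr 1
  rw [Finset.prod_eq_single c]
  · simp only [if_true]
    linear_combination u * v * hy
  · intro i _ hi
    simp [hi]
  · intro h
    exact absurd (Finset.mem_range.2 hk) h

theorem eminor_zschur (hy : y * y' = 1) :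
    eminor (zschur M n c y y' u v) n c = eminor M n c := by
  refine eminor_congr fun i hi j hj hic hjc => ?_
  rw [zschur_of_lt M hy (by omega) (by omega), if_neg hic, if_neg hjc, one_mul, mul_one]

theorem zschur_right {i : ℕ} (hi : i < n + 2) (hcn : c < n) :
    zschur M n c y y' u v i n = if i = c ∨ i = n + 1 then v else 0 := by
  by_cases hic : i = c
  · subst hic
    simp [zschur, zstep, hcn.ne, hcn.ne']
  · by_cases h1 : i = n + 1
    · subst h1
      simp [zschur, zstep, hcn.ne, hcn.ne', hic]
    · by_cases h2 : i = n
      · subst h2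
        simp [zschur, zstep, hcn.ne, hcn.ne', hic]
      · have h3 : ¬ n ≤ i := by omega
        simp [zschur, zstep, hcn.ne, hcn.ne', *]

theorem zschur_bot {j : ℕ} (hj : j < n + 2) (hcn : c < n) :
    zschur M n c y y' u v n j = if j = c ∨ j = n + 1 then u else 0 := by
  have h0 : n ≠ c := by omega
  by_cases hic : j = c
  · subst hic
    simp [zschur, zstep, h0]
  · by_cases h1 : j = n + 1
    · subst h1
      simp [zschur, zstep, h0]
    · simp [zschur, zstep, *]

theorem zschur_last {j : ℕ} (hj : j < n + 2) (hjn : j ≠ n) (hcn : c < n) :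
    v * zschur M n c y y' u v (n + 1) j = (v + y) * zschur M n c y y' u v c j := by
  have h0 : n + 1 ≠ c := by omega
  have h0' : n + 1 ≠ n := by omega
  by_cases hic : j = c
  · subst hic
    simp [zschur, zstep, h0, hjn]
    ring
  · by_cases h1 : j = n + 1
    · subst h1
      simp [zschur, zstep, h0]
      ring
    · have h3 : ¬ n ≤ j := by omega
      simp [zschur, zstep, *]
      ring

theorem zschur_last' {i : ℕ} (hi : i < n + 2) (hin : i ≠ n) (hcn : c < n) :
    u * zschur M n c y y' u v i (n + 1) = (u + y') * zschur M n c y y' u v i c := by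
  have h0 : n + 1 ≠ c := by omega
  have h0' : n + 1 ≠ n := by omega
  have h0'' : c ≠ n := by omega
  by_cases hic : i = c
  · subst hic
    simp [zschur, zstep, h0, hin]
    ring
  · by_cases h1 : i = n + 1
    · subst h1
      simp [zschur, zstep, h0, h0'']
      ring
    · have h3 : ¬ n ≤ i := by omega
      simp [zschur, zstep, *]
      ring

theorem lmin_zstep_add_two (hy : y * y' = 1) {k : ℕ} (hk : c < k) (hkn : k ≤ n) :
    lmin (zstep M n c y y' u v) (k + 2) = - (u * v * lmin M k) := by
  rw [lmin_zstep M hy, lmin_zschur M hy hk hkn]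

theorem lmin_zstep_add_three (hy : y * y' = 1) (hcn : c < n) :
    lmin (zstep M n c y y' u v) (n + 3) = u * v * eminor M n c := by
  rw [lmin_zstep M hy (n + 1), lmin_succ_bordered hcn, eminor_zschur M hy,
    zschur_right M (by omega) hcn, zschur_bot M (by omega) hcn]
  · simp
    ring
  · intro j hj hjc
    rw [zschur_bot M (by omega) hcn, if_neg (by omega)]
  · intro j hj hjc
    rw [zschur_right M (by omega) hcn, if_neg (by omega)]

theorem lmin_zstep_add_four (hy : y * y' = 1) {u' v' : R} (hu : u * u' = 1) (hv : v * v' = 1)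
    (hcn : c < n) :
    lmin (zstep M n c y y' u v) (n + 4) = u * v * lmin M n := by
  have h0 : c ≠ n := by omega
  have h1 : c ≠ n + 1 := by omega
  have hrow : ∀ j < n + 2, j ≠ n → zschur M n c y y' u v (n + 1) j -
      (1 + v' * y) * zschur M n c y y' u v c j = 0 := fun j hj hjn => by
    linear_combination v' * zschur_last M (y := y) (y' := y') (u := u) (v := v) hj hjn hcn -
      (zschur M n c y y' u v (n + 1) j - zschur M n c y y' u v c j) * hv
  have hcol : ∀ i < n + 2, i ≠ n → zschur M n c y y' u v i (n + 1) -
      (1 + u' * y') * zschur M n c y y' u v i c = 0 := fun i hi hin => by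
    linear_combination u' * zschur_last' M (y := y) (y' := y') (u := u) (v := v) hi hin hcn -
      (zschur M n c y y' u v i (n + 1) - zschur M n c y y' u v i c) * hu
  rw [lmin_zstep M hy (n + 2),
    ← lmin_sub_row _ (show n + 1 < n + 2 by omega) (show c < n + 2 by omega) (by omega) (1 + v' * y),
    ← lmin_sub_col _ (show n + 1 < n + 2 by omega) (show c < n + 2 by omega) (by omega) (1 + u' * y'),
    lmin_add_two_of_antidiag', neg_neg]
  · have h2 : lmin (fun i j => if j = n + 1 then
        (if i = n + 1 then zschur M n c y y' u v (n + 1) (n + 1) -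
          (1 + v' * y) * zschur M n c y y' u v c (n + 1) else zschur M n c y y' u v i (n + 1)) -
        (1 + u' * y') * (if i = n + 1 then zschur M n c y y' u v (n + 1) c -
          (1 + v' * y) * zschur M n c y y' u v c c else zschur M n c y y' u v i c) else
        if i = n + 1 then zschur M n c y y' u v (n + 1) j -
          (1 + v' * y) * zschur M n c y y' u v c j else zschur M n c y y' u v i j) n =
        lmin (zschur M n c y y' u v) n :=
      lmin_congr fun i hi j hj => by
        rw [if_neg (by omega), if_neg (by omega)]
    rw [h2, lmin_zschur M hy hcn le_rfl]
    simp only [if_true, if_neg (show n ≠ n + 1 by omega)]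
    rw [zschur_right M (by omega) hcn, zschur_right M (by omega) hcn, zschur_bot M (by omega) hcn,
      zschur_bot M (by omega) hcn]
    simp only [true_or, or_true, if_true]
    linear_combination (u * v * lmin M n) * (hy + (y * y' * v * v') * hu + y * y' * hv)
  · intro j hj hjn
    simp only [if_true]
    rcases eq_or_ne j (n + 1) with rfl | hj1
    · rw [if_pos rfl, hrow _ (by omega) (by omega), hrow _ (by omega) (by omega), mul_zero, sub_zero]
    · rw [if_neg hj1, hrow _ hj hjn]
  · intro i hi hin
    simp only [if_true]
    rcases eq_or_ne i (n + 1) with rfl | hi1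
    · rw [if_pos rfl, if_pos rfl, hrow _ (by omega) (by omega), hrow _ (by omega) (by omega), mul_zero,
        sub_zero]
    · rw [if_neg hi1, if_neg hi1, hcol _ hi hin]

theorem eminor_zstep (hy : y * y' = 1) (hcn : c < n) :
    eminor (zstep M n c y y' u v) (n + 4) (c + 2) = u * v * eminor M n c := by
  have h0 : c ≠ n := by omega
  have h1 : c ≠ n + 1 := by omega
  rw [eminor, lmin_add_two hy (by simp [zstep]) (by simp [zstep]) (by simp [zstep])]
  have h2 : lmin (fun i j => if i = c ∨ j = c then (if i = j then 1 else 0) else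
      zschur M n c y y' u v i j) (n + 2) = - (u * v * eminor M n c) := by
    rw [lmin_add_two_of_antidiag, zschur_right M (by omega) hcn, zschur_bot M (by omega) hcn,
      ← eminor_zschur (u := u) (v := v) M hy, eminor]
    · simp [h0.symm, h1.symm]
    · intro j hj
      rw [zschur_bot M (by omega) hcn]
      split_ifs <;> first | rfl | omega
    · intro i hi
      rw [zschur_right M (by omega) hcn]
      split_ifs <;> first | rfl | omega
  rw [neg_eq_iff_eq_neg, ← h2]
  refine lmin_congr fun i hi j hj => ?_
  by_cases hic : i = c <;> by_cases hjc : j = c <;> simp [hic, hjc, zschur, zstep]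

end Step

section Leading

variable {Ω : Type*} [Field Ω]

/-- `P` has order `v` at zero, with leading coefficient `c` (unless `c = 0`). -/
def Lead (P : Polynomial Ω) (v : ℕ) (c : Ω) : Prop :=
  ∃ R : Polynomial Ω, P = Polynomial.X ^ v * (Polynomial.C c + Polynomial.X * R)

theorem Lead.mul {P Q : Polynomial Ω} {v w : ℕ} {c d : Ω} (hP : Lead P v c) (hQ : Lead Q w d) :
    Lead (P * Q) (v + w) (c * d) := by
  obtain ⟨R, rfl⟩ := hP
  obtain ⟨S, rfl⟩ := hQ
  refine ⟨Polynomial.C c * S + R * Polynomial.C d + Polynomial.X * R * S, ?_⟩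
  rw [Polynomial.C_mul]
  ring

theorem lead_C (c : Ω) : Lead (Polynomial.C c) 0 c := ⟨0, by simp⟩

theorem lead_X_pow (v : ℕ) : Lead (Polynomial.X ^ v : Polynomial Ω) v 1 := ⟨0, by simp⟩

theorem lead_one : Lead (1 : Polynomial Ω) 0 1 := lead_C 1

theorem Lead.C_mul {P : Polynomial Ω} {v : ℕ} {c : Ω} (hP : Lead P v c) (d : Ω) :
    Lead (Polynomial.C d * P) v (d * c) := by
  simpa using (lead_C d).mul hP

theorem Lead.neg {P : Polynomial Ω} {v : ℕ} {c : Ω} (hP : Lead P v c) : Lead (-P) v (-c) := by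
  simpa using hP.C_mul (-1)

theorem Lead.pow {P : Polynomial Ω} {v : ℕ} {c : Ω} (hP : Lead P v c) (a : ℕ) :
    Lead (P ^ a) (a * v) (c ^ a) := by
  induction a with
  | zero => simpa using lead_C (1 : Ω)
  | succ a ih =>
    rw [pow_succ, pow_succ, Nat.succ_mul]
    exact ih.mul hP

theorem Lead.prod {ι : Type*} (s : Finset ι) {P : ι → Polynomial Ω} {v : ι → ℕ} {c : ι → Ω}
    (h : ∀ i ∈ s, Lead (P i) (v i) (c i)) :
    Lead (∏ i ∈ s, P i) (∑ i ∈ s, v i) (∏ i ∈ s, c i) := by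
  classical
  induction s using Finset.induction_on with
  | empty => simpa using lead_one
  | insert i s hi ih =>
    rw [Finset.prod_insert hi, Finset.sum_insert hi, Finset.prod_insert hi]
    exact (h i (Finset.mem_insert_self _ _)).mul (ih fun j hj => h j (Finset.mem_insert_of_mem hj))

theorem Lead.of_dvd_sub {P Q : Polynomial Ω} {v N : ℕ} {c : Ω} (hP : Lead P v c) (hN : v < N)
    (h : Polynomial.X ^ N ∣ Q - P) : Lead Q v c := by
  obtain ⟨R, rfl⟩ := hP
  obtain ⟨S, hS⟩ := h
  obtain ⟨d, rfl⟩ := Nat.exists_eq_add_of_lt hN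
  refine ⟨R + Polynomial.X ^ d * S, ?_⟩
  rw [sub_eq_iff_eq_add.1 hS]
  ring

theorem Lead.coeff {P : Polynomial Ω} {v : ℕ} {c : Ω} (hP : Lead P v c) : P.coeff v = c := by
  obtain ⟨R, rfl⟩ := hP
  rw [Polynomial.coeff_X_pow_mul']
  simp

theorem dvd_lmin_sub_lmin {R : Type*} [CommRing R] {d : R} {M M' : ℕ → ℕ → R} {k : ℕ}
    (h : ∀ i < k, ∀ j < k, d ∣ M' i j - M i j) : d ∣ lmin M' k - lmin M k := by
  have : ∀ x y : R, d ∣ x - y ↔ Ideal.Quotient.mk (Ideal.span {d}) x =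
      Ideal.Quotient.mk (Ideal.span {d}) y := fun x y => by
    rw [Ideal.Quotient.eq, Ideal.mem_span_singleton]
  rw [this, map_lmin, map_lmin]
  exact lmin_congr fun i hi j hj => (this _ _).1 (h i hi j hj)

theorem dvd_eminor_sub_eminor {R : Type*} [CommRing R] {d : R} {M M' : ℕ → ℕ → R} {k c : ℕ}
    (h : ∀ i < k, ∀ j < k, d ∣ M' i j - M i j) : d ∣ eminor M' k c - eminor M k c := by
  refine dvd_lmin_sub_lmin fun i hi j hj => ?_
  split_ifs
  · simp
  · simp
  · exact h i hi j hj

/-- The matrix of the bilinear form `diag x` in the vectors `A i`, `B j`. -/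
noncomputable def form {κ : Type*} [Fintype κ] (A B : ℕ → κ → Polynomial Ω) (x : κ → Ω) (i j : ℕ) :
    Polynomial Ω :=
  ∑ e, A i e * Polynomial.C (x e) * B j e

/-- The leading minors of size at most `n` of suitable transforms of the diagonal matrices `x τ`
have leading coefficients independent of `τ`. -/
def Good {κ ι : Type*} [Fintype κ] (x : ι → κ → Ω) (n : ℕ) : Prop :=
  ∃ (A B : ℕ → κ → Polynomial Ω) (v : ℕ → ℕ) (K : ℕ → Ω), (∀ k, K k ≠ 0) ∧
    ∀ τ, ∀ k ≤ n, Lead (lmin (form A B (x τ)) k) (v k) (K k)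

/-- A variant of `Good` where the leading minors of size greater than `c` are proportional to
`ζ τ`. -/
def GoodAbove {κ ι : Type*} [Fintype κ] (x : ι → κ → Ω) (n c : ℕ) (ζ : ι → Ω) : Prop :=
  ∃ (A B : ℕ → κ → Polynomial Ω) (v : ℕ → ℕ) (K : ℕ → Ω) (w : ℕ) (L : Ω), (∀ k, K k ≠ 0) ∧ L ≠ 0 ∧
    (∀ τ, ∀ k ≤ n, Lead (lmin (form A B (x τ)) k) (v k) (K k * if k ≤ c then 1 else ζ τ)) ∧
    ∀ τ, Lead (eminor (form A B (x τ)) n c) w (L * ζ τ)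

theorem GoodAbove.good {κ ι : Type*} [Fintype κ] {x : ι → κ → Ω} {n c : ℕ} {ζ : ι → Ω}
    (h : GoodAbove x n c ζ) (hζ : ∀ τ, ζ τ = 1) : Good x n := by
  obtain ⟨A, B, v, K, _, _, hK, _, h, _⟩ := h
  exact ⟨A, B, v, K, hK, fun τ k hk => by simpa [hζ] using h τ k hk⟩

theorem good_one {κ ι : Type*} [Fintype κ] [DecidableEq κ] {x : ι → κ → Ω} (e : κ)
    (he : ∀ τ, x τ e = 1) : Good x 1 := by
  refine ⟨fun _ => Pi.single e 1, fun _ => Pi.single e 1, 0, 1, fun _ => one_ne_zero,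
    fun τ k hk => ?_⟩
  interval_cases k
  · rw [lmin_zero]; exact lead_one
  · rw [lmin_one, form, Finset.sum_eq_single e]
    · simpa [he] using lead_one
    · intro b _ hb
      simp [hb]
    · simp

theorem Good.add_pair {κ ι : Type*} [Fintype κ] [DecidableEq κ] {x : ι → κ → Ω} {n : ℕ}
    (h : Good x n) (e : κ) (he : ∀ τ, x τ e = 1) {y y' : ι → Ω} (hy : ∀ τ, y τ * y' τ = 1) :
    Good (fun τ => Sum.elim (x τ) ![y τ, y' τ]) (n + 2) := by
  obtain ⟨A, B, v, K, hK, h⟩ := h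
  let A' : ℕ → κ ⊕ Fin 2 → Polynomial Ω
    | 0 => Sum.elim (Pi.single e 1) ![1, 0]
    | 1 => Sum.elim 0 ![0, 1]
    | i + 2 => Sum.elim (A i) 0
  let B' : ℕ → κ ⊕ Fin 2 → Polynomial Ω
    | 0 => Sum.elim (Pi.single e 1) ![0, 1]
    | 1 => Sum.elim 0 ![1, 0]
    | i + 2 => Sum.elim (B i) 0
  have hf : ∀ τ i j, form A' B' (Sum.elim (x τ) ![y τ, y' τ]) i j = 
      ∑ a, A' i (Sum.inl a) * Polynomial.C (x τ a) * B' j (Sum.inl a) +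
      (A' i (Sum.inr 0) * Polynomial.C (y τ) * B' j (Sum.inr 0) +
        A' i (Sum.inr 1) * Polynomial.C (y' τ) * B' j (Sum.inr 1)) := by
    intro τ i j
    simp [form, Fintype.sum_sum_type, Fin.sum_univ_two]
  refine ⟨A', B', fun k => if k < 2 then 0 else v (k - 2),
    fun k => if k < 2 then 1 else - K (k - 2), fun k => ?_, fun τ k hk => ?_⟩
  · beta_reduce
    split_ifs
    · exact one_ne_zero
    · exact neg_ne_zero.2 (hK _)
  · match k with
    | 0 => simpa [lmin_zero] using lead_one
    | 1 =>
      rw [lmin_one, hf, Finset.sum_eq_single e]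
      · simpa [he, A', B'] using lead_one
      · intro b _ hb
        simp [hb, A']
      · simp
    | k + 2 =>
      have hy' : Polynomial.C (y' τ) * Polynomial.C (y τ) = 1 := by
        rw [← Polynomial.C_mul, mul_comm, hy, Polynomial.C_1]
      rw [lmin_add_two hy' (by rw [hf]; simp [A', B']) (by rw [hf]; simp [A', B'])
        (by rw [hf τ 1 1]; simp [A', B'])]
      simp only [show ¬ k + 2 < 2 by omega, if_false, Nat.add_sub_cancel]
      refine Lead.neg ?_
      convert h τ k (by omega) using 1
      refine lmin_congr fun i _ j _ => ?_
      simp [hf, A', B', form]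

theorem goodAbove_two {ι : Type*} {x : ι → Fin 2 → Ω} (hx : ∀ τ, x τ 0 = 1) :
    GoodAbove x 2 0 (fun τ => x τ 1) := by
  let A : ℕ → Fin 2 → Polynomial Ω
    | 0 => ![0, 1]
    | _ => ![Polynomial.X, 1]
  have h00 : ∀ τ, form A A (x τ) 0 0 = Polynomial.C (x τ 1) := fun τ => by simp [form, A]
  have h01 : ∀ τ, form A A (x τ) 0 1 = Polynomial.C (x τ 1) := fun τ => by simp [form, A]
  have h10 : ∀ τ, form A A (x τ) 1 0 = Polynomial.C (x τ 1) := fun τ => by simp [form, A]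
  have h11 : ∀ τ, form A A (x τ) 1 1 = Polynomial.X ^ 2 + Polynomial.C (x τ 1) := fun τ => by
    simp [form, A, hx]; ring
  refine ⟨A, A, fun k => if k < 2 then 0 else 2, 1, 0, 1, fun _ => one_ne_zero, one_ne_zero,
    fun τ k hk => ?_, fun τ => ?_⟩
  · interval_cases k
    · simpa [lmin_zero] using lead_one
    · simpa [lmin_one, h00] using lead_C (x τ 1)
    · rw [lmin_two, h00, h01, h10, h11]
      refine ⟨0, ?_⟩
      simp
      ring
  · rw [eminor, lmin_two]
    refine ⟨Polynomial.X, ?_⟩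
    simp [h11]
    ring

theorem GoodAbove.add_four {κ ι : Type*} [Fintype κ] [DecidableEq κ] {x : ι → κ → Ω} {n c : ℕ}
    {ζ : ι → Ω} (h : GoodAbove x n c ζ) (hcn : c < n) (e : κ) (he : ∀ τ, x τ e = 1)
    {y y' u v : ι → Ω} (hy : ∀ τ, y τ * y' τ = 1) (hu : ∀ τ, u τ ≠ 0) (hv : ∀ τ, v τ ≠ 0) :
    GoodAbove (fun τ => Sum.elim (x τ) ![y τ, y' τ, u τ, v τ]) (n + 4) (c + 2)
      (fun τ => ζ τ * (u τ * v τ)) := by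
  obtain ⟨A, B, o, K, w, L, hK, hL, h, hE⟩ := h
  let N := w + (∑ k ∈ Finset.range (n + 1), o k) + 1
  have hw : w < N := by simp only [N]; omega
  have ho : ∀ k ≤ n, o k < N := fun k hk => by
    have := Finset.single_le_sum (f := o) (fun _ _ => Nat.zero_le _)
      (Finset.mem_range.2 (Nat.lt_add_one_of_le hk))
    simp only [N]; omega
  let A' : ℕ → κ ⊕ Fin 4 → Polynomial Ω
    | 0 => Sum.elim (Pi.single e (Polynomial.X ^ N)) ![0, 1, 1, 0]
    | 1 => Sum.elim (A c) ![1, 0, 0, 0]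
    | i + 2 => Sum.elim (if i = c ∨ n ≤ i then 0 else A i) (if i = c then ![0, 0, 0, 1] else
        if i = n + 1 then ![1, 0, 0, 1] else if i = n then ![0, 0, 1, 0] else 0)
  let B' : ℕ → κ ⊕ Fin 4 → Polynomial Ω
    | 0 => Sum.elim (Pi.single e (Polynomial.X ^ N)) ![1, 0, 0, 1]
    | 1 => Sum.elim (B c) ![0, 1, 0, 0]
    | i + 2 => Sum.elim (if i = c ∨ n ≤ i then 0 else B i) (if i = c then ![0, 0, 1, 0] else
        if i = n + 1 then ![0, 1, 1, 0] else if i = n then ![0, 0, 0, 1] else 0)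
  have hf : ∀ τ i j, form A' B' (Sum.elim (x τ) ![y τ, y' τ, u τ, v τ]) i j =
      ∑ a, A' i (Sum.inl a) * Polynomial.C (x τ a) * B' j (Sum.inl a) +
      (A' i (Sum.inr 0) * Polynomial.C (y τ) * B' j (Sum.inr 0) +
        A' i (Sum.inr 1) * Polynomial.C (y' τ) * B' j (Sum.inr 1) +
        A' i (Sum.inr 2) * Polynomial.C (u τ) * B' j (Sum.inr 2) +
        A' i (Sum.inr 3) * Polynomial.C (v τ) * B' j (Sum.inr 3)) := by
    intro τ i j
    simp [form, Fintype.sum_sum_type, Fin.sum_univ_four]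
  have hl : ∀ τ (f : κ → Polynomial Ω), ∑ a, (Pi.single e (Polynomial.X ^ N) : κ → Polynomial Ω) a *
      Polynomial.C (x τ a) * f a = Polynomial.X ^ N * f e := by
    intro τ f
    rw [Finset.sum_eq_single e]
    · simp [he]
    · intro b _ hb
      simp [hb]
    · simp
  have hr : ∀ τ (f : κ → Polynomial Ω), ∑ a, f a * Polynomial.C (x τ a) *
      (Pi.single e (Polynomial.X ^ N) : κ → Polynomial Ω) a = Polynomial.X ^ N * f e := by
    intro τ f
    rw [Finset.sum_eq_single e]
    · simp [he, mul_comm]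
    · intro b _ hb
      simp [hb]
    · simp
  have hdvd : ∀ τ, ∀ i < n + 4, ∀ j < n + 4, Polynomial.X ^ N ∣
      form A' B' (Sum.elim (x τ) ![y τ, y' τ, u τ, v τ]) i j -
        zstep (form A B (x τ)) n c (Polynomial.C (y τ)) (Polynomial.C (y' τ))
          (Polynomial.C (u τ)) (Polynomial.C (v τ)) i j := by
    intro τ i hi j hj
    have hc1 : c ≠ n := hcn.ne
    have hc2 : c ≠ n + 1 := by omega
    have hc3 : ¬ n ≤ c := by omega
    rw [hf]
    match i, j with
    | 0, 0 => simp [A', B', zstep, hl]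
    | 0, 1 => simp [A', B', zstep, hl]
    | 1, 0 => simp [A', B', zstep, hr]
    | 1, 1 => simp [A', B', zstep, form]
    | 0, j + 2 =>
      by_cases h1 : j = c
      · subst h1; simp [A', B', zstep]
      by_cases h2 : j = n + 1
      · subst h2; simp [A', B', zstep, h1, add_comm]
      by_cases h3 : j = n
      · subst h3; simp [A', B', zstep, h1]
      · have h4 : ¬ n ≤ j := by omega
        simp [A', B', zstep, hl, *]
    | 1, j + 2 =>
      by_cases h1 : j = c
      · subst h1; simp [A', B', zstep]
      by_cases h2 : j = n + 1
      · subst h2; simp [A', B', zstep, h1]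
      by_cases h3 : j = n
      · subst h3; simp [A', B', zstep, h1]
      · have h4 : ¬ n ≤ j := by omega
        simp [A', B', zstep, form, *]
    | i + 2, 0 =>
      by_cases h1 : i = c
      · subst h1; simp [A', B', zstep]
      by_cases h2 : i = n + 1
      · subst h2; simp [A', B', zstep, h1, add_comm]
      by_cases h3 : i = n
      · subst h3; simp [A', B', zstep, h1]
      · have h4 : ¬ n ≤ i := by omega
        simp [A', B', zstep, hr, *]
    | i + 2, 1 =>
      by_cases h1 : i = c
      · subst h1; simp [A', B', zstep]
      by_cases h2 : i = n + 1
      · subst h2; simp [A', B', zstep, h1]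
      by_cases h3 : i = n
      · subst h3; simp [A', B', zstep, h1]
      · have h4 : ¬ n ≤ i := by omega
        simp [A', B', zstep, form, *]
    | i + 2, j + 2 =>
      by_cases h1 : i = c
      · subst h1
        by_cases h5 : j = i
        · subst h5; simp [A', B', zstep, hc1]
        by_cases h6 : j = n + 1
        · subst h6; simp [A', B', zstep, *]
        by_cases h7 : j = n
        · subst h7; simp [A', B', zstep, *]
        · simp [A', B', zstep, *]
      by_cases h2 : i = n + 1
      · subst h2
        by_cases h5 : j = c
        · subst h5; simp [A', B', zstep, *]
        by_cases h6 : j = n + 1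
        · subst h6; simp [A', B', zstep, *]
        by_cases h7 : j = n
        · subst h7; simp [A', B', zstep, *]
        · simp [A', B', zstep, *]
      by_cases h3 : i = n
      · subst h3
        by_cases h5 : j = c
        · subst h5; simp [A', B', zstep, *]
        by_cases h6 : j = i + 1
        · subst h6; simp [A', B', zstep, *]
        by_cases h7 : j = i
        · subst h7; simp [A', B', zstep, *]
        · simp [A', B', zstep, *]
      · have h4 : ¬ n ≤ i := by omega
        by_cases h5 : j = c
        · subst h5; simp [A', B', zstep, *]
        by_cases h6 : j = n + 1
        · subst h6; simp [A', B', zstep, *]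
        by_cases h7 : j = n
        · subst h7; simp [A', B', zstep, *]
        · have h8 : ¬ n ≤ j := by omega
          simp [A', B', zstep, form, *]
  have hy' : ∀ τ, Polynomial.C (y τ) * Polynomial.C (y' τ) = 1 := fun τ => by
    rw [← Polynomial.C_mul, hy, Polynomial.C_1]
  have hu' : ∀ τ, Polynomial.C (u τ) * Polynomial.C (u τ)⁻¹ = 1 := fun τ => by
    rw [← Polynomial.C_mul, mul_inv_cancel₀ (hu τ), Polynomial.C_1]
  have hv' : ∀ τ, Polynomial.C (v τ) * Polynomial.C (v τ)⁻¹ = 1 := fun τ => by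
    rw [← Polynomial.C_mul, mul_inv_cancel₀ (hv τ), Polynomial.C_1]
  refine ⟨A', B', fun k => if k = 0 then 0 else if k = 1 then 2 * N else if k ≤ n + 2 then o (k - 2)
      else if k = n + 3 then w else o n,
    fun k => if k < 2 then 1 else if k ≤ n + 2 then - K (k - 2) else if k = n + 3 then L else K n,
    w, L, fun k => ?_, hL, fun τ k hk => ?_, fun τ => ?_⟩
  · beta_reduce
    split_ifs
    · exact one_ne_zero
    · exact neg_ne_zero.2 (hK _)
    · exact hL
    · exact hK _
  · match k with
    | 0 => simpa [lmin_zero] using lead_one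
    | 1 =>
      have h0 : ∑ a, A' 0 (Sum.inl a) * Polynomial.C (x τ a) * B' 0 (Sum.inl a) =
        Polynomial.X ^ N * B' 0 (Sum.inl e) := hl τ _
      rw [lmin_one, hf, h0]
      simpa [B', A', ← pow_add, ← two_mul] using lead_X_pow (2 * N)
    | k + 2 =>
      have hk1 : k + 2 ≠ 0 := by omega
      have hk2 : k + 2 ≠ 1 := by omega
      have hk3 : ¬ k + 2 < 2 := by omega
      have hkd := dvd_lmin_sub_lmin (k := k + 2)
        fun i hi j hj => hdvd τ i (by omega) j (by omega)
      simp only [hk1, hk2, hk3, if_false, Nat.add_sub_cancel, Nat.add_le_add_iff_right]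
      by_cases h1 : k ≤ n
      · simp only [h1, if_true]
        have h2 := h τ k h1
        refine Lead.of_dvd_sub ?_ (ho k h1) hkd
        by_cases h3 : k ≤ c
        · rw [if_pos h3] at h2 ⊢
          rw [lmin_zstep_of_le _ (hy' τ) hcn h3]
          simpa using h2.neg
        · rw [if_neg h3] at h2 ⊢
          rw [lmin_zstep_add_two _ (hy' τ) (by omega) h1, ← Polynomial.C_mul]
          convert (h2.C_mul (u τ * v τ)).neg using 1
          ring
      · have h4 : ¬ k ≤ c := by omega
        simp only [h1, h4, if_false]
        obtain rfl | rfl : k = n + 1 ∨ k = n + 2 := by omega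
        · simp only [if_true]
          refine Lead.of_dvd_sub ?_ hw hkd
          rw [lmin_zstep_add_three _ (hy' τ) hcn, ← Polynomial.C_mul]
          convert (hE τ).C_mul (u τ * v τ) using 1
          ring
        · simp only [show ¬ n + 2 + 2 = n + 3 by omega, if_false]
          refine Lead.of_dvd_sub ?_ (ho n le_rfl) hkd
          rw [lmin_zstep_add_four _ (hy' τ) (hu' τ) (hv' τ) hcn, ← Polynomial.C_mul]
          have h2 := h τ n le_rfl
          rw [if_neg (by omega)] at h2
          convert h2.C_mul (u τ * v τ) using 1
          ring
  · refine Lead.of_dvd_sub ?_ hw (dvd_eminor_sub_eminor (k := n + 4) (hdvd τ))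
    rw [eminor_zstep _ (hy' τ) hcn, ← Polynomial.C_mul]
    convert (hE τ).C_mul (u τ * v τ) using 1
    ring

end Leading

section Torus

variable {Ω : Type*} [Field Ω]

/-- The powers of the diagonal matrix with diagonal entries the elements of `D` form a good
family. -/
def GoodTorus (D : Multiset Ω) : Prop :=
  ∃ (κ : Type) (_ : Fintype κ) (_ : DecidableEq κ) (e : κ) (d : κ → Ω), d e = 1 ∧
    Finset.univ.val.map d = D ∧ Good (fun (τ : ℕ) k => d k ^ τ) D.card

/-- A version of `GoodTorus` for the predicate `GoodAbove`. -/
def GoodTorusAbove (D : Multiset Ω) (c : ℕ) (z : Ω) : Prop :=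
  c < D.card ∧ ∃ (κ : Type) (_ : Fintype κ) (_ : DecidableEq κ) (e : κ) (d : κ → Ω), d e = 1 ∧
    Finset.univ.val.map d = D ∧ GoodAbove (fun (τ : ℕ) k => d k ^ τ) D.card c fun τ => z ^ τ

theorem map_univ_sum_elim {α β γ : Type*} [Fintype α] [Fintype β] (f : α → γ) (g : β → γ) :
    (Finset.univ : Finset (α ⊕ β)).val.map (Sum.elim f g) =
      Finset.univ.val.map f + Finset.univ.val.map g := by
  rw [← Finset.univ_disjSum_univ, Finset.val_disjSum, Multiset.disjSum, Multiset.map_add,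
    Multiset.map_map, Multiset.map_map]
  rfl

theorem GoodTorusAbove.good {D : Multiset Ω} {c : ℕ} (h : GoodTorusAbove D c 1) : GoodTorus D := by
  obtain ⟨_, κ, _, _, e, d, he, hd, h⟩ := h
  exact ⟨κ, _, ‹_›, e, d, he, hd, h.good fun τ => one_pow τ⟩

theorem goodTorus_one : GoodTorus ({1} : Multiset Ω) := by
  refine ⟨Unit, inferInstance, inferInstance, (), fun _ => 1, rfl, by simp, ?_⟩
  rw [Multiset.card_singleton]
  exact good_one () fun τ => one_pow τ

theorem GoodTorus.add_pair {D : Multiset Ω} (h : GoodTorus D) {y : Ω} (hy : y ≠ 0) :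
    GoodTorus (D + {y, y⁻¹}) := by
  obtain ⟨κ, _, _, e, d, he, hd, h⟩ := h
  refine ⟨κ ⊕ Fin 2, inferInstance, inferInstance, Sum.inl e, Sum.elim d ![y, y⁻¹], he, ?_, ?_⟩
  · rw [map_univ_sum_elim, hd]
    rfl
  · have := h.add_pair e (fun τ => by rw [he, one_pow])
      (y := fun τ => y ^ τ) (y' := fun τ => y⁻¹ ^ τ) (fun τ => by
        rw [← mul_pow, mul_inv_cancel₀ hy, one_pow])
    convert this using 1
    · funext τ k
      rcases k with k | k
      · rfl
      · fin_cases k <;> rfl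
    · simp

theorem goodTorusAbove_two (z : Ω) : GoodTorusAbove ({1, z} : Multiset Ω) 0 z := by
  refine ⟨by simp, Fin 2, inferInstance, inferInstance, 0, ![1, z], rfl, rfl, ?_⟩
  have := goodAbove_two (x := fun (τ : ℕ) (k : Fin 2) => ![1, z] k ^ τ) (fun τ => by simp)
  exact this

theorem GoodTorusAbove.add_four {D : Multiset Ω} {c : ℕ} {z : Ω} (h : GoodTorusAbove D c z)
    {y u v : Ω} (hy : y ≠ 0) (hu : u ≠ 0) (hv : v ≠ 0) :
    GoodTorusAbove (D + {y, y⁻¹} + {u, v}) (c + 2) (z * (u * v)) := by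
  obtain ⟨hc, κ, _, _, e, d, he, hd, h⟩ := h
  refine ⟨by simp; omega, κ ⊕ Fin 4, inferInstance, inferInstance, Sum.inl e,
    Sum.elim d ![y, y⁻¹, u, v], he, ?_, ?_⟩
  · rw [map_univ_sum_elim, hd, add_assoc]
    rfl
  · have := h.add_four hc e (fun τ => by rw [he, one_pow])
      (y := fun τ => y ^ τ) (y' := fun τ => y⁻¹ ^ τ) (u := fun τ => u ^ τ) (v := fun τ => v ^ τ)
      (fun τ => by rw [← mul_pow, mul_inv_cancel₀ hy, one_pow]) (fun τ => pow_ne_zero _ hu)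
      (fun τ => pow_ne_zero _ hv)
    convert this using 1
    · funext τ k
      rcases k with k | k
      · rfl
      · fin_cases k <;> rfl
    · simp
    · funext τ
      rw [mul_pow, mul_pow]

/-- `1`, and `b` pairs of inverse elements. -/
def pairs (Y : ℕ → Ω) (b : ℕ) : Multiset Ω :=
  {1} + (Multiset.range b).map Y + (Multiset.range b).map fun i => (Y i)⁻¹

theorem pairs_succ (Y : ℕ → Ω) (b : ℕ) : pairs Y (b + 1) = pairs Y b + {Y b, (Y b)⁻¹} := by
  simp only [pairs, Multiset.range_succ, Multiset.map_cons, Multiset.insert_eq_cons]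
  simp only [← Multiset.singleton_add]
  abel

theorem goodTorus_pairs {Y : ℕ → Ω} (hY : ∀ i, Y i ≠ 0) (b : ℕ) : GoodTorus (pairs Y b) := by
  induction b with
  | zero => simpa [pairs] using goodTorus_one
  | succ b ih => rw [pairs_succ]; exact ih.add_pair (hY b)

theorem goodTorusAbove_pairs {Y Z : ℕ → Ω} (hY : ∀ i, Y i ≠ 0) (hZ : ∀ i, Z i ≠ 0) (b : ℕ) :
    GoodTorusAbove (pairs Y b + (Multiset.range (2 * b + 1)).map Z) (2 * b)
      (∏ i ∈ Finset.range (2 * b + 1), Z i) := by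
  induction b with
  | zero => simpa [pairs] using goodTorusAbove_two (Z 0)
  | succ b ih =>
    have := ih.add_four (hY b) (hZ (2 * b + 1)) (hZ (2 * b + 2))
    convert this using 1
    · rw [pairs_succ, show 2 * (b + 1) + 1 = 2 * b + 1 + 1 + 1 by ring, Multiset.range_succ (2 * b + 1 + 1),
        Multiset.range_succ (2 * b + 1)]
      simp only [Multiset.map_cons, Multiset.insert_eq_cons]
      simp only [← Multiset.singleton_add]
      abel
    · ring
    · rw [show 2 * (b + 1) + 1 = 2 * b + 1 + 1 + 1 by ring, Finset.prod_range_succ,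
        Finset.prod_range_succ, mul_assoc]

theorem goodTorus_pairs_add {Y Z : ℕ → Ω} (hY : ∀ i, Y i ≠ 0) (hZ : ∀ i, Z i ≠ 0) {b : ℕ}
    (h : ∏ i ∈ Finset.range (2 * b + 1), Z i = 1) :
    GoodTorus (pairs Y b + (Multiset.range (2 * b + 1)).map Z) := by
  have := goodTorusAbove_pairs hY hZ b
  rw [h] at this
  exact this.good

theorem goodTorus_pairs_succ_add {Y Z : ℕ → Ω} (hY : ∀ i, Y i ≠ 0) (hZ : ∀ i, Z i ≠ 0) {b : ℕ}
    (h : ∏ i ∈ Finset.range (2 * b + 1), Z i = 1) :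
    GoodTorus (pairs Y (b + 1) + (Multiset.range (2 * b + 1)).map Z) := by
  have := (goodTorus_pairs_add hY hZ h).add_pair (hY b)
  rw [pairs_succ]
  convert this using 1
  abel

/-- Diagonalization of a matrix with distinct eigenvalues. -/
theorem exists_mul_diagonal {n : ℕ} {S : Matrix (Fin n) (Fin n) Ω} {d : Fin n → Ω}
    (hd : Function.Injective d) (h : ∀ i, S.charpoly.IsRoot (d i)) :
    ∃ V V' : Matrix (Fin n) (Fin n) Ω, V' * V = 1 ∧ ∀ τ : ℕ,
      S ^ τ * V = V * diagonal fun i => d i ^ τ := by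
  have h1 : ∀ i, ∃ v, Module.End.HasEigenvector (Matrix.toLin' S) (d i) v := fun i => by
    refine Module.End.HasEigenvalue.exists_hasEigenvector ?_
    rw [Module.End.hasEigenvalue_iff_isRoot_charpoly, Matrix.charpoly_toLin']
    exact h i
  choose v hv using h1
  have hli := Module.End.eigenvectors_linearIndependent' _ d hd v hv
  have hV : IsUnit (Matrix.of fun i j => v j i) := by
    rw [← Matrix.linearIndependent_cols_iff_isUnit]
    exact hli
  obtain ⟨U, hU⟩ := hV
  have h2 : S * U.1 = U.1 * diagonal d := by
    rw [hU]
    ext i j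
    have := congrFun (hv j).apply_eq_smul i
    simp only [Matrix.toLin'_apply, Pi.smul_apply, smul_eq_mul] at this
    rw [Matrix.mul_diagonal, Matrix.of_apply, mul_comm, ← this]
    rfl
  refine ⟨U.1, (U⁻¹).1, U.inv_mul, fun τ => ?_⟩
  induction τ with
  | zero => simp
  | succ τ ih =>
    rw [pow_succ', Matrix.mul_assoc, ih, ← Matrix.mul_assoc, h2, Matrix.mul_assoc,
      Matrix.diagonal_mul_diagonal]
    simp only [pow_succ']

theorem minor_of (N : ℕ) (f : ℕ → ℕ → Ω) (k : Fin N) :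
    minor k (Matrix.of fun i j : Fin (N + 1) => f i j) = lmin f (k + 1) := rfl

theorem GoodTorus.exists_sum_ne_zero [Infinite Ω] {D : Multiset Ω} (hD : GoodTorus D) (hn : D.Nodup) {N : ℕ}
    {S : Matrix (Fin (N + 1)) (Fin (N + 1)) Ω} (hS : S.charpoly.roots = D) (hc : D.card = N + 1)
    (a : Fin N → ℕ) {l : ℕ} (hl : (l : Ω) ≠ 0) :
    ∃ A B : Matrix (Fin (N + 1)) (Fin (N + 1)) Ω,
      ∑ i ∈ Finset.range l, minorProd a (A * S ^ i * B) ≠ 0 := by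
  by_contra! hz
  obtain ⟨κ, _, _, e, d, he, hd, A, B, v, K, hK, h⟩ := hD
  have hinj : Function.Injective d := by
    rw [← hd] at hn
    intro i j hij
    exact Multiset.inj_on_of_nodup_map hn i (Finset.mem_univ _) j (Finset.mem_univ _) hij
  have hcard : Fintype.card κ = N + 1 := by
    rw [← hc, ← hd, Multiset.card_map]
    rfl
  let σ : Fin (N + 1) ≃ κ := (Fintype.equivFinOfCardEq hcard).symm
  obtain ⟨V, V', hV, hSV⟩ := exists_mul_diagonal (S := S) (d := fun i => d (σ i))
    (hinj.comp σ.injective) (fun i => by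
      refine Polynomial.isRoot_of_mem_roots ?_
      rw [hS, ← hd]
      exact Multiset.mem_map_of_mem _ (Finset.mem_univ _))
  have key : ∑ τ ∈ Finset.range l, ∏ k : Fin N, lmin (form A B (fun k => d k ^ τ)) (k + 1) ^ a k =
      0 := by
    refine Polynomial.funext fun t => ?_
    have := hz (Matrix.of (fun (i j : Fin (N + 1)) => (A i (σ j)).eval t) * V')
      (V * Matrix.of (fun (i j : Fin (N + 1)) => (B j (σ i)).eval t))
    rw [Polynomial.eval_zero, ← this, Polynomial.eval_finsetSum]
    refine Finset.sum_congr rfl fun τ _ => ?_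
    rw [Polynomial.eval_prod, minorProd]
    refine Finset.prod_congr rfl fun k _ => ?_
    rw [Polynomial.eval_pow]
    congr 1
    rw [← Polynomial.coe_evalRingHom, map_lmin, ← minor_of]
    congr 1
    rw [Matrix.mul_assoc _ (S ^ τ), ← Matrix.mul_assoc (S ^ τ), hSV, Matrix.mul_assoc _ V',
      Matrix.mul_assoc V, ← Matrix.mul_assoc V', hV, Matrix.one_mul]
    ext i j
    rw [← Matrix.mul_assoc, Matrix.mul_apply]
    simp only [Matrix.of_apply, Matrix.mul_diagonal, form, map_sum, map_mul,
      Polynomial.coe_evalRingHom, Polynomial.eval_C]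
    rw [← σ.sum_comp]
  have hL : ∀ τ : ℕ, (∏ k : Fin N, lmin (form A B (fun k => d k ^ τ)) (k + 1) ^ a k).coeff
      (∑ k : Fin N, a k * v (k + 1)) = ∏ k : Fin N, K (k + 1) ^ a k := fun τ =>
    (Lead.prod Finset.univ fun (k : Fin N) _ => (h τ (k + 1) (by have := k.2; omega)).pow (a k)).coeff
  have := congrArg (fun P : Polynomial Ω => P.coeff (∑ k : Fin N, a k * v (k + 1))) key
  simp only [Polynomial.finsetSum_coeff, hL, Finset.sum_const, Finset.card_range, nsmul_eq_mul,
    Polynomial.coeff_zero] at this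
  exact mul_ne_zero hl (Finset.prod_ne_zero_iff.2 fun k _ => pow_ne_zero _ (hK _)) this

end Torus

section NoVanish

variable {N : ℕ} {F Ω : Type*} [Field F] [Fintype F] [Field Ω] [Algebra F Ω]

theorem GoodTorus.exists_sum_apply_ne_zero {p : ℕ} [Fact p.Prime] [CharP F p] [CharP Ω p]
    [Infinite Ω] (hN : 0 < N) {K W : Type*} [Field K] [CharP K p] [AddCommGroup W] [Module K W]
    [Nontrivial W] (ρ : Matrix.SpecialLinearGroup (Fin (N + 1)) F →* (W ≃ₗ[K] W))
    {D : Multiset Ω} (hD : GoodTorus D) (hn : D.Nodup)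
    {s : Matrix.SpecialLinearGroup (Fin (N + 1)) F}
    (hS : (baseChange (N + 1) F Ω s).1.charpoly.roots = D) (hc : D.card = N + 1)
    {l : ℕ} (hl : ¬ p ∣ l) : ∃ w, ∑ i ∈ Finset.range l, ρ (s ^ i) w ≠ 0 := by
  by_contra! h
  obtain ⟨a, -, ha, -⟩ := exists_minorProd_sum_eq_zero (Ω := Ω) hN ρ
  obtain ⟨A, B, hAB⟩ := hD.exists_sum_ne_zero hn hS hc a (l := l)
    (fun h => hl ((CharP.cast_eq_zero_iff Ω p l).1 h))
  exact hAB (ha s l h A B)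

theorem sum_pow_eq_ite {u : Ω} {k : ℕ} (hu : orderOf u = k) (m : ℕ) :
    ∑ τ ∈ Finset.range k, (u ^ τ) ^ m = if k ∣ m then (k : Ω) else 0 := by
  have h1 : ∀ τ : ℕ, (u ^ τ) ^ m = (u ^ m) ^ τ := fun τ => by rw [← pow_mul, mul_comm, pow_mul]
  simp only [h1]
  split_ifs with h
  · rw [← hu] at h
    simp [orderOf_dvd_iff_pow_eq_one.1 h]
  · have h2 : u ^ m ≠ 1 := fun h2 => h (hu ▸ orderOf_dvd_of_pow_eq_one h2)
    rw [geom_sum_eq h2, ← pow_mul, mul_comm, pow_mul, ← hu, pow_orderOf_eq_one, one_pow, sub_self,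
      zero_div]

theorem sum_add_one_pow_mul {u : Ω} {k : ℕ} (hu : orderOf u = k) {a c : ℕ} (hca : c ≤ a)
    (ha : a < k) :
    ∑ τ ∈ Finset.range k, (u ^ τ + 1) ^ a * ((u ^ τ)⁻¹) ^ c = k * (a.choose c : Ω) := by
  have hu1 : u ^ k = 1 := hu ▸ pow_orderOf_eq_one u
  have hu0 : u ≠ 0 := by rintro rfl; rw [zero_pow (by omega)] at hu1; exact zero_ne_one hu1
  have h1 : ∀ τ : ℕ, ((u ^ τ)⁻¹) ^ c = (u ^ τ) ^ (k - c) := fun τ => by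
    rw [inv_pow, eq_comm]
    refine eq_inv_of_mul_eq_one_left ?_
    rw [← pow_add,
      Nat.sub_add_cancel (by omega), ← pow_mul, mul_comm, pow_mul, hu1, one_pow]
  calc _ = ∑ τ ∈ Finset.range k, ∑ j ∈ Finset.range (a + 1),
        (a.choose j : Ω) * (u ^ τ) ^ (j + (k - c)) := by
        refine Finset.sum_congr rfl fun τ _ => ?_
        rw [h1, add_pow, Finset.sum_mul]
        refine Finset.sum_congr rfl fun j _ => ?_
        rw [one_pow, pow_add]
        ring
    _ = ∑ j ∈ Finset.range (a + 1), (a.choose j : Ω) * if k ∣ j + (k - c) then (k : Ω) else 0 := by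
        rw [Finset.sum_comm]
        refine Finset.sum_congr rfl fun j _ => ?_
        rw [← Finset.mul_sum, sum_pow_eq_ite hu]
    _ = _ := by
        rw [Finset.sum_eq_single c]
        · rw [if_pos (by rw [Nat.add_sub_of_le (by omega)]), mul_comm]
        · intro j hj hjc
          rw [if_neg, mul_zero]
          rintro ⟨r, hr⟩
          have := Finset.mem_range.1 hj
          have : r = 1 := by
            have h2 : r < 2 := by
              by_contra h; have := Nat.mul_le_mul_left k (not_lt.1 h); omega
            have h0 : r ≠ 0 := by rintro rfl; omega
            omega
          subst this
          omega
        · simp; omega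

theorem sum_add_inv_pow_mul {x : Ω} (hx : x ≠ 0) {k : ℕ} (hu : orderOf (x ^ 2) = k) {a b : ℕ} (hab : b ≤ a)
    (h2 : Even (a + b)) (ha : a < k) :
    ∑ τ ∈ Finset.range k, (x ^ τ + (x ^ τ)⁻¹) ^ a * (x ^ τ) ^ b =
      k * (a.choose ((a - b) / 2) : Ω) := by
  rw [← sum_add_one_pow_mul hu (by omega) ha]
  refine Finset.sum_congr rfl fun τ _ => ?_
  obtain ⟨c, hc⟩ : ∃ c, a = b + 2 * c := by
    obtain ⟨d, hd⟩ := h2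
    exact ⟨d - b, by omega⟩
  have hx' : x ^ τ ≠ 0 := pow_ne_zero _ hx
  rw [show (a - b) / 2 = c by omega, ← pow_mul x 2 τ, mul_comm 2 τ, pow_mul x τ 2]
  generalize x ^ τ = X at hx'
  have h3 : X ^ 2 + 1 = (X + X⁻¹) * X := by field_simp
  rw [h3, mul_pow, mul_assoc]
  congr 1
  rw [hc, pow_add, mul_assoc, pow_mul, inv_pow, mul_inv_cancel₀ (pow_ne_zero _ (pow_ne_zero _ hx')), mul_one]

theorem minorProd_three (a : Fin 3 → ℕ) (M : Matrix (Fin 4) (Fin 4) Ω) :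
    minorProd a M = M 0 0 ^ a 0 * (M 0 0 * M 1 1 - M 0 1 * M 1 0) ^ a 1 *
      (M 0 0 * M 1 1 * M 2 2 - M 0 0 * M 1 2 * M 2 1 - M 0 1 * M 1 0 * M 2 2
        + M 0 1 * M 1 2 * M 2 0 + M 0 2 * M 1 0 * M 2 1 - M 0 2 * M 1 1 * M 2 0) ^ a 2 := by
  rw [minorProd, Fin.prod_univ_three]
  congr
  · exact Matrix.det_fin_one (lead 0 M)
  · exact Matrix.det_fin_two (lead 1 M)
  · exact Matrix.det_fin_three (lead 2 M)

theorem exists_sum_apply_ne_zero_of_four {p : ℕ} [Fact p.Prime] [CharP F p] [CharP Ω p]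
    [Infinite Ω] (hp : p ≠ 2) (hF : Fintype.card F = p) {K W : Type*} [Field K] [CharP K p]
    [AddCommGroup W] [Module K W]
    [Nontrivial W] (ρ : Matrix.SpecialLinearGroup (Fin 4) F →* (W ≃ₗ[K] W))
    {z : Matrix.SpecialLinearGroup (Fin 4) F} (hz : z.1 = -1) (hρ : ρ z = 1)
    {x y : Ω} (hx : x ≠ 0) (hy : y ≠ 0) (hn : ({x, x⁻¹, y, y⁻¹} : Multiset Ω).Nodup)
    {s : Matrix.SpecialLinearGroup (Fin 4) F}
    (hS : (baseChange 4 F Ω s).1.charpoly.roots = {x, x⁻¹, y, y⁻¹})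
    {k : ℕ} (hk : orderOf (x ^ 2) = k) (hpk : ¬ p ∣ k) (hk' : p ≤ k) :
    ∃ w, ∑ i ∈ Finset.range k, ρ (s ^ i) w ≠ 0 := by
  by_contra! h
  have hpp : p.Prime := Fact.out
  obtain ⟨a, hap, ha, ha'⟩ := exists_minorProd_sum_eq_zero (N := 3) (Ω := Ω) (by norm_num) ρ
  have hk0 : (k : Ω) ≠ 0 := fun h => hpk ((CharP.cast_eq_zero_iff Ω p k).1 h)
  have hch : ∀ a c : ℕ, c ≤ a → a < p → (a.choose c : Ω) ≠ 0 := by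
    intro a c hc hap h
    have h1 := (CharP.cast_eq_zero_iff Ω p _).1 h
    have h2 := (h1.mul_right c.factorial).mul_right (a - c).factorial
    rw [Nat.choose_mul_factorial_mul_factorial hc, hpp.dvd_factorial] at h2
    omega
  have hap' : ∀ i, a i < p := fun i => by have := hap i; have := hpp.pos; omega
  have heven : Even (a 0 + a 2) := by
    have h1 := ha' z hρ
    have h2 : (baseChange 4 F Ω z).1 = -1 := by
      ext i j
      rw [baseChange_apply, hz]
      simp [Matrix.one_apply]
    rw [h2, minorProd_three] at h1
    simp at h1
    rw [← pow_add] at h1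
    by_contra hodd
    rw [(Nat.not_even_iff_odd.1 hodd).neg_one_pow] at h1
    have : ((2 : ℕ) : Ω) = 0 := by push_cast; linear_combination -h1
    rw [CharP.cast_eq_zero_iff Ω p, Nat.prime_dvd_prime_iff_eq hpp Nat.prime_two] at this
    exact hp this
  let d : Fin 4 → Ω := ![x, x⁻¹, y, y⁻¹]
  have hd : Finset.univ.val.map d = {x, x⁻¹, y, y⁻¹} := rfl
  have hinj : Function.Injective d := by
    rw [← hd] at hn
    intro i j hij
    exact Multiset.inj_on_of_nodup_map hn i (Finset.mem_univ i) j (Finset.mem_univ j) hij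
  obtain ⟨V, V', hV, hSV⟩ := exists_mul_diagonal (S := (baseChange 4 F Ω s).1) (d := d) hinj
    (fun i => by
      refine Polynomial.isRoot_of_mem_roots ?_
      rw [hS, ← hd]
      exact Multiset.mem_map_of_mem _ (Finset.mem_univ i))
  have key : ∀ α β γ δ : Ω, ∑ τ ∈ Finset.range k, (α * x ^ τ + β * (x ^ τ)⁻¹) ^ a 0 * (-1) ^ a 1 *
      (-(γ * x ^ τ + δ * (x ^ τ)⁻¹)) ^ a 2 = 0 := by
    intro α β γ δ
    rw [← ha s k h (!![α, β, 1, 0; 0, 0, 0, 1; γ, δ, 0, 0; 0, 0, 0, 0] * V')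
      (V * !![1, 0, 1, 0; 1, 0, 1, 0; 0, 1, 0, 0; 1, 0, 0, 0])]
    refine Finset.sum_congr rfl fun τ _ => ?_
    rw [Matrix.mul_assoc _ (_ ^ τ), ← Matrix.mul_assoc (_ ^ τ), hSV, Matrix.mul_assoc _ V',
      Matrix.mul_assoc V, ← Matrix.mul_assoc V', hV, Matrix.one_mul, ← Matrix.mul_assoc,
      minorProd_three]
    have hyy : y ^ τ * (y ^ τ)⁻¹ = 1 := mul_inv_cancel₀ (pow_ne_zero _ hy)
    simp [Matrix.mul_apply, Fin.sum_univ_four, d, Matrix.vecMul_diagonal]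
    rw [hyy, one_mul, neg_add_rev]
  rcases le_total (a 2) (a 0) with h02 | h02
  · have := key 1 1 1 0
    simp only [one_mul, zero_mul, add_zero] at this
    have h3 := sum_add_inv_pow_mul hx hk h02 heven (by have := hap' 0; omega)
    refine mul_ne_zero hk0 (hch (a 0) ((a 0 - a 2) / 2) (by omega) (hap' 0)) ?_
    rw [← h3, ← mul_right_inj' (a := (-1 : Ω) ^ (a 1 + a 2)) (by simp), mul_zero, ← this,
      Finset.mul_sum]
    refine Finset.sum_congr rfl fun τ _ => ?_
    rw [neg_pow (x ^ τ), pow_add]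
    ring
  · have := key 1 0 1 1
    simp only [one_mul, zero_mul, add_zero] at this
    have h3 := sum_add_inv_pow_mul hx hk h02 (add_comm (a 0) _ ▸ heven) (by have := hap' 2; omega)
    refine mul_ne_zero hk0 (hch (a 2) ((a 2 - a 0) / 2) (by omega) (hap' 2)) ?_
    rw [← h3, ← mul_right_inj' (a := (-1 : Ω) ^ (a 1 + a 2)) (by simp), mul_zero, ← this,
      Finset.mul_sum]
    refine Finset.sum_congr rfl fun τ _ => ?_
    rw [neg_pow (x ^ τ + _), pow_add]
    ring

end NoVanish

section Realization

variable {F Ω : Type*} [Field F] [Fintype F] [Field Ω] [Algebra F Ω]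

theorem mem_range_algebraMap_of_pow_card {x : Ω} (h : x ^ Fintype.card F = x) :
    x ∈ Set.range (algebraMap F Ω) := by
  classical
  have h0 : (Polynomial.X ^ Fintype.card F - Polynomial.X : Polynomial F) ≠ 0 :=
    FiniteField.X_pow_card_sub_X_ne_zero F Fintype.one_lt_card
  have hm : (Polynomial.X ^ Fintype.card F - Polynomial.X : Polynomial Ω).roots =
      Finset.univ.val.map (algebraMap F Ω) := by
    have := Polynomial.roots_map_of_injective_of_card_eq_natDegree (algebraMap F Ω).injective
      (p := (Polynomial.X ^ Fintype.card F - Polynomial.X : Polynomial F)) (by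
        rw [FiniteField.roots_X_pow_card_sub_X,
          FiniteField.X_pow_card_sub_X_natDegree_eq F Fintype.one_lt_card]
        rfl)
    rw [FiniteField.roots_X_pow_card_sub_X] at this
    simpa using this.symm
  have : x ∈ (Polynomial.X ^ Fintype.card F - Polynomial.X : Polynomial Ω).roots := by
    rw [Polynomial.mem_roots (FiniteField.X_pow_card_sub_X_ne_zero Ω Fintype.one_lt_card)]
    simp [h]
  rw [hm, Multiset.mem_map] at this
  obtain ⟨y, -, hy⟩ := this
  exact ⟨y, hy⟩

theorem exists_matrix_charpoly {P : Polynomial F} (hP : P.Monic) {n : ℕ} (hn : P.natDegree = n) :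
    ∃ M : Matrix (Fin n) (Fin n) F, M.charpoly = P := by
  subst hn
  have h0 := hP.ne_zero
  let pb := AdjoinRoot.powerBasis h0
  have hdim : pb.dim = P.natDegree := rfl
  refine ⟨Matrix.reindex (finCongr hdim) (finCongr hdim) (Algebra.leftMulMatrix pb.basis pb.gen), ?_⟩
  rw [Matrix.charpoly_reindex, charpoly_leftMulMatrix]
  exact AdjoinRoot.minpoly_powerBasis_gen_of_monic hP

/-- A multiset of size `n` with product one, stable under the Frobenius, is the multiset of
eigenvalues of an element of the special linear group. -/
theorem exists_charpoly_roots_eq {D : Multiset Ω} {n : ℕ} (hc : D.card = n)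
    (hD : D.map (· ^ Fintype.card F) = D) (h1 : D.prod = 1) :
    ∃ s : Matrix.SpecialLinearGroup (Fin n) F, (baseChange n F Ω s).1.charpoly.roots = D := by
  let Q : Polynomial Ω := (D.map fun a => Polynomial.X - Polynomial.C a).prod
  have hQm : Q.Monic := Polynomial.monic_multiset_prod_of_monic _ _ fun a _ =>
    Polynomial.monic_X_sub_C a
  have hQφ : Q.map (FiniteField.frobeniusAlgHom F Ω : Ω →+* Ω) = Q := by
    rw [Polynomial.map_multiset_prod, Multiset.map_map]
    have hQ : Q = (D.map fun a => Polynomial.X - Polynomial.C a).prod := rfl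
    conv_rhs => rw [hQ, ← hD, Multiset.map_map]
    congr 1
    refine Multiset.map_congr rfl fun x _ => ?_
    simp
  have hl : Q ∈ Polynomial.lifts (algebraMap F Ω) := by
    rw [Polynomial.lifts_iff_coeff_lifts]
    intro k
    refine mem_range_algebraMap_of_pow_card ?_
    conv_rhs => rw [← hQφ]
    rw [Polynomial.coeff_map]
    simp
  obtain ⟨P, hPQ, hdeg, hPm⟩ := Polynomial.lifts_and_degree_eq_and_monic hl hQm
  have hQn : Q.natDegree = n := by
    rw [Polynomial.natDegree_multiset_prod_X_sub_C_eq_card, hc]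
  obtain ⟨M, hM⟩ := exists_matrix_charpoly hPm
    ((Polynomial.natDegree_eq_of_degree_eq hdeg).trans hQn)
  have hMQ : (M.map (algebraMap F Ω)).charpoly = Q := by
    rw [Matrix.charpoly_map, hM, hPQ]
  have hdet : M.det = 1 := by
    refine (algebraMap F Ω).injective ?_
    rw [RingHom.map_det, map_one, Matrix.det_eq_sign_charpoly_coeff]
    erw [hMQ]
    rw [Polynomial.coeff_zero_multiset_prod, Multiset.map_map]
    simp only [Function.comp_def, Polynomial.coeff_sub, Polynomial.coeff_X_zero,
      Polynomial.coeff_C_zero, zero_sub, Multiset.prod_map_neg]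
    rw [h1, hc, mul_one, Fintype.card_fin, ← pow_add, ← two_mul, pow_mul]
    simp
  refine ⟨⟨M, hdet⟩, ?_⟩
  have : (baseChange n F Ω ⟨M, hdet⟩).1 = M.map (algebraMap F Ω) := rfl
  rw [this, hMQ, Polynomial.roots_multiset_prod_X_sub_C]

/-- The powers of a diagonalizable element which are scalar. -/
theorem baseChange_pow_eq_iff {n : ℕ} {s : Matrix.SpecialLinearGroup (Fin n) F} {D : Multiset Ω}
    (hn : D.Nodup) (hs : (baseChange n F Ω s).1.charpoly.roots = D) (hc : D.card = n) (τ : ℕ)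
    (c : F) : (s ^ τ).1 = Matrix.scalar (Fin n) c ↔ ∀ x ∈ D, x ^ τ = algebraMap F Ω c := by
  obtain ⟨d, hd⟩ : ∃ d : Fin n → Ω, Finset.univ.val.map d = D := by
    have hl : D.toList.length = n := by rw [Multiset.length_toList, hc]
    refine ⟨fun i => D.toList.get (i.cast hl.symm), ?_⟩
    subst hl
    exact (Fin.univ_val_map _).trans
      ((congrArg _ (List.ofFn_get D.toList)).trans (Multiset.coe_toList D))
  have hinj : Function.Injective d := by
    rw [← hd] at hn
    intro i j hij
    exact Multiset.inj_on_of_nodup_map hn i (Finset.mem_univ i) j (Finset.mem_univ j) hij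
  obtain ⟨V, V', hV, hSV⟩ := exists_mul_diagonal (S := (baseChange n F Ω s).1) (d := d) hinj
    (fun i => by
      refine Polynomial.isRoot_of_mem_roots ?_
      rw [hs, ← hd]
      exact Multiset.mem_map_of_mem _ (Finset.mem_univ i))
  have hV' := mul_eq_one_comm.1 hV
  have h1 : (s ^ τ).1 = Matrix.scalar (Fin n) c ↔
      (baseChange n F Ω s).1 ^ τ = Matrix.scalar (Fin n) (algebraMap F Ω c) := by
    rw [← Matrix.SpecialLinearGroup.coe_pow, ← map_pow]
    constructor
    · intro h
      ext i j
      rw [baseChange_apply, h]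
      simp only [Matrix.scalar_apply, Matrix.diagonal_apply]
      split_ifs <;> simp
    · intro h
      ext i j
      refine (algebraMap F Ω).injective ?_
      rw [← baseChange_apply, h]
      simp only [Matrix.scalar_apply, Matrix.diagonal_apply]
      split_ifs <;> simp
  have h2 : (baseChange n F Ω s).1 ^ τ = Matrix.scalar (Fin n) (algebraMap F Ω c) ↔
      (diagonal fun i => d i ^ τ) = Matrix.scalar (Fin n) (algebraMap F Ω c) := by
    constructor
    · intro h
      have := hSV τ
      rw [h, (Matrix.scalar_commute _ (fun _ => Commute.all _ _) V).eq] at this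
      calc _ = V' * V * diagonal (fun i => d i ^ τ) := by rw [hV, one_mul]
        _ = _ := by rw [Matrix.mul_assoc, ← this, ← Matrix.mul_assoc, hV, one_mul]
    · intro h
      have := hSV τ
      rw [h, ← (Matrix.scalar_commute _ (fun _ => Commute.all _ _) V).eq] at this
      calc _ = (baseChange n F Ω s).1 ^ τ * (V * V') := by rw [hV', mul_one]
        _ = _ := by rw [← Matrix.mul_assoc, this, Matrix.mul_assoc, hV', mul_one]
  rw [h1, h2, Matrix.scalar_apply, Matrix.diagonal_eq_diagonal_iff, ← hd]
  simp

end Realization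

theorem mk_pow_eq_one_iff {n : ℕ} {F : Type*} [Field F] (s : Matrix.SpecialLinearGroup (Fin n) F)
    (τ : ℕ) : (QuotientGroup.mk s : Matrix.ProjectiveSpecialLinearGroup (Fin n) F) ^ τ = 1 ↔
      ∃ c, (s ^ τ).1 = Matrix.scalar (Fin n) c := by
  rw [← QuotientGroup.mk_pow, QuotientGroup.eq_one_iff, Matrix.SpecialLinearGroup.mem_center_iff]
  constructor
  · rintro ⟨c, -, hc⟩
    exact ⟨c, hc.symm⟩
  · rintro ⟨c, hc⟩
    refine ⟨c, ?_, hc.symm⟩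
    have := (s ^ τ).2
    rw [hc, Matrix.scalar_apply, Matrix.det_diagonal] at this
    simpa using this

section Realization

variable {F Ω : Type*} [Field F] [Fintype F] [Field Ω] [Algebra F Ω]

theorem mk_pow_eq_one_iff_of_one_mem {n : ℕ} {s : Matrix.SpecialLinearGroup (Fin n) F}
    {D : Multiset Ω} (hn : D.Nodup) (hs : (baseChange n F Ω s).1.charpoly.roots = D)
    (hc : D.card = n) (h1 : 1 ∈ D) (τ : ℕ) :
    (QuotientGroup.mk s : Matrix.ProjectiveSpecialLinearGroup (Fin n) F) ^ τ = 1 ↔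
      ∀ x ∈ D, x ^ τ = 1 := by
  rw [mk_pow_eq_one_iff]
  simp only [baseChange_pow_eq_iff hn hs hc]
  constructor
  · rintro ⟨c, h⟩ x hx
    rw [h x hx, ← h 1 h1, one_pow]
  · intro h
    exact ⟨1, by simpa using h⟩

theorem map_range_succ_add {α : Type*} (f : ℕ → α) (b : ℕ) :
    (Multiset.range b).map (fun i => f (i + 1)) + {f 0} = (Multiset.range b).map f + {f b} := by
  induction b with
  | zero => simp
  | succ b ih =>
    simp only [Multiset.range_succ, Multiset.map_cons]
    simp only [← Multiset.singleton_add]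
    rw [add_assoc, ih]
    abel

theorem map_pow_pairs {q b : ℕ} {θ : Ω} (hθ : θ ^ q ^ b = θ⁻¹) :
    (pairs (fun i => θ ^ q ^ i) b).map (· ^ q) = pairs (fun i => θ ^ q ^ i) b := by
  have h1 : ∀ i, (θ ^ q ^ i) ^ q = θ ^ q ^ (i + 1) := fun i => by rw [← pow_mul, pow_succ]
  have h2 : ∀ i, ((θ ^ q ^ i)⁻¹) ^ q = (θ ^ q ^ (i + 1))⁻¹ := fun i => by rw [inv_pow, h1]
  have h3 := map_range_succ_add (fun i => θ ^ q ^ i) b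
  have h4 := map_range_succ_add (fun i => (θ ^ q ^ i)⁻¹) b
  simp only [hθ, inv_inv, pow_zero, pow_one] at h3 h4
  simp only [pairs, Multiset.map_add, Multiset.map_map, Multiset.map_singleton, one_pow,
    Function.comp_def, h1, h2]
  refine add_right_cancel (b := ({θ} + {θ⁻¹} : Multiset Ω)) ?_
  calc _ = {1} + (Multiset.map (fun i => θ ^ q ^ (i + 1)) (Multiset.range b) + {θ}) +
        (Multiset.map (fun i => (θ ^ q ^ (i + 1))⁻¹) (Multiset.range b) + {θ⁻¹}) := by abel
    _ = _ := by rw [h3, h4]; abel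

theorem map_pow_conj {q c : ℕ} {η : Ω} (hη : η ^ q ^ c = η) :
    ((Multiset.range c).map fun i => η ^ q ^ i).map (· ^ q) =
      (Multiset.range c).map fun i => η ^ q ^ i := by
  have h3 := map_range_succ_add (fun i => η ^ q ^ i) c
  simp only [hη, pow_zero, pow_one] at h3
  rw [Multiset.map_map]
  convert add_right_cancel h3 using 2
  rw [Function.comp_apply, ← pow_mul, pow_succ]

theorem prod_pairs {Y : ℕ → Ω} (hY : ∀ i, Y i ≠ 0) (b : ℕ) : (pairs Y b).prod = 1 := by
  induction b with
  | zero => simp [pairs]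
  | succ b ih =>
    rw [pairs_succ, Multiset.prod_add, ih]
    simp [hY]

theorem card_pairs (Y : ℕ → Ω) (b : ℕ) : (pairs Y b).card = 2 * b + 1 := by
  simp [pairs]; omega

/-- The multiplicative order of `q` modulo `R` is a multiple of `e`. -/
def PrimMod (q R e : ℕ) : Prop := ∀ k, R ∣ q ^ k - 1 → e ∣ k

theorem PrimMod.injOn {q R e : ℕ} (h : PrimMod q R e) (hqR : R.Coprime q) (hq : 0 < q) {θ : Ω}
    (hθ0 : θ ≠ 0) (hθ : orderOf θ = R) {i j : ℕ} (hi : i < e) (hj : j < e) (hij : θ ^ q ^ i = θ ^ q ^ j) :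
    i = j := by
  wlog hle : i ≤ j generalizing i j
  · exact (this hj hi hij.symm (by omega)).symm
  rw [← Nat.add_sub_of_le hle, pow_add, pow_mul] at hij
  have h1 : (θ ^ q ^ i) ^ (q ^ (j - i) - 1) = 1 := by
    refine mul_right_cancel₀ (pow_ne_zero (q ^ i) hθ0) ?_
    rw [← pow_succ, Nat.sub_add_cancel (Nat.pow_pos hq), one_mul]
    exact hij.symm
  have h2 : orderOf (θ ^ q ^ i) = R := by
    rw [Nat.Coprime.orderOf_pow, hθ]
    rw [hθ]
    exact hqR.pow_right i
  have h3 := h _ (h2 ▸ orderOf_dvd_of_pow_eq_one h1)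
  have := Nat.eq_zero_of_dvd_of_lt h3 (by omega)
  omega

theorem PrimMod.nodup_pairs {q R b : ℕ} (h : PrimMod q R (2 * b)) (hqR : R.Coprime q) (hq : 0 < q)
    (hb : 0 < b) {θ : Ω} (hθ0 : θ ≠ 0) (hθ : orderOf θ = R) (hθb : θ ^ q ^ b = θ⁻¹) :
    (pairs (fun i => θ ^ q ^ i) b).Nodup := by
  have hR : R ≠ 1 := by
    rintro rfl
    have := h 1 (one_dvd _)
    have := Nat.le_of_dvd one_pos this
    omega
  have h1 : ∀ i, θ ^ q ^ i ≠ 1 := fun i h1 => by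
    have := orderOf_dvd_of_pow_eq_one h1
    rw [hθ] at this
    exact hR ((hqR.pow_right i).eq_one_of_dvd this)
  have h2 : ∀ i, (θ ^ q ^ i)⁻¹ = θ ^ q ^ (b + i) := fun i => by
    rw [pow_add, pow_mul, hθb, inv_pow]
  have hinj : ∀ {i j}, i < 2 * b → j < 2 * b → θ ^ q ^ i = θ ^ q ^ j → i = j :=
    fun hi hj hij => h.injOn hqR hq hθ0 hθ hi hj hij
  simp only [pairs, h2]
  refine Multiset.nodup_add.2 ⟨Multiset.nodup_add.2 ⟨Multiset.nodup_singleton _, ?_, ?_⟩, ?_, ?_⟩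
  · refine Multiset.Nodup.map_on (fun i hi j hj hij => ?_) (Multiset.nodup_range b)
    rw [Multiset.mem_range] at hi hj
    exact hinj (by omega) (by omega) hij
  · rw [Multiset.disjoint_left]
    intro x hx
    rw [Multiset.mem_singleton] at hx
    subst hx
    simp [h1]
  · refine Multiset.Nodup.map_on (fun i hi j hj hij => ?_) (Multiset.nodup_range b)
    rw [Multiset.mem_range] at hi hj
    have := hinj (by omega) (by omega) hij
    omega
  · rw [Multiset.disjoint_left]
    intro x hx hx'
    obtain ⟨j, hj, rfl⟩ := Multiset.mem_map.1 hx'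
    rw [Multiset.mem_range] at hj
    rcases Multiset.mem_add.1 hx with hx | hx
    · exact h1 _ (Multiset.mem_singleton.1 hx)
    · obtain ⟨i, hi, hij⟩ := Multiset.mem_map.1 hx
      rw [Multiset.mem_range] at hi
      have := hinj (by omega) (by omega) hij
      omega

theorem exists_orderOf_eq [IsAlgClosed Ω] {p : ℕ} [Fact p.Prime] [CharP Ω p] {R : ℕ}
    (hR : ¬ p ∣ R) : ∃ θ : Ω, orderOf θ = R := by
  have : NeZero (R : Ω) := ⟨fun h => hR ((CharP.cast_eq_zero_iff Ω p R).1 h)⟩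
  obtain ⟨θ, hθ⟩ := HasEnoughRootsOfUnity.exists_primitiveRoot Ω R
  exact ⟨θ, hθ.eq_orderOf.symm⟩

theorem coprime_of_dvd_pow_add_one {q R b : ℕ} (hR : R ∣ q ^ b + 1) (hb : 0 < b) : R.Coprime q := by
  refine Nat.Coprime.coprime_dvd_left hR ?_
  obtain ⟨b, rfl⟩ := Nat.exists_eq_add_of_lt hb
  rw [pow_succ]
  simp

theorem coprime_of_dvd_geom {q r c : ℕ} (hr : r ∣ ∑ i ∈ Finset.range (c + 1), q ^ i) :
    r.Coprime q := by
  refine Nat.Coprime.coprime_dvd_left hr ?_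
  rw [Finset.sum_range_succ']
  simp only [pow_succ, pow_zero, ← Finset.sum_mul]
  simp

theorem not_dvd_of_coprime {p q R : ℕ} (hp : p.Prime) (hpq : p ∣ q) (h : R.Coprime q) : ¬ p ∣ R :=
  fun h' => hp.one_lt.ne' (Nat.eq_one_of_dvd_coprimes h h' hpq)

theorem pow_eq_inv_of_orderOf_dvd {θ : Ω} {k : ℕ} (h : orderOf θ ∣ k + 1) : θ ^ k = θ⁻¹ :=
  eq_inv_of_mul_eq_one_left (by rw [← pow_succ]; exact orderOf_dvd_iff_pow_eq_one.1 h)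

theorem forall_mem_pairs_pow {q b : ℕ} {θ : Ω} {τ : ℕ} (h : θ ^ τ = 1) :
    ∀ x ∈ pairs (fun i => θ ^ q ^ i) b, x ^ τ = 1 := by
  have h1 : ∀ i, (θ ^ q ^ i) ^ τ = 1 := fun i => by
    rw [← pow_mul, mul_comm, pow_mul, h, one_pow]
  intro x hx
  simp only [pairs, Multiset.mem_add, Multiset.mem_singleton, Multiset.mem_map] at hx
  rcases hx with (rfl | ⟨i, -, rfl⟩) | ⟨i, -, rfl⟩
  · exact one_pow τ
  · exact h1 i
  · rw [inv_pow, h1, inv_one]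

theorem mem_pairs (Y : ℕ → Ω) {b : ℕ} (hb : 0 < b) : Y 0 ∈ pairs Y b := by
  simp only [pairs, Multiset.mem_add, Multiset.mem_map, Multiset.mem_range]
  exact Or.inl (Or.inr ⟨0, hb, rfl⟩)

theorem one_mem_pairs (Y : ℕ → Ω) (b : ℕ) : 1 ∈ pairs Y b := by simp [pairs]

/-- An element of a maximal torus of odd rank. -/
theorem exists_torus_odd [IsAlgClosed Ω] {p : ℕ} [Fact p.Prime] [CharP Ω p] {q R b : ℕ}
    (hF : Fintype.card F = q) (h : PrimMod q R (2 * b)) (hR : R ∣ q ^ b + 1) (hb : 0 < b)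
    (hpq : p ∣ q) :
    ∃ (s : Matrix.SpecialLinearGroup (Fin (2 * b + 1)) F) (D : Multiset Ω), GoodTorus D ∧ D.Nodup ∧
      (baseChange (2 * b + 1) F Ω s).1.charpoly.roots = D ∧ D.card = 2 * b + 1 ∧
      orderOf (QuotientGroup.mk s : Matrix.ProjectiveSpecialLinearGroup (Fin (2 * b + 1)) F) = R := by
  subst hF
  have hqR := coprime_of_dvd_pow_add_one hR hb
  obtain ⟨θ, hθ⟩ := exists_orderOf_eq (Ω := Ω) (not_dvd_of_coprime Fact.out hpq hqR)
  have hθb : θ ^ Fintype.card F ^ b = θ⁻¹ := pow_eq_inv_of_orderOf_dvd (hθ ▸ hR)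
  have hθ0 : θ ≠ 0 := by
    rintro rfl
    rw [orderOf_zero] at hθ
    rw [← hθ, Nat.zero_dvd] at hR
    omega
  have hn := h.nodup_pairs hqR Fintype.card_pos hb hθ0 hθ hθb
  have hY0 : ∀ i, θ ^ Fintype.card F ^ i ≠ 0 := fun i => pow_ne_zero _ hθ0
  obtain ⟨s, hs⟩ := exists_charpoly_roots_eq (card_pairs _ b) (map_pow_pairs hθb)
    (prod_pairs hY0 b)
  refine ⟨s, _, goodTorus_pairs hY0 b, hn, hs, card_pairs _ b, ?_⟩
  have hmk := mk_pow_eq_one_iff_of_one_mem hn hs (card_pairs _ b) (one_mem_pairs _ b)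
  refine Nat.dvd_antisymm (orderOf_dvd_of_pow_eq_one ?_) ?_
  · exact (hmk R).2 (forall_mem_pairs_pow (hθ ▸ pow_orderOf_eq_one θ))
  · rw [← hθ, orderOf_dvd_iff_pow_eq_one]
    simpa using (hmk _).1 (pow_orderOf_eq_one _) _ (mem_pairs _ hb)

/-- An element of a maximal torus of even rank. -/
theorem exists_torus_even [IsAlgClosed Ω] {p : ℕ} [Fact p.Prime] [CharP Ω p] {q R r b c : ℕ}
    (hF : Fintype.card F = q) (h : PrimMod q R (2 * b)) (hR : R ∣ q ^ b + 1) (hb : 0 < b)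
    (hpq : p ∣ q) (h' : PrimMod q r (2 * c + 1)) (hr : r ∣ ∑ i ∈ Finset.range (2 * c + 1), q ^ i)
    (hc : 0 < c) (hbc : b = c ∨ b = c + 1) :
    ∃ (s : Matrix.SpecialLinearGroup (Fin (2 * b + 1 + (2 * c + 1))) F) (D : Multiset Ω),
      GoodTorus D ∧ D.Nodup ∧
      (baseChange (2 * b + 1 + (2 * c + 1)) F Ω s).1.charpoly.roots = D ∧
      D.card = 2 * b + 1 + (2 * c + 1) ∧
      orderOf (QuotientGroup.mk s : Matrix.ProjectiveSpecialLinearGroup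
        (Fin (2 * b + 1 + (2 * c + 1))) F) = R.lcm r := by
  subst hF
  have hqR := coprime_of_dvd_pow_add_one hR hb
  have hqr := coprime_of_dvd_geom hr
  obtain ⟨θ, hθ⟩ := exists_orderOf_eq (Ω := Ω) (not_dvd_of_coprime Fact.out hpq hqR)
  obtain ⟨η, hη⟩ := exists_orderOf_eq (Ω := Ω) (not_dvd_of_coprime Fact.out hpq hqr)
  have hθb : θ ^ Fintype.card F ^ b = θ⁻¹ := pow_eq_inv_of_orderOf_dvd (hθ ▸ hR)
  have hθ0 : θ ≠ 0 := by
    rintro rfl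
    rw [orderOf_zero] at hθ
    rw [← hθ, Nat.zero_dvd] at hR
    omega
  have hprod : ∏ i ∈ Finset.range (2 * c + 1), η ^ Fintype.card F ^ i = 1 := by
    rw [Finset.prod_pow_eq_pow_sum]
    exact orderOf_dvd_iff_pow_eq_one.1 (hη ▸ hr)
  have hη0 : η ≠ 0 := by
    rintro rfl
    rw [Finset.prod_range_succ'] at hprod
    simp at hprod
  have hY0 : ∀ i, θ ^ Fintype.card F ^ i ≠ 0 := fun i => pow_ne_zero _ hθ0
  have hZ0 : ∀ i, η ^ Fintype.card F ^ i ≠ 0 := fun i => pow_ne_zero _ hη0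
  have hηc : η ^ Fintype.card F ^ (2 * c + 1) = η := by
    have h1 := Finset.prod_range_succ (fun i => η ^ Fintype.card F ^ i) (2 * c + 1)
    have h2 : ∏ i ∈ Finset.range (2 * c + 1), η ^ Fintype.card F ^ (i + 1) = 1 := by
      simp only [pow_succ _ (_ : ℕ), pow_mul _ (Fintype.card F ^ _)]
      rw [Finset.prod_pow, hprod, one_pow]
    rw [Finset.prod_range_succ', hprod, h2, one_mul, one_mul, pow_zero, pow_one] at h1
    exact h1.symm
  have hrR : R ≠ r := by
    rintro rfl
    have h1 : R ∣ Fintype.card F ^ (2 * c + 1) - 1 := by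
      rw [← hη]
      refine orderOf_dvd_of_pow_eq_one (mul_right_cancel₀ hη0 ?_)
      rw [← pow_succ, Nat.sub_add_cancel (Nat.pow_pos Fintype.card_pos), one_mul, hηc]
    have := (Nat.dvd_mul_right 2 b).trans (h _ h1)
    omega
  have hr1 : r ≠ 1 := by
    rintro rfl
    have := Nat.le_of_dvd one_pos (h' 1 (one_dvd _))
    omega
  have hor : ∀ i, orderOf (η ^ Fintype.card F ^ i) = r := fun i => by
    rw [Nat.Coprime.orderOf_pow, hη]
    rw [hη]
    exact hqr.pow_right i
  have hoR : ∀ i, orderOf (θ ^ Fintype.card F ^ i) = R := fun i => by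
    rw [Nat.Coprime.orderOf_pow, hθ]
    rw [hθ]
    exact hqR.pow_right i
  have hn : (pairs (fun i => θ ^ Fintype.card F ^ i) b +
      (Multiset.range (2 * c + 1)).map fun i => η ^ Fintype.card F ^ i).Nodup := by
    refine Multiset.nodup_add.2 ⟨h.nodup_pairs hqR Fintype.card_pos hb hθ0 hθ hθb,
      Multiset.Nodup.map_on (fun i hi j hj hij => ?_) (Multiset.nodup_range _), ?_⟩
    · rw [Multiset.mem_range] at hi hj
      exact h'.injOn hqr Fintype.card_pos hη0 hη hi hj hij
    · rw [Multiset.disjoint_left]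
      intro x hx hx'
      obtain ⟨j, -, rfl⟩ := Multiset.mem_map.1 hx'
      simp only [pairs, Multiset.mem_add, Multiset.mem_singleton, Multiset.mem_map] at hx
      rcases hx with (hx | ⟨i, -, hx⟩) | ⟨i, -, hx⟩
      · apply hr1
        rw [← hor j, hx, orderOf_one]
      · apply hrR
        rw [← hor j, ← hx, hoR]
      · apply hrR
        rw [← hor j, ← hx, ← hoR (b + i), pow_add, pow_mul, hθb, inv_pow]
  have hcard : (pairs (fun i => θ ^ Fintype.card F ^ i) b +
      (Multiset.range (2 * c + 1)).map fun i => η ^ Fintype.card F ^ i).card =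
        2 * b + 1 + (2 * c + 1) := by
    rw [Multiset.card_add, card_pairs, Multiset.card_map, Multiset.card_range]
  obtain ⟨s, hs⟩ := exists_charpoly_roots_eq hcard
    (by rw [Multiset.map_add, map_pow_pairs hθb, map_pow_conj hηc])
    (by rw [Multiset.prod_add, prod_pairs hY0 b, one_mul]; exact hprod)
  refine ⟨s, _, ?_, hn, hs, hcard, ?_⟩
  · rcases hbc with rfl | rfl
    · exact goodTorus_pairs_add hY0 hZ0 hprod
    · exact goodTorus_pairs_succ_add hY0 hZ0 hprod
  have hmk := mk_pow_eq_one_iff_of_one_mem hn hs hcard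
    (Multiset.mem_add.2 (Or.inl (one_mem_pairs _ b)))
  refine Nat.dvd_antisymm (orderOf_dvd_of_pow_eq_one ?_) (Nat.lcm_dvd ?_ ?_)
  · refine (hmk _).2 fun x hx => ?_
    rcases Multiset.mem_add.1 hx with hx | hx
    · exact forall_mem_pairs_pow (orderOf_dvd_iff_pow_eq_one.1 (hθ ▸ Nat.dvd_lcm_left _ _)) x hx
    · obtain ⟨j, -, rfl⟩ := Multiset.mem_map.1 hx
      exact orderOf_dvd_iff_pow_eq_one.1 (hor j ▸ Nat.dvd_lcm_right _ _)
  · rw [← hθ, orderOf_dvd_iff_pow_eq_one]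
    simpa using (hmk _).1 (pow_orderOf_eq_one _) _ (Multiset.mem_add.2 (Or.inl (mem_pairs _ hb)))
  · rw [← hη, orderOf_dvd_iff_pow_eq_one]
    refine (hmk _).1 (pow_orderOf_eq_one _) _ (Multiset.mem_add.2 (Or.inr ?_))
    exact Multiset.mem_map.2 ⟨0, Multiset.mem_range.2 (by omega), by simp⟩

end Realization

section FourTorus

variable {F Ω : Type*} [Field F] [Fintype F] [Field Ω] [Algebra F Ω]

/-- An element of `SL₄(p)` with eigenvalues `x, x⁻¹, y, y⁻¹`, where `x` has order `p² + 1`. -/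
theorem exists_torus_four [IsAlgClosed Ω] {p k : ℕ} [Fact p.Prime] [CharP Ω p]
    (hF : Fintype.card F = p) (hk : p ^ 2 + 1 = 2 * k) :
    ∃ (s : Matrix.SpecialLinearGroup (Fin 4) F) (x y : Ω), x ≠ 0 ∧ y ≠ 0 ∧
      ({x, x⁻¹, y, y⁻¹} : Multiset Ω).Nodup ∧
      (baseChange 4 F Ω s).1.charpoly.roots = {x, x⁻¹, y, y⁻¹} ∧ orderOf (x ^ 2) = k ∧
      orderOf (QuotientGroup.mk s : Matrix.ProjectiveSpecialLinearGroup (Fin 4) F) = k := by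
  have hp2 : 2 ≤ p := (Fact.out : p.Prime).two_le
  have hodd : Odd p := by
    rcases Nat.even_or_odd p with h | h
    · obtain ⟨t, rfl⟩ := h
      exfalso
      have : (t + t) ^ 2 = 2 * (2 * t ^ 2) := by ring
      omega
    · exact h
  have hndvd : ¬ p ∣ p ^ 2 + 1 := fun h => by
    have := (Nat.dvd_add_right (dvd_pow_self p two_ne_zero)).1 h
    exact (Fact.out : p.Prime).one_lt.ne' (Nat.dvd_one.1 this)
  obtain ⟨θ, hθ⟩ := exists_orderOf_eq (Ω := Ω) hndvd
  have hθ0 : θ ≠ 0 := by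
    rintro rfl
    rw [orderOf_zero] at hθ
    omega
  have hne : ∀ j, 0 < j → j < p ^ 2 + 1 → θ ^ j ≠ 1 := fun j h0 hj =>
    pow_ne_one_of_lt_orderOf h0.ne' (hθ ▸ hj)
  have hpp : p * 2 ≤ p ^ 2 := by rw [pow_two]; gcongr
  have hθp : θ ^ p ≠ 0 := pow_ne_zero _ hθ0
  have hinv : (θ ^ p) ^ p = θ⁻¹ := by
    refine eq_inv_of_mul_eq_one_left ?_
    rw [← pow_mul, ← pow_two, ← pow_succ, ← hθ, pow_orderOf_eq_one]
  have h2 : orderOf (θ ^ 2) = k := by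
    rw [orderOf_pow_of_dvd two_ne_zero (hθ ▸ hk ▸ dvd_mul_right _ _), hθ, hk]
    omega
  have hn : ({θ, θ⁻¹, θ ^ p, (θ ^ p)⁻¹} : Multiset Ω).Nodup := by
    have e1 : θ ≠ θ⁻¹ := fun h => hne 2 two_pos (by omega)
      (by rw [pow_two]; nth_rw 2 [h]; exact mul_inv_cancel₀ hθ0)
    have e2 : θ ≠ θ ^ p := fun h => hne (p - 1) (by omega) (by omega)
      (mul_right_cancel₀ hθ0 (by rw [← pow_succ, Nat.sub_add_cancel (by omega), ← h, one_mul]))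
    have e3 : θ ≠ (θ ^ p)⁻¹ := fun h => hne (p + 1) (by omega) (by omega)
      (by rw [pow_succ]; nth_rw 2 [h]; exact mul_inv_cancel₀ hθp)
    have e4 : θ ^ p ≠ (θ ^ p)⁻¹ := fun h => hne (p * 2) (by omega) (by omega)
      (by rw [pow_mul, pow_two]; nth_rw 2 [h]; exact mul_inv_cancel₀ hθp)
    have e5 : θ⁻¹ ≠ θ ^ p := fun h => e3 (by rw [← h, inv_inv])
    have e6 : θ⁻¹ ≠ (θ ^ p)⁻¹ := fun h => e2 (inv_injective h)
    simp [e1, e2, e3, e4, e5, e6]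
  have hmap : ({θ, θ⁻¹, θ ^ p, (θ ^ p)⁻¹} : Multiset Ω).map (· ^ Fintype.card F) =
      {θ, θ⁻¹, θ ^ p, (θ ^ p)⁻¹} := by
    rw [hF]
    simp only [Multiset.insert_eq_cons, Multiset.map_cons, Multiset.map_singleton, inv_pow, hinv,
      inv_inv]
    simp only [← Multiset.singleton_add]
    abel
  have hprod : ({θ, θ⁻¹, θ ^ p, (θ ^ p)⁻¹} : Multiset Ω).prod = 1 := by
    simp only [Multiset.insert_eq_cons, Multiset.prod_cons, Multiset.prod_singleton]
    field_simp
  obtain ⟨s, hs⟩ := exists_charpoly_roots_eq (F := F) (n := 4) rfl hmap hprod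
  refine ⟨s, θ, θ ^ p, hθ0, hθp, hn, hs, h2, Nat.dvd_antisymm (orderOf_dvd_of_pow_eq_one ?_) ?_⟩
  · have hθk : θ ^ k = -1 := by
      have h : (θ ^ k) ^ 2 = 1 := by
        rw [← pow_mul, mul_comm, ← hk, ← hθ, pow_orderOf_eq_one]
      exact (sq_eq_one_iff.1 h).resolve_left (hne k (by omega) (by omega))
    rw [mk_pow_eq_one_iff]
    refine ⟨-1, (baseChange_pow_eq_iff hn hs rfl _ _).2 ?_⟩
    have hθk' : (θ ^ p) ^ k = -1 := by rw [pow_right_comm, hθk, hodd.neg_one_pow]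
    simp [hθk, hθk', inv_pow]
  · obtain ⟨c, hc⟩ := (mk_pow_eq_one_iff _ _).1 (pow_orderOf_eq_one
      (QuotientGroup.mk s : Matrix.ProjectiveSpecialLinearGroup (Fin 4) F))
    rw [baseChange_pow_eq_iff hn hs rfl] at hc
    have hx := hc θ (by simp)
    have hx' := hc θ⁻¹ (by simp)
    rw [← h2]
    refine orderOf_dvd_of_pow_eq_one ?_
    rw [pow_right_comm, pow_two]
    nth_rw 2 [hx]
    rw [← hx', inv_pow, mul_inv_cancel₀ (pow_ne_zero _ hθ0)]

end FourTorus

section Orders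

theorem IsPrimePow.exists_dvd_of_dvd_lcm {ι : Type*} {R : ℕ} (hR : IsPrimePow R) {f : ι → ℕ}
    {s : Finset ι} (hf : ∀ i ∈ s, f i ≠ 0) (h : R ∣ s.lcm f) : ∃ i ∈ s, R ∣ f i := by
  classical
  induction s using Finset.induction_on with
  | empty => exact absurd (Nat.dvd_one.1 (by simpa using h)) hR.ne_one
  | insert i s hi ih =>
    rw [Finset.lcm_insert] at h
    have h0 : s.lcm f ≠ 0 := by
      rw [Ne, Finset.lcm_eq_zero_iff]
      rintro ⟨j, hj, hj0⟩
      exact hf j (Finset.mem_insert_of_mem hj) hj0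
    have hi0 := hf i (Finset.mem_insert_self _ _)
    obtain ⟨r, a, hr, -, rfl⟩ := (isPrimePow_nat_iff R).1 hR
    have h' : r ^ a ∣ Nat.lcm (f i) (s.lcm f) := h
    rw [hr.pow_dvd_iff_le_factorization (Nat.lcm_ne_zero hi0 h0), Nat.factorization_lcm hi0 h0,
      Finsupp.sup_apply, le_sup_iff] at h'
    rcases h' with h' | h'
    · exact ⟨i, Finset.mem_insert_self _ _, (hr.pow_dvd_iff_le_factorization hi0).2 h'⟩
    · obtain ⟨j, hj, hj'⟩ := ih (fun j hj => hf j (Finset.mem_insert_of_mem hj))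
        ((hr.pow_dvd_iff_le_factorization h0).2 h')
      exact ⟨j, Finset.mem_insert_of_mem hj, hj'⟩

variable {F Ω : Type*} [Field F] [Fintype F] [Field Ω] [Algebra F Ω]

theorem map_roots_charpoly_baseChange [IsAlgClosed Ω] {n : ℕ}
    (s : Matrix.SpecialLinearGroup (Fin n) F) :
    (baseChange n F Ω s).1.charpoly.roots.map (· ^ Fintype.card F) =
      (baseChange n F Ω s).1.charpoly.roots := by
  have h1 : (baseChange n F Ω s).1.charpoly = s.1.charpoly.map (algebraMap F Ω) := by
    rw [← Matrix.charpoly_map]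
    rfl
  have h2 := (IsAlgClosed.splits (baseChange n F Ω s).1.charpoly).roots_map
    (FiniteField.frobeniusAlgHom F Ω : Ω →+* Ω)
  have h3 : (baseChange n F Ω s).1.charpoly.map (FiniteField.frobeniusAlgHom F Ω : Ω →+* Ω) =
      (baseChange n F Ω s).1.charpoly := by
    rw [h1, Polynomial.map_map]
    congr 1
    exact (FiniteField.frobeniusAlgHom F Ω).comp_algebraMap
  rw [h3] at h2
  exact h2.symm

theorem card_roots_charpoly [IsAlgClosed Ω] {n : ℕ} (S : Matrix (Fin n) (Fin n) Ω) :
    S.charpoly.roots.card = n := by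
  rw [← (IsAlgClosed.splits S.charpoly).natDegree_eq_card_roots, Matrix.charpoly_natDegree_eq_dim,
    Fintype.card_fin]

theorem orderOf_ne_zero_of_mem_roots [IsAlgClosed Ω] {n : ℕ}
    (s : Matrix.SpecialLinearGroup (Fin n) F) {x : Ω}
    (hx : x ∈ (baseChange n F Ω s).1.charpoly.roots) : orderOf x ≠ 0 := by
  have : Finite (Matrix.SpecialLinearGroup (Fin n) F) := by
    classical exact Finite.of_injective _ Subtype.val_injective
  rw [orderOf_ne_zero_iff, isOfFinOrder_iff_pow_eq_one]
  refine ⟨orderOf s, orderOf_pos s, ?_⟩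
  have hx1 : x ∈ spectrum Ω (baseChange n F Ω s).1 := by
    rw [Matrix.mem_spectrum_iff_isRoot_charpoly]
    exact (Polynomial.mem_roots'.1 hx).2
  have hx2 := spectrum.pow_mem_pow (baseChange n F Ω s).1 (orderOf s) hx1
  rw [← Matrix.SpecialLinearGroup.coe_pow, ← map_pow, pow_orderOf_eq_one, map_one] at hx2
  cases n with
  | zero => simp at hx
  | succ n =>
    have h3 : spectrum Ω (1 : Matrix (Fin (n + 1)) (Fin (n + 1)) Ω) = {1} := spectrum.one_eq
    change _ ∈ spectrum Ω (1 : Matrix (Fin (n + 1)) (Fin (n + 1)) Ω) at hx2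
    rw [h3] at hx2
    exact hx2

theorem pow_mul_pow_eq_one [IsAlgClosed Ω] {p : ℕ} [Fact p.Prime] [CharP Ω p] {n l : ℕ}
    (s : Matrix.SpecialLinearGroup (Fin n) F)
    (hl : ∀ x ∈ (baseChange n F Ω s).1.charpoly.roots, x ^ l = 1) : s ^ (l * p ^ n) = 1 := by
  cases n with
  | zero => exact Subsingleton.elim _ _
  | succ n =>
  set S := (baseChange (n + 1) F Ω s).1 with hS
  have h1 : S.charpoly ∣ (Polynomial.X ^ l - 1) ^ (n + 1) := by
    have h2 := (IsAlgClosed.splits S.charpoly).eq_prod_roots_of_monic (Matrix.charpoly_monic S)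
    have h3 : ((Polynomial.X ^ l - 1 : Polynomial Ω)) ^ (n + 1) =
        (S.charpoly.roots.map fun _ => (Polynomial.X ^ l - 1 : Polynomial Ω)).prod := by
      rw [Multiset.map_const', Multiset.prod_replicate, card_roots_charpoly]
    rw [h3]
    conv_lhs => rw [h2]
    refine Multiset.prod_dvd_prod_of_dvd _ _ fun x hx => ?_
    rw [Polynomial.dvd_iff_isRoot]
    simp [hl x hx]
  have h2 : (S ^ l - 1) ^ (n + 1) = 0 := by
    obtain ⟨Q, hQ⟩ := h1
    have := congrArg (Polynomial.aeval S) hQ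
    simpa [Matrix.aeval_self_charpoly] using this
  have h3 : (S ^ l - 1) ^ p ^ (n + 1) = 0 :=
    pow_eq_zero_of_le (Nat.lt_pow_self (Fact.out : p.Prime).one_lt).le h2
  rw [sub_pow_char_pow_of_commute _ _ (Commute.one_right _), one_pow, sub_eq_zero, ← pow_mul] at h3
  have h4 : Function.Injective (baseChange (n + 1) F Ω) := fun a b hab => by
    ext i j
    have := congrArg (fun M => M.1 i j) hab
    simp only [baseChange_apply] at this
    exact (algebraMap F Ω).injective this
  apply h4
  rw [map_pow, map_one]
  exact Subtype.ext (by rw [Matrix.SpecialLinearGroup.coe_pow]; exact h3)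

/-- The eigenvalues of an element whose order in the projective group is divisible by `p`. -/
theorem roots_of_orderOf_eq [IsAlgClosed Ω] {p : ℕ} [Fact p.Prime] [CharP F p] [CharP Ω p]
    {n k : ℕ} (s : Matrix.SpecialLinearGroup (Fin n) F)
    (hs : orderOf (QuotientGroup.mk s : Matrix.ProjectiveSpecialLinearGroup (Fin n) F) = p * k)
    (hk : 0 < k) :
    ¬ (baseChange n F Ω s).1.charpoly.roots.Nodup ∧ (¬ p ∣ k → ∀ R, IsPrimePow R → R ∣ k →
      ∃ x ∈ (baseChange n F Ω s).1.charpoly.roots, R ∣ orderOf x) := by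
  classical
  have hp : p.Prime := Fact.out
  refine ⟨fun hn => ?_, fun hpk R hR hRk => ?_⟩
  · obtain ⟨c, hc⟩ := (mk_pow_eq_one_iff s (p * k)).1 (hs ▸ pow_orderOf_eq_one _)
    obtain ⟨d, rfl⟩ := (frobeniusEquiv F p).surjective c
    rw [baseChange_pow_eq_iff hn rfl (card_roots_charpoly _)] at hc
    have h1 : (QuotientGroup.mk s : Matrix.ProjectiveSpecialLinearGroup (Fin n) F) ^ k = 1 := by
      rw [mk_pow_eq_one_iff]
      refine ⟨d, (baseChange_pow_eq_iff hn rfl (card_roots_charpoly _) _ _).2 fun x hx => ?_⟩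
      have h2 := hc x hx
      rw [coe_frobeniusEquiv, frobenius_def, map_pow, mul_comm, pow_mul] at h2
      exact frobenius_inj Ω p h2
    have h2 := Nat.le_of_dvd hk (hs ▸ orderOf_dvd_of_pow_eq_one h1)
    have := Nat.mul_le_mul_right k hp.two_le
    omega
  · set D := (baseChange n F Ω s).1.charpoly.roots with hD
    have h1 : s ^ (D.toFinset.lcm orderOf * p ^ n) = 1 := pow_mul_pow_eq_one (Ω := Ω) s fun x hx =>
      orderOf_dvd_iff_pow_eq_one.1 (Finset.dvd_lcm (Multiset.mem_toFinset.2 hx))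
    have h2 : p * k ∣ D.toFinset.lcm orderOf * p ^ n := by
      rw [← hs]
      refine orderOf_dvd_of_pow_eq_one ?_
      rw [← QuotientGroup.mk_pow, h1]
      rfl
    have h3 : k ∣ D.toFinset.lcm orderOf :=
      (((Nat.Prime.coprime_iff_not_dvd hp).2 hpk).symm.pow_right n).dvd_of_dvd_mul_right
        ((dvd_mul_left _ _).trans h2)
    obtain ⟨x, hx, hx'⟩ := IsPrimePow.exists_dvd_of_dvd_lcm hR (f := orderOf) (s := D.toFinset)
      (fun x hx => orderOf_ne_zero_of_mem_roots s (Multiset.mem_toFinset.1 hx)) (hRk.trans h3)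
    exact ⟨x, Multiset.mem_toFinset.1 hx, hx'⟩

theorem card_add_two_le_of_not_nodup [DecidableEq Ω] {D : Multiset Ω} {q : ℕ}
    (hD : D.map (· ^ q) = D) (hn : ¬ D.Nodup) (N : Finset Ω) (hND : ∀ x ∈ N, x ∈ D)
    (hN : ∀ x ∈ N, x ^ q ≠ x) : N.card + 2 ≤ D.card := by
  rw [Multiset.nodup_iff_count_le_one] at hn
  push Not at hn
  obtain ⟨x, hx⟩ := hn
  have hx' : 1 < D.count (x ^ q) := by
    rw [← Nat.succ_le_iff, Multiset.le_count_iff_replicate_le] at hx ⊢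
    rw [← hD]
    simpa using Multiset.map_le_map (f := fun y : Ω => y ^ q) hx
  obtain ⟨y, hy, hyx⟩ : ∃ y, 1 < D.count y ∧ (y ≠ x ∨ y ∉ N) := by
    by_cases h : x ∈ N
    · exact ⟨x ^ q, hx', Or.inl (hN x h)⟩
    · exact ⟨x, hx, Or.inr h⟩
  have key : N.val + {x, y} ≤ D := by
    rw [Multiset.le_iff_count]
    intro t
    have h1 := Multiset.nodup_iff_count_le_one.1 N.nodup t
    have h2 : t ∈ N → 1 ≤ D.count t := fun h => Multiset.one_le_count_iff_mem.2 (hND t h)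
    have h3 : t ∉ N → N.val.count t = 0 := Multiset.count_eq_zero.2
    rw [Multiset.count_add, Multiset.insert_eq_cons, Multiset.count_cons, Multiset.count_singleton]
    by_cases htx : t = x <;> by_cases hty : t = y
    · subst htx hty
      rw [h3 (hyx.resolve_left (by simp)), if_pos rfl]
      omega
    · subst htx
      rw [if_pos rfl, if_neg hty]
      omega
    · subst hty
      rw [if_pos rfl, if_neg htx]
      omega
    · rw [if_neg htx, if_neg hty]
      by_cases htN : t ∈ N
      · have := h2 htN
        omega
      · rw [h3 htN]
        omega
  have := Multiset.card_le_card key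
  rw [Multiset.card_add] at this
  exact this

end Orders

section Orders

theorem PrimMod.of_dvd {q R S e : ℕ} (h : PrimMod q R e) (hS : R ∣ S) : PrimMod q S e :=
  fun k hk => h k (hS.trans hk)

theorem PrimMod.mul {q R e f : ℕ} (he : PrimMod q R e) (hf : PrimMod q R f) (hef : e.Coprime f) :
    PrimMod q R (e * f) :=
  fun k hk => hef.mul_dvd_of_dvd_of_dvd (he k hk) (hf k hk)

theorem coprime_orderOf {Ω : Type*} [Field Ω] {p m : ℕ} [Fact p.Prime] [CharP Ω p] {x : Ω}
    (hx : orderOf x ≠ 0) : (orderOf x).Coprime (p ^ m) := by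
  have hp : p.Prime := Fact.out
  refine Nat.Coprime.pow_right _ (((Nat.Prime.coprime_iff_not_dvd hp).2 fun h => ?_).symm)
  obtain ⟨t, ht⟩ := h
  have h1 : x ^ t = 1 := by
    refine frobenius_inj Ω p ?_
    rw [frobenius_def, frobenius_def, one_pow, ← pow_mul, mul_comm, ← ht, pow_orderOf_eq_one]
  have h0 : 0 < t := by
    rcases Nat.eq_zero_or_pos t with rfl | h
    · exact absurd ht hx
    · exact h
  have h2 := Nat.le_of_dvd h0 (orderOf_dvd_of_pow_eq_one h1)
  have := Nat.mul_le_mul_right t hp.two_le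
  omega

variable {Ω : Type*} [Field Ω] [DecidableEq Ω]

/-- The first `e` conjugates of `x` under the `q`-power map. -/
def conjFinset (q e : ℕ) (x : Ω) : Finset Ω := (Finset.range e).image fun i => x ^ q ^ i

theorem mem_of_mem_conjFinset {D : Multiset Ω} {q e : ℕ} (hD : D.map (· ^ q) = D) {x : Ω}
    (hx : x ∈ D) {y : Ω} (hy : y ∈ conjFinset q e x) : y ∈ D := by
  obtain ⟨i, -, rfl⟩ := Finset.mem_image.1 hy
  clear hy
  induction i with
  | zero => simpa using hx
  | succ i ih =>
    rw [pow_succ, pow_mul, ← hD]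
    exact Multiset.mem_map_of_mem (· ^ q) ih

theorem orderOf_of_mem_conjFinset {q e : ℕ} {x : Ω} (hx : (orderOf x).Coprime q) {y : Ω}
    (hy : y ∈ conjFinset q e x) : orderOf y = orderOf x := by
  obtain ⟨i, -, rfl⟩ := Finset.mem_image.1 hy
  exact Nat.Coprime.orderOf_pow (hx.pow_right i)

theorem PrimMod.card_conjFinset {q e : ℕ} {x : Ω} (h : PrimMod q (orderOf x) e)
    (hx : (orderOf x).Coprime q) (hq : 0 < q) (hx0 : x ≠ 0) : (conjFinset q e x).card = e := by
  rw [conjFinset, Finset.card_image_of_injOn, Finset.card_range]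
  intro i hi j hj hij
  exact h.injOn hx hq hx0 rfl (Finset.mem_range.1 hi) (Finset.mem_range.1 hj) hij

theorem PrimMod.pow_ne_self {q e : ℕ} {y : Ω} (h : PrimMod q (orderOf y) e) (hq : 0 < q)
    (he : 1 < e) (hy : y ≠ 0) : y ^ q ≠ y := fun hy' => by
  have h1 : y ^ (q - 1) = 1 := mul_right_cancel₀ hy (by
    rw [← pow_succ, Nat.sub_add_cancel hq, one_mul, hy'])
  have := Nat.le_of_dvd one_pos (h 1 (by simpa using orderOf_dvd_of_pow_eq_one h1))
  omega

variable {F : Type*} [Field F] [Fintype F]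

theorem ne_zero_of_orderOf_ne_zero {x : Ω} (h : orderOf x ≠ 0) : x ≠ 0 := by
  rintro rfl
  exact h (orderOf_zero _)

/-- If `p * k` is the order of an element of `PSL_n(q)`, then `k` has no prime power divisor
modulo which `q` has order a multiple of `e`, for `e ≥ n - 1`. -/
theorem orderOf_mk_ne {p : ℕ} [Fact p.Prime] [CharP F p] {n k R e : ℕ}
    (s : Matrix.SpecialLinearGroup (Fin n) F) (hpk : ¬ p ∣ k)
    (hR : IsPrimePow R) (hRk : R ∣ k) (h : PrimMod (Fintype.card F) R e) (he : 1 < e)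
    (hne : n ≤ e + 1) :
    orderOf (QuotientGroup.mk s : Matrix.ProjectiveSpecialLinearGroup (Fin n) F) ≠ p * k := by
  classical
  intro hs
  have := charP_of_injective_algebraMap (algebraMap F (AlgebraicClosure F)).injective p
  have hk : 0 < k := Nat.pos_of_ne_zero fun h0 => hpk (h0 ▸ dvd_zero p)
  obtain ⟨hn, hD⟩ := roots_of_orderOf_eq (Ω := AlgebraicClosure F) s hs hk
  obtain ⟨x, hx, hRx⟩ := hD hpk R hR hRk
  have hx0 := orderOf_ne_zero_of_mem_roots s hx
  have hx0' := ne_zero_of_orderOf_ne_zero hx0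
  obtain ⟨m, -, hm⟩ := FiniteField.card F p
  have hxq : (orderOf x).Coprime (Fintype.card F) := hm ▸ coprime_orderOf hx0
  have hst := map_roots_charpoly_baseChange (Ω := AlgebraicClosure F) s
  have h1 := card_add_two_le_of_not_nodup hst hn (conjFinset (Fintype.card F) e x)
    (fun y hy => mem_of_mem_conjFinset hst hx hy) (fun y hy => by
      have hy' := orderOf_of_mem_conjFinset hxq hy
      exact (h.of_dvd (hy' ▸ hRx)).pow_ne_self Fintype.card_pos he
        (ne_zero_of_orderOf_ne_zero (hy' ▸ hx0)))
  rw [(h.of_dvd hRx).card_conjFinset hxq Fintype.card_pos hx0', card_roots_charpoly] at h1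
  omega

/-- If `p * k` is the order of an element of `PSL_n(q)`, then `k` does not have prime power divisors
modulo which `q` has orders multiples of `e` and `f`, for `e` and `f` coprime with
`e + f ≥ n - 1`. -/
theorem orderOf_mk_ne_of_add {p : ℕ} [Fact p.Prime] [CharP F p] {n k R r e f : ℕ}
    (s : Matrix.SpecialLinearGroup (Fin n) F) (hpk : ¬ p ∣ k)
    (hR : IsPrimePow R) (hRk : R ∣ k) (h : PrimMod (Fintype.card F) R e) (he : 1 < e)
    (hr : IsPrimePow r) (hrk : r ∣ k) (h' : PrimMod (Fintype.card F) r f) (hf : 1 < f)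
    (hef : e.Coprime f) (hne : n ≤ e + f + 1) :
    orderOf (QuotientGroup.mk s : Matrix.ProjectiveSpecialLinearGroup (Fin n) F) ≠ p * k := by
  classical
  intro hs
  have := charP_of_injective_algebraMap (algebraMap F (AlgebraicClosure F)).injective p
  have hk : 0 < k := Nat.pos_of_ne_zero fun h0 => hpk (h0 ▸ dvd_zero p)
  obtain ⟨hn, hD⟩ := roots_of_orderOf_eq (Ω := AlgebraicClosure F) s hs hk
  obtain ⟨x, hx, hRx⟩ := hD hpk R hR hRk
  obtain ⟨z, hz, hrz⟩ := hD hpk r hr hrk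
  have hx0 := orderOf_ne_zero_of_mem_roots s hx
  have hz0 := orderOf_ne_zero_of_mem_roots s hz
  obtain ⟨m, -, hm⟩ := FiniteField.card F p
  have hxq : (orderOf x).Coprime (Fintype.card F) := hm ▸ coprime_orderOf hx0
  have hzq : (orderOf z).Coprime (Fintype.card F) := hm ▸ coprime_orderOf hz0
  have hst := map_roots_charpoly_baseChange (Ω := AlgebraicClosure F) s
  have hcx := (h.of_dvd hRx).card_conjFinset hxq Fintype.card_pos (ne_zero_of_orderOf_ne_zero hx0)
  have hcz := (h'.of_dvd hrz).card_conjFinset hzq Fintype.card_pos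
    (ne_zero_of_orderOf_ne_zero hz0)
  by_cases hdis : Disjoint (conjFinset (Fintype.card F) e x) (conjFinset (Fintype.card F) f z)
  · have h1 := card_add_two_le_of_not_nodup hst hn
      (conjFinset (Fintype.card F) e x ∪ conjFinset (Fintype.card F) f z)
      (fun y hy => (Finset.mem_union.1 hy).elim (mem_of_mem_conjFinset hst hx)
        (mem_of_mem_conjFinset hst hz)) (fun y hy => by
        rcases Finset.mem_union.1 hy with hy | hy
        · have hy' := orderOf_of_mem_conjFinset hxq hy
          exact (h.of_dvd (hy' ▸ hRx)).pow_ne_self Fintype.card_pos he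
            (ne_zero_of_orderOf_ne_zero (hy' ▸ hx0))
        · have hy' := orderOf_of_mem_conjFinset hzq hy
          exact (h'.of_dvd (hy' ▸ hrz)).pow_ne_self Fintype.card_pos hf
            (ne_zero_of_orderOf_ne_zero (hy' ▸ hz0)))
    rw [Finset.card_union_of_disjoint hdis, hcx, hcz, card_roots_charpoly] at h1
    omega
  · rw [Finset.not_disjoint_iff] at hdis
    obtain ⟨y, hyx, hyz⟩ := hdis
    have hxz : orderOf x = orderOf z :=
      (orderOf_of_mem_conjFinset hxq hyx).symm.trans (orderOf_of_mem_conjFinset hzq hyz)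
    have hm := ((h.of_dvd hRx).mul (h'.of_dvd (hxz ▸ hrz)) hef)
    have h1 := card_add_two_le_of_not_nodup hst hn (conjFinset (Fintype.card F) (e * f) x)
      (fun y hy => mem_of_mem_conjFinset hst hx hy) (fun y hy => by
        have hy' := orderOf_of_mem_conjFinset hxq hy
        exact (h.of_dvd (hy' ▸ hRx)).pow_ne_self Fintype.card_pos he
          (ne_zero_of_orderOf_ne_zero (hy' ▸ hx0)))
    rw [hm.card_conjFinset hxq Fintype.card_pos (ne_zero_of_orderOf_ne_zero hx0),
      card_roots_charpoly] at h1
    nlinarith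

end Orders

section Cyclotomic

/-- The value at `q` of the cyclotomic polynomial of index `N`. -/
noncomputable def cyc (N q : ℕ) : ℕ := ((Polynomial.cyclotomic N ℤ).eval (q : ℤ)).natAbs

theorem cast_cyc {N q : ℕ} (hq : 2 ≤ q) :
    (cyc N q : ℤ) = (Polynomial.cyclotomic N ℤ).eval (q : ℤ) :=
  Int.natAbs_of_nonneg (Polynomial.cyclotomic_pos' N (by exact_mod_cast hq)).le

theorem eval_cyclotomic_natCast {N q : ℕ} (hq : 2 ≤ q) (R : Type*) [CommRing R] :
    (Polynomial.cyclotomic N R).eval (q : R) = (cyc N q : R) := by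
  have h := congrArg (Int.cast : ℤ → R) (cast_cyc (N := N) hq)
  rw [Int.cast_natCast] at h
  rw [h, ← Polynomial.map_cyclotomic_int N R, ← eq_intCast (Int.castRingHom R),
    Polynomial.eval_natCast_map]

theorem dvd_pow_sub_one_iff {q R k : ℕ} (hq : 0 < q) : R ∣ q ^ k - 1 ↔ (q : ZMod R) ^ k = 1 := by
  rw [← ZMod.natCast_eq_zero_iff, Nat.cast_sub (Nat.one_le_pow _ _ hq), sub_eq_zero]
  simp

theorem sub_one_mul_cyc_dvd {N d q : ℕ} (hq : 2 ≤ q) (hd : d ∣ N) (hdN : d < N) :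
    (q ^ d - 1) * cyc N q ∣ q ^ N - 1 := by
  obtain ⟨P, hP⟩ := Polynomial.X_pow_sub_one_mul_cyclotomic_dvd_X_pow_sub_one_of_dvd ℤ
    (Nat.mem_properDivisors.2 ⟨hd, hdN⟩)
  have h := congrArg (Polynomial.eval (q : ℤ)) hP
  simp only [Polynomial.eval_mul, Polynomial.eval_sub, Polynomial.eval_pow, Polynomial.eval_X,
    Polynomial.eval_one, ← cast_cyc hq] at h
  rw [← Int.natCast_dvd_natCast]
  push_cast [Nat.one_le_pow _ _ (zero_lt_two.trans_le hq)]
  exact ⟨_, h⟩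

theorem cyc_dvd_geom {N d q : ℕ} (hq : 2 ≤ q) (hd : 0 < d) {e : ℕ} (he : 1 < e) (hN : N = d * e) :
    cyc N q ∣ ∑ i ∈ Finset.range e, (q ^ d) ^ i := by
  have hlt : d < N := by nlinarith
  have h := sub_one_mul_cyc_dvd (q := q) hq ⟨e, hN⟩ hlt
  have h1 : 1 < q ^ d := Nat.one_lt_pow hd.ne' (by omega)
  rw [hN, pow_mul, ← geom_sum_mul_of_one_le h1.le, mul_comm] at h
  rw [hN]
  exact Nat.dvd_of_mul_dvd_mul_right (by omega) h

theorem isPrimitiveRoot_of_dvd_cyc {r N q a m : ℕ} [Fact r.Prime] (hq : 2 ≤ q) (h : r ∣ cyc N q)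
    (hN : N = r ^ a * m) (hm : ¬ r ∣ m) : IsPrimitiveRoot (q : ZMod r) m := by
  have : NeZero (m : ZMod r) := ⟨by rwa [Ne, ZMod.natCast_eq_zero_iff]⟩
  rw [← Polynomial.isRoot_cyclotomic_prime_pow_mul_iff_of_charP (p := r) (k := a), ← hN,
    Polynomial.IsRoot.def, eval_cyclotomic_natCast hq, ZMod.natCast_eq_zero_iff]
  exact h

theorem one_lt_cyc {N q : ℕ} (hq : 2 ≤ q) (hN : 1 < N) : 1 < cyc N q := by
  have h := Polynomial.sub_one_pow_totient_lt_natAbs_cyclotomic_eval hN (by omega : q ≠ 1)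
  have := Nat.one_le_pow N.totient (q - 1) (by omega)
  exact this.trans_lt h

/-- Either some prime power divisor of the cyclotomic value is primitive, or that value is a prime
divisor of the index. -/
theorem exists_primMod_or_prime_cyc {N q : ℕ} (hq : 2 ≤ q) (hN : 1 < N) :
    (∃ R, IsPrimePow R ∧ R ∣ cyc N q ∧ PrimMod q R N) ∨ ((cyc N q).Prime ∧ cyc N q ∣ N) := by
  by_cases hex : ∃ r, r.Prime ∧ r ∣ cyc N q ∧ ¬ r ∣ N
  · obtain ⟨r, hr, hrc, hrN⟩ := hex
    have : Fact r.Prime := ⟨hr⟩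
    have h := isPrimitiveRoot_of_dvd_cyc (a := 0) (m := N) hq hrc (by simp) hrN
    refine Or.inl ⟨r, hr.isPrimePow, hrc, fun k hk => ?_⟩
    exact h.dvd_of_pow_eq_one _ ((dvd_pow_sub_one_iff (by omega)).1 hk)
  push Not at hex
  have key : ∀ r r', r.Prime → r'.Prime → r ∣ cyc N q → r' ∣ cyc N q → r ≠ r' → r' < r := by
    intro r r' hr hr' h h' hne
    have : Fact r.Prime := ⟨hr⟩
    obtain ⟨a, m, hm, hNm⟩ := Nat.exists_eq_pow_mul_and_not_dvd (by omega : N ≠ 0) r hr.ne_one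
    have h1 := isPrimitiveRoot_of_dvd_cyc hq h hNm hm
    have h2 : r' ∣ m := by
      have h3 := hNm ▸ hex r' hr' h'
      exact (Nat.Coprime.pow_right a ((Nat.coprime_primes hr' hr).2 hne.symm)).dvd_of_dvd_mul_left h3
    have h4 : m ∣ r - 1 := by
      rw [h1.eq_orderOf]
      refine ZMod.orderOf_dvd_card_sub_one fun h0 => ?_
      have hm0 : m ≠ 0 := by
        rintro rfl
        exact hm (dvd_zero r)
      have h5 := h1.pow_eq_one
      rw [h0, zero_pow hm0] at h5
      exact zero_ne_one h5
    have := Nat.le_of_dvd (Nat.sub_pos_of_lt hr.one_lt) (h2.trans h4)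
    have := hr.one_lt
    omega
  obtain ⟨r, hr, hrc⟩ := Nat.exists_prime_and_dvd (one_lt_cyc hq hN).ne'
  have : Fact r.Prime := ⟨hr⟩
  have huniq : ∀ r', r'.Prime → r' ∣ cyc N q → r' = r := fun r' hr' h' => by
    by_contra hne
    have := key r r' hr hr' hrc h' (Ne.symm hne)
    have := key r' r hr' hr h' hrc hne
    omega
  have hA := Nat.eq_prime_pow_of_unique_prime_dvd (by have := one_lt_cyc hq hN; omega)
    (fun {d} hd hd' => huniq d hd hd')
  set t := (cyc N q).primeFactorsList.length
  have hA' : IsPrimePow (cyc N q) := by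
    rw [hA]
    refine hr.isPrimePow.pow fun ht => ?_
    rw [ht, pow_zero] at hA
    exact (one_lt_cyc hq hN).ne' hA
  by_cases hprim : PrimMod q (cyc N q) N
  · exact Or.inl ⟨_, hA', dvd_rfl, hprim⟩
  right
  obtain ⟨k, hk, hNk⟩ : ∃ k, cyc N q ∣ q ^ k - 1 ∧ ¬ N ∣ k := by
    by_contra! h
    exact hprim h
  obtain ⟨a, m, hm, hNm⟩ := Nat.exists_eq_pow_mul_and_not_dvd (by omega : N ≠ 0) r hr.ne_one
  have h1 := isPrimitiveRoot_of_dvd_cyc hq hrc hNm hm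
  have hmk : m ∣ k := h1.dvd_of_pow_eq_one _ ((dvd_pow_sub_one_iff (by omega)).1 (hrc.trans hk))
  have hrN := hex r hr hrc
  obtain ⟨N', hN'⟩ := hrN
  have hN'0 : 0 < N' := Nat.pos_of_ne_zero fun h => by
    rw [h, mul_zero] at hN'
    omega
  have hgcd : k.gcd N ∣ N' := by
    have hm0 : 0 < m := Nat.pos_of_ne_zero fun h => hm (h ▸ dvd_zero r)
    obtain ⟨g, hg⟩ := Nat.dvd_gcd hmk (hNm ▸ dvd_mul_left m _)
    have h2 : m * g ∣ m * r ^ a := by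
      rw [← hg, mul_comm m, ← hNm]
      exact Nat.gcd_dvd_right _ _
    obtain ⟨j, hj, rfl⟩ := (Nat.dvd_prime_pow hr).1 (Nat.dvd_of_mul_dvd_mul_left hm0 h2)
    obtain hja | rfl := hj.lt_or_eq
    · obtain ⟨b, rfl⟩ := Nat.exists_eq_add_of_lt hja
      have h3 : N' = m * r ^ (j + b) := by
        apply Nat.eq_of_mul_eq_mul_left hr.pos
        rw [← hN', hNm]
        ring
      rw [hg, h3]
      exact mul_dvd_mul_left _ (pow_dvd_pow _ (Nat.le_add_right _ _))
    · rw [mul_comm, ← hNm] at hg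
      exact absurd (Nat.gcd_eq_right_iff_dvd.1 hg) hNk
  have hd : cyc N q ∣ q ^ N' - 1 := by
    rw [dvd_pow_sub_one_iff (by omega)] at hk ⊢
    have h2 := (dvd_pow_sub_one_iff (by omega)).1
      ((dvd_mul_left _ _).trans (sub_one_mul_cyc_dvd hq (one_dvd N) hN))
    exact orderOf_dvd_iff_pow_eq_one.1 ((Nat.dvd_gcd (orderOf_dvd_of_pow_eq_one hk)
      (orderOf_dvd_of_pow_eq_one h2)).trans hgcd)
  have hg := cyc_dvd_geom hq hN'0 hr.one_lt (hN'.trans (mul_comm _ _))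
  have hr' : cyc N q ∣ r := by
    rw [← ZMod.natCast_eq_zero_iff] at hg ⊢
    rw [dvd_pow_sub_one_iff (by omega)] at hd
    simpa [hd] using hg
  have hr'' : cyc N q = r := ((Nat.dvd_prime hr).1 hr').resolve_left (one_lt_cyc hq hN).ne'
  rw [hr'']
  exact ⟨hr, ⟨N', hN'⟩⟩

end Cyclotomic

section Cyclotomic

theorem sub_one_pow_lt_cyc {N q : ℕ} (hq : 2 ≤ q) (hN : 1 < N) : (q - 1) ^ N.totient < cyc N q :=
  Polynomial.sub_one_pow_totient_lt_natAbs_cyclotomic_eval hN (by omega)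

theorem cyc_lt_add_one_pow {N q : ℕ} (hq : 2 ≤ q) (hN : 3 ≤ N) : cyc N q < (q + 1) ^ N.totient := by
  have h := Polynomial.cyclotomic_eval_lt_add_one_pow_totient (q := (q : ℝ)) hN
    (by exact_mod_cast hq)
  rw [eval_cyclotomic_natCast hq] at h
  exact_mod_cast h

theorem cyc_mul_of_dvd {n r q : ℕ} (hq : 2 ≤ q) (hr : r.Prime) (h : r ∣ n) :
    cyc (n * r) q = cyc n (q ^ r) := by
  have hq' : 2 ≤ q ^ r := hq.trans (Nat.le_self_pow hr.ne_zero q)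
  have h1 := congrArg (Polynomial.eval (q : ℤ)) (Polynomial.cyclotomic_expand_eq_cyclotomic hr h ℤ)
  rw [Polynomial.expand_eval, ← cast_cyc hq, ← Nat.cast_pow, ← cast_cyc hq'] at h1
  exact_mod_cast h1.symm

theorem cyc_mul_of_not_dvd {n r q : ℕ} (hq : 2 ≤ q) (hr : r.Prime) (h : ¬ r ∣ n) :
    cyc (n * r) q * cyc n q = cyc n (q ^ r) := by
  have hq' : 2 ≤ q ^ r := hq.trans (Nat.le_self_pow hr.ne_zero q)
  have h1 := congrArg (Polynomial.eval (q : ℤ))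
    (Polynomial.cyclotomic_expand_eq_cyclotomic_mul hr h ℤ)
  rw [Polynomial.expand_eval, Polynomial.eval_mul, ← cast_cyc hq, ← cast_cyc hq, ← Nat.cast_pow,
    ← cast_cyc hq'] at h1
  exact_mod_cast h1.symm

theorem cyc_one {q : ℕ} (hq : 2 ≤ q) : cyc 1 q = q - 1 := by
  zify [(by omega : 1 ≤ q)]
  rw [cast_cyc hq]
  simp

theorem cyc_two {q : ℕ} (hq : 2 ≤ q) : cyc 2 q = q + 1 := by
  zify
  rw [cast_cyc hq]
  simp

theorem le_two_pow_sub_one (r : ℕ) : r ≤ 2 ^ r - 1 := Nat.le_sub_one_of_lt Nat.lt_two_pow_self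

theorem eq_of_prime_cyc {N q : ℕ} (hq : 2 ≤ q) (hN : 1 < N) (hr : (cyc N q).Prime)
    (hrN : cyc N q ∣ N) : q = 2 ∧ N = 6 := by
  obtain hq3 | rfl := hq.lt_or_eq
  · exfalso
    have h1 := sub_one_pow_lt_cyc hq hN
    have h2 : cyc N q - 1 ≤ N.totient := by
      rw [← Nat.totient_prime hr]
      exact Nat.le_of_dvd (Nat.totient_pos.2 (by omega)) (Nat.totient_dvd_of_dvd hrN)
    have h3 : 2 ^ (cyc N q - 1) ≤ (q - 1) ^ N.totient :=
      (Nat.pow_le_pow_right two_pos h2).trans (Nat.pow_le_pow_left (by omega) _)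
    have h4 : cyc N q - 1 < 2 ^ (cyc N q - 1) := Nat.lt_two_pow_self
    omega
  refine ⟨rfl, ?_⟩
  have hodd : cyc N 2 ≠ 2 := fun h => by
    have h1 := sub_one_mul_cyc_dvd (q := 2) le_rfl (one_dvd N) hN
    have h2 : 2 ∣ 2 ^ N - 1 := by
      rw [h] at h1
      exact (dvd_mul_left _ _).trans h1
    have h3 : 2 ∣ 2 ^ N := dvd_pow_self 2 (by omega)
    have h4 : 0 < 2 ^ N := by positivity
    omega
  obtain ⟨n, hn⟩ := hrN
  have hr3 : 3 ≤ cyc N 2 := by have := hr.two_le; omega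
  have hq' : 2 ≤ 2 ^ cyc N 2 := Nat.le_self_pow hr.ne_zero 2
  have hle := le_two_pow_sub_one (cyc N 2)
  rw [mul_comm] at hn
  by_cases hrn : cyc N 2 ∣ n
  · exfalso
    have h1 := cyc_mul_of_dvd (q := 2) le_rfl hr hrn
    rw [← hn] at h1
    have hn0 : n ≠ 0 := by rintro rfl; omega
    have hn1 : 1 < n := by have := Nat.le_of_dvd (by omega) hrn; omega
    have h2 := sub_one_pow_lt_cyc hq' hn1
    have h3 : 2 ^ cyc N 2 - 1 ≤ (2 ^ cyc N 2 - 1) ^ n.totient :=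
      Nat.le_self_pow (Nat.totient_pos.2 (by omega)).ne' _
    omega
  · have h1 := cyc_mul_of_not_dvd (q := 2) le_rfl hr hrn
    rw [← hn] at h1
    generalize cyc N 2 = r at *
    have hn0 : n ≠ 0 := by rintro rfl; omega
    obtain rfl | rfl | hn3 : n = 1 ∨ n = 2 ∨ 3 ≤ n := by omega
    · exfalso
      rw [cyc_one le_rfl, cyc_one hq'] at h1
      have : r - 1 < 2 ^ (r - 1) := Nat.lt_two_pow_self
      have h2 : 2 ^ r = 2 ^ (r - 1) * 2 := by rw [← pow_succ, Nat.sub_add_cancel (by omega)]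
      omega
    · rw [cyc_two le_rfl, cyc_two hq'] at h1
      obtain rfl | hr4 := hr3.eq_or_lt
      · exact hn
      exfalso
      obtain ⟨s, rfl⟩ := Nat.exists_eq_add_of_lt hr4
      have : s < 2 ^ s := Nat.lt_two_pow_self
      have h2 : 2 ^ (3 + s + 1) = 16 * 2 ^ s := by ring
      omega
    · exfalso
      have h2 := cyc_lt_add_one_pow (q := 2) le_rfl hn3
      have h3 := sub_one_pow_lt_cyc hq' (by omega : 1 < n)
      have h4 : 2 ≤ n.totient := by
        have h5 := Nat.totient_even (n := n) (by omega)
        have h6 := Nat.totient_pos.2 (by omega : 0 < n)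
        obtain ⟨u, hu⟩ := h5
        omega
      obtain ⟨u, hu⟩ := Nat.exists_eq_add_of_le h4
      rw [hu] at h2 h3
      have h5 : 3 * 3 ≤ 2 ^ r - 1 + 2 := by
        have : 2 ^ 3 ≤ 2 ^ r := Nat.pow_le_pow_right two_pos hr3
        omega
      have h6 : 9 * r ≤ (2 ^ r - 1) ^ 2 := by
        obtain ⟨s, rfl⟩ := Nat.exists_eq_add_of_le hr3
        have h7 : s < 2 ^ s := Nat.lt_two_pow_self
        have h8 : 2 ^ (3 + s) = 8 * 2 ^ s := by ring
        have h9 : 7 * (s + 1) ≤ 2 ^ (3 + s) - 1 := by omega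
        nlinarith
      have h7 : 3 ^ u ≤ (2 ^ r - 1) ^ u := Nat.pow_le_pow_left (by omega) u
      have h8 : r * (3 ^ 2 * 3 ^ u) ≤ (2 ^ r - 1) ^ 2 * (2 ^ r - 1) ^ u := by
        calc r * (3 ^ 2 * 3 ^ u) = 9 * r * 3 ^ u := by ring
          _ ≤ _ := Nat.mul_le_mul h6 h7
      rw [pow_add] at h2 h3
      have h9 : r * cyc n 2 ≤ r * (3 ^ 2 * 3 ^ u) := Nat.mul_le_mul_left r h2.le
      omega

/-- A primitive prime power divisor of `q ^ b + 1`. -/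
theorem exists_primMod_two_mul {q b : ℕ} (hq : 2 ≤ q) (hb : 0 < b) :
    ∃ R, IsPrimePow R ∧ R ∣ q ^ b + 1 ∧ PrimMod q R (2 * b) := by
  rcases exists_primMod_or_prime_cyc hq (by omega : 1 < 2 * b) with ⟨R, hR, hRc, hRp⟩ | ⟨hr, hrN⟩
  · refine ⟨R, hR, hRc.trans ?_, hRp⟩
    have := cyc_dvd_geom hq hb one_lt_two (mul_comm 2 b)
    simpa [Finset.sum_range_succ, add_comm] using this
  · obtain ⟨rfl, hb3⟩ := eq_of_prime_cyc hq (by omega) hr hrN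
    obtain rfl : b = 3 := by omega
    refine ⟨9, ?_, by norm_num, fun k hk => ?_⟩
    · exact (isPrimePow_nat_iff 9).2 ⟨3, 2, Nat.prime_three, two_pos, by norm_num⟩
    · rw [dvd_pow_sub_one_iff two_pos] at hk
      have h6 : orderOf ((2 : ℕ) : ZMod 9) = 6 := by
        rw [orderOf_eq_iff (by norm_num)]
        refine ⟨by decide, ?_⟩
        intro m hm hm0
        interval_cases m <;> decide
      have := orderOf_dvd_of_pow_eq_one hk
      rwa [h6] at this

/-- A primitive prime power divisor of `(q ^ N - 1) / (q - 1)`, for odd `N`. -/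
theorem exists_primMod_odd {q c : ℕ} (hq : 2 ≤ q) (hc : 0 < c) :
    ∃ R, IsPrimePow R ∧ R ∣ ∑ i ∈ Finset.range (2 * c + 1), q ^ i ∧ PrimMod q R (2 * c + 1) := by
  rcases exists_primMod_or_prime_cyc hq (by omega : 1 < 2 * c + 1) with
    ⟨R, hR, hRc, hRp⟩ | ⟨hr, hrN⟩
  · refine ⟨R, hR, hRc.trans ?_, hRp⟩
    simpa using cyc_dvd_geom hq one_pos (by omega : 1 < 2 * c + 1) (one_mul _).symm
  · have := (eq_of_prime_cyc hq (by omega) hr hrN).2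
    omega

end Cyclotomic

section Semidirect

variable {K W G : Type*} [Field K] [AddCommGroup W] [Module K W] [Group G]

theorem mk_pow_semidirect (ρ : G →* (W ≃ₗ[K] W)) (w : W) (g : G) (k : ℕ) :
    (⟨Multiplicative.ofAdd w, g⟩ : SemidirectProduct (Multiplicative W) G
      ((linearToMulAut K W).comp ρ)) ^ k =
      ⟨Multiplicative.ofAdd (∑ i ∈ Finset.range k, ρ (g ^ i) w), g ^ k⟩ := by
  induction k with
  | zero => ext <;> simp
  | succ k ih =>
    rw [pow_succ, ih, SemidirectProduct.mul_def, Finset.sum_range_succ, ofAdd_add, pow_succ]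
    rfl

theorem mul_mem_groupSpectrum_semidirect {p : ℕ} (hp : p.Prime) [CharP K p]
    (ρ : G →* (W ≃ₗ[K] W)) {g : G} {k : ℕ} (hk : orderOf g = k) (hk0 : 0 < k)
    (h : ∃ w, ∑ i ∈ Finset.range k, ρ (g ^ i) w ≠ 0) :
    p * k ∈ groupSpectrum (SemidirectProduct (Multiplicative W) G
      ((linearToMulAut K W).comp ρ)) := by
  obtain ⟨w, hw⟩ := h
  let x : SemidirectProduct (Multiplicative W) G ((linearToMulAut K W).comp ρ) :=
    ⟨Multiplicative.ofAdd w, g⟩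
  refine ⟨x, ?_⟩
  set v := ∑ i ∈ Finset.range k, ρ (g ^ i) w with hv
  have hx : x ^ k = SemidirectProduct.inl (Multiplicative.ofAdd v) := by
    rw [mk_pow_semidirect, ← hk, pow_orderOf_eq_one, hk]
    rfl
  have hkx : k ∣ orderOf x := hk ▸ orderOf_map_dvd SemidirectProduct.rightHom x
  have ho : orderOf (x ^ k) = p := by
    have : Fact p.Prime := ⟨hp⟩
    rw [hx, orderOf_injective _ SemidirectProduct.inl_injective]
    refine orderOf_eq_prime ?_ fun h => hw (ofAdd_eq_one.1 h)
    rw [← ofAdd_nsmul, ofAdd_eq_one, ← Nat.cast_smul_eq_nsmul K, CharP.cast_eq_zero, zero_smul]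
  rw [orderOf_pow' x hk0.ne', Nat.gcd_eq_right hkx] at ho
  rw [← ho, Nat.div_mul_cancel hkx]

theorem groupSpectrum_semidirect_ne {p : ℕ} (hp : p.Prime) [CharP K p]
    (ρ : G →* (W ≃ₗ[K] W)) {g : G} {k : ℕ} (hk : orderOf g = k) (hk0 : 0 < k)
    (h : ∃ w, ∑ i ∈ Finset.range k, ρ (g ^ i) w ≠ 0) (h' : ∀ x : G, orderOf x ≠ p * k) :
    groupSpectrum (SemidirectProduct (Multiplicative W) G ((linearToMulAut K W).comp ρ)) ≠
      groupSpectrum G := by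
  intro he
  obtain ⟨x, hx⟩ := he ▸ mul_mem_groupSpectrum_semidirect hp ρ hk hk0 h
  exact h' x hx

end Semidirect

section Assembly

variable {F : Type*} [Field F] [Fintype F] {K W : Type*} [Field K] [AddCommGroup W] [Module K W]
  [Nontrivial W] {p q : ℕ} [Fact p.Prime] [CharP F p] [CharP K p]

theorem groupSpectrum_ne_of_odd {b : ℕ} (hb : 2 ≤ b) (hF : Fintype.card F = q) (hpq : p ∣ q)
    (ρ : Matrix.ProjectiveSpecialLinearGroup (Fin (2 * b + 1)) F →* (W ≃ₗ[K] W)) :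
    groupSpectrum (SemidirectProduct (Multiplicative W) _ ((linearToMulAut K W).comp ρ)) ≠
      groupSpectrum (Matrix.ProjectiveSpecialLinearGroup (Fin (2 * b + 1)) F) := by
  have hp : p.Prime := Fact.out
  have hq : 2 ≤ q := hF ▸ Fintype.one_lt_card
  have : CharP (AlgebraicClosure F) p :=
    charP_of_injective_algebraMap (algebraMap F (AlgebraicClosure F)).injective p
  obtain ⟨R, hR, hRq, hRe⟩ := exists_primMod_two_mul hq (b := b) (by omega)
  obtain ⟨s, D, hD, hn, hs, hc, ho⟩ :=
    exists_torus_odd (Ω := AlgebraicClosure F) hF hRe hRq (by omega) hpq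
  have hpR := not_dvd_of_coprime hp hpq (coprime_of_dvd_pow_add_one hRq (by omega))
  refine groupSpectrum_semidirect_ne hp ρ ho hR.pos ?_ ?_
  · simpa using GoodTorus.exists_sum_apply_ne_zero (by omega)
      (ρ.comp (QuotientGroup.mk' _)) hD hn hs hc hpR
  · intro x
    obtain ⟨x, rfl⟩ := QuotientGroup.mk_surjective x
    exact orderOf_mk_ne x hpR hR dvd_rfl (hF ▸ hRe) (by omega) (by omega)

theorem groupSpectrum_ne_of_even {b c : ℕ} (hc : 0 < c) (hbc : b = c ∨ b = c + 1)
    (hF : Fintype.card F = q) (hpq : p ∣ q)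
    (ρ : Matrix.ProjectiveSpecialLinearGroup (Fin (2 * b + 1 + (2 * c + 1))) F →* (W ≃ₗ[K] W)) :
    groupSpectrum (SemidirectProduct (Multiplicative W) _ ((linearToMulAut K W).comp ρ)) ≠
      groupSpectrum
        (Matrix.ProjectiveSpecialLinearGroup (Fin (2 * b + 1 + (2 * c + 1))) F) := by
  have hp : p.Prime := Fact.out
  have hq : 2 ≤ q := hF ▸ Fintype.one_lt_card
  have : CharP (AlgebraicClosure F) p :=
    charP_of_injective_algebraMap (algebraMap F (AlgebraicClosure F)).injective p
  obtain ⟨R, hR, hRq, hRe⟩ := exists_primMod_two_mul hq (b := b) (by omega)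
  obtain ⟨r, hr, hrq, hre⟩ := exists_primMod_odd hq hc
  obtain ⟨s, D, hD, hn, hs, hcard, ho⟩ :=
    exists_torus_even (Ω := AlgebraicClosure F) hF hRe hRq (by omega) hpq hre hrq hc hbc
  have hpR := not_dvd_of_coprime hp hpq (coprime_of_dvd_pow_add_one hRq (by omega))
  have hpr := not_dvd_of_coprime hp hpq (coprime_of_dvd_geom hrq)
  have hpk : ¬ p ∣ R.lcm r := fun h => by
    rcases hp.dvd_mul.1 (h.trans (Nat.lcm_dvd_mul R r)) with h | h
    exacts [hpR h, hpr h]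
  have hef : (2 * b).Coprime (2 * c + 1) := by
    rcases hbc with rfl | rfl
    · simp
    · rw [show 2 * (c + 1) = 2 * c + 1 + 1 by ring]
      simp
  refine groupSpectrum_semidirect_ne hp ρ ho (Nat.lcm_pos hR.pos hr.pos) ?_ ?_
  · simpa using GoodTorus.exists_sum_apply_ne_zero (N := 2 * b + 1 + 2 * c) (by omega)
      (ρ.comp (QuotientGroup.mk' _)) hD hn hs hcard hpk
  · intro x
    obtain ⟨x, rfl⟩ := QuotientGroup.mk_surjective x
    exact orderOf_mk_ne_of_add x hpk hR (Nat.dvd_lcm_left _ _) (hF ▸ hRe) (by omega) hr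
      (Nat.dvd_lcm_right _ _) (hF ▸ hre) (by omega) hef (by omega)

theorem groupSpectrum_ne_of_four (hp2 : p ≠ 2) (hF : Fintype.card F = p)
    (ρ : Matrix.ProjectiveSpecialLinearGroup (Fin 4) F →* (W ≃ₗ[K] W)) :
    groupSpectrum (SemidirectProduct (Multiplicative W) _ ((linearToMulAut K W).comp ρ)) ≠
      groupSpectrum (Matrix.ProjectiveSpecialLinearGroup (Fin 4) F) := by
  have hp : p.Prime := Fact.out
  have : CharP (AlgebraicClosure F) p :=
    charP_of_injective_algebraMap (algebraMap F (AlgebraicClosure F)).injective p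
  obtain ⟨a, rfl⟩ := hp.odd_of_ne_two hp2
  obtain ⟨k, hk⟩ : ∃ k, (2 * a + 1) ^ 2 + 1 = 2 * k := ⟨2 * a ^ 2 + 2 * a + 1, by ring⟩
  obtain ⟨R, hR, hRq, hRe⟩ := exists_primMod_two_mul hp.two_le (b := 2) (by omega)
  obtain ⟨s, x, y, hx, hy, hn, hs, hxk, ho⟩ :=
    exists_torus_four (Ω := AlgebraicClosure F) hF hk
  have hpk : ¬ 2 * a + 1 ∣ k := fun h => hp.one_lt.ne' <| Nat.dvd_one.1 <|
    (Nat.dvd_add_right (dvd_pow_self _ two_ne_zero)).1 (hk ▸ h.mul_left 2)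
  have hle : 2 * a + 1 ≤ k := by nlinarith [hp.two_le]
  have hR2 : R.Coprime 2 := by
    obtain ⟨r, t, hr, ht, rfl⟩ := (isPrimePow_nat_iff R).1 hR
    refine Nat.Coprime.pow_left t ((Nat.coprime_primes hr Nat.prime_two).2 ?_)
    rintro rfl
    obtain ht | rfl : 2 ≤ t ∨ t = 1 := by omega
    · have h4 : 4 ∣ (2 * a + 1) ^ 2 + 1 := (pow_dvd_pow 2 ht).trans hRq
      rw [show (2 * a + 1) ^ 2 + 1 = 4 * (a ^ 2 + a) + 2 by ring] at h4
      omega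
    · have := Nat.le_of_dvd one_pos (hRe 1 (by simp))
      omega
  let z : Matrix.SpecialLinearGroup (Fin 4) F := ⟨-1, by simp [Matrix.det_neg]; norm_num⟩
  have hz : (QuotientGroup.mk z : Matrix.ProjectiveSpecialLinearGroup (Fin 4) F) = 1 := by
    rw [← pow_one (QuotientGroup.mk z), mk_pow_eq_one_iff]
    exact ⟨-1, by rw [pow_one, map_neg, map_one]⟩
  refine groupSpectrum_semidirect_ne hp ρ ho (by omega) ?_ ?_
  · simpa using exists_sum_apply_ne_zero_of_four hp2 hF
      (ρ.comp (QuotientGroup.mk' _)) (z := z) rfl (by simp [hz]) hx hy hn hs hxk hpk hle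
  · intro x
    obtain ⟨x, rfl⟩ := QuotientGroup.mk_surjective x
    refine orderOf_mk_ne x hpk hR (hR2.dvd_of_dvd_mul_left (hk ▸ hRq)) (hF ▸ hRe) (by omega)
      (by omega)

end Assembly

section EvenFour

theorem coprime_one_add_pow {q j : ℕ} (hq : Even q) (hj : j < 4) (hj0 : j ≠ 0) :
    (1 + q ^ (j + 2)).Coprime (q ^ 2 + 1) := by
  refine Nat.coprime_of_dvd fun r hr h1 h2 => ?_
  rw [← ZMod.natCast_eq_zero_iff] at h1 h2
  push_cast at h1 h2
  have h : ((2 : ℕ) : ZMod r) = 0 := by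
    push_cast
    interval_cases j
    · exact absurd rfl hj0
    · linear_combination h2 + (1 + (q : ZMod r)) * (h1 - q * h2)
    · linear_combination h1 - ((q : ZMod r) ^ 2 - 1) * h2
    · linear_combination h2 - (q - 1 : ZMod r) * (h1 - q * (q ^ 2 - 1) * h2)
  rw [ZMod.natCast_eq_zero_iff, Nat.prime_dvd_prime_iff_eq hr Nat.prime_two] at h
  subst h
  have hq0 : ((q : ℕ) : ZMod 2) = 0 := (ZMod.natCast_eq_zero_iff _ _).2 hq.two_dvd
  simp [hq0] at h2

theorem eq_one_of_geom_sum_eq_zero {A : Type*} [Ring A] [CharP A 2] {q : ℕ} (hq : Even q) {t u : A}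
    (h : u * t = t ^ q * u) (ht : t ^ (q ^ 2 + 1) = 1) (hu : ∑ j ∈ Finset.range 4, u ^ j = 0) :
    t = 1 := by
  have hcomm : ∀ j k, u ^ j * t ^ k = t ^ (q ^ j * k) * u ^ j := by
    have h1 : ∀ k, u * t ^ k = t ^ (q * k) * u := fun k => by
      rw [pow_mul]
      exact (show SemiconjBy u t (t ^ q) from h).pow_right k
    intro j
    induction j with
    | zero => simp
    | succ j ih =>
      intro k
      rw [pow_succ, mul_assoc, h1, ← mul_assoc, ih, mul_assoc, pow_succ, mul_assoc]
  have hl : ((q ^ 2 + 1 : ℕ) : A) = 1 := by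
    have hq0 : ((q : ℕ) : A) = 0 := (CharP.cast_eq_zero_iff A 2 q).2 hq.two_dvd
    simp [hq0]
  let S : ℕ → A := fun j => ∑ i ∈ Finset.range (q ^ 2 + 1), (t ^ (1 + q ^ (j + 2))) ^ i
  have hS0 : S 0 = 1 := by
    simp only [S]
    rw [show 1 + q ^ (0 + 2) = q ^ 2 + 1 by ring, ht]
    simpa using hl
  have hS : ∀ j < 4, j ≠ 0 → (t - 1) * S j = 0 := by
    intro j hj hj0
    obtain ⟨m, hm⟩ := exists_pow_eq_self_of_coprime (x := t)
      ((coprime_one_add_pow hq hj hj0).coprime_dvd_right (orderOf_dvd_of_pow_eq_one ht))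
    have h1 : (∑ i ∈ Finset.range m, (t ^ (1 + q ^ (j + 2))) ^ i) * (t ^ (1 + q ^ (j + 2)) - 1) =
        t - 1 := by rw [geom_sum_mul, hm]
    rw [← h1, mul_assoc, mul_geom_sum, ← pow_mul, mul_comm (1 + _), pow_mul, ht, one_pow, sub_self,
      mul_zero]
  have hsum : ∑ j ∈ Finset.range 4, S j * u ^ j = 0 := by
    have h2 : ∀ j, S j * u ^ j =
        ∑ i ∈ Finset.range (q ^ 2 + 1), t ^ i * u ^ j * t ^ (q ^ 2 * i) := by
      intro j
      simp only [S]
      rw [Finset.sum_mul]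
      refine Finset.sum_congr rfl fun i _ => ?_
      rw [mul_assoc (t ^ i), hcomm, ← mul_assoc, ← pow_add, ← pow_mul]
      congr 2
      ring
    simp_rw [h2]
    rw [Finset.sum_comm]
    simp_rw [← Finset.sum_mul, ← Finset.mul_sum, hu]
    simp
  have h3 := congrArg ((t - 1) * ·) hsum
  simp only [Finset.sum_range_succ, Finset.sum_range_zero, zero_add, mul_add, ← mul_assoc, hS0,
    hS 1 (by omega) (by omega), hS 2 (by omega) (by omega), hS 3 (by omega) (by omega)] at h3
  simpa [sub_eq_zero] using h3

end EvenFour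

section EvenFourMatrices

variable {F : Type*} [Field F] [Fintype F]

theorem coprime_sub_one_sq_add_one {q : ℕ} (hq : Even q) (hq2 : 2 ≤ q) :
    (q - 1).Coprime (q ^ 2 + 1) := by
  obtain ⟨a, rfl⟩ : ∃ a, q = a + 1 := ⟨q - 1, by omega⟩
  have h : (a + 1) ^ 2 + 1 = 2 + a * (a + 2) := by ring
  rw [Nat.add_sub_cancel, h, Nat.coprime_add_mul_left_right, Nat.coprime_two_right]
  by_contra h'
  rw [Nat.not_odd_iff_even] at h'
  exact (Nat.not_even_iff_odd.2 (h'.add_one)) hq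

theorem even_card_of_charP_two {q : ℕ} [CharP F 2] (hF : Fintype.card F = q) : Even q := by
  obtain ⟨n, -, hn⟩ := FiniteField.card F 2
  rw [← hF, hn]
  exact Nat.even_pow.2 ⟨even_two, n.ne_zero⟩

theorem eq_one_of_pow_eq_one {q k : ℕ} (hF : Fintype.card F = q) (h : (q - 1).Coprime k) {c : F}
    (hc0 : c ≠ 0) (hc : c ^ k = 1) : c = 1 := by
  have h1 := orderOf_dvd_of_pow_eq_one (hF ▸ FiniteField.pow_card_sub_one_eq_one c hc0)
  have h2 := orderOf_dvd_of_pow_eq_one hc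
  exact orderOf_eq_one_iff.1 (Nat.eq_one_of_dvd_coprimes h h1 h2)

theorem eq_one_of_pow_four_eq_one [CharP F 2] {c : F} (hc : c ^ 4 = 1) : c = 1 := by
  simpa using (ExpChar.pow_prime_pow_mul_eq_one_iff 2 2 1 c).1 (by simpa using hc)

theorem exists_normalized_torus {q : ℕ} [CharP F 2] (hF : Fintype.card F = q) :
    ∃ s u : Matrix.SpecialLinearGroup (Fin 4) F, orderOf s = q ^ 2 + 1 ∧ u ^ 4 = 1 ∧
      u * s = s ^ q * u := by
  classical
  have hq2 : 2 ≤ q := hF ▸ Fintype.one_lt_card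
  have hq := even_card_of_charP_two hF
  let E := FiniteField.Extension F 2 4
  have : Fintype E := Fintype.ofFinite E
  have hE : Fintype.card E = q ^ 4 := by
    rw [← Nat.card_eq_fintype_card, FiniteField.natCard_extension, Nat.card_eq_fintype_card, hF]
  let b : Module.Basis (Fin 4) F E :=
    Module.finBasisOfFinrankEq F E (FiniteField.finrank_extension F 2 4)
  let Φ := LinearMap.toMatrixAlgEquiv b
  obtain ⟨θ, hθ⟩ : ∃ θ : Eˣ, orderOf θ = q ^ 2 + 1 := by
    obtain ⟨g, hg⟩ := IsCyclic.exists_generator (α := Eˣ)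
    have hc : orderOf g = (q ^ 2 + 1) * (q ^ 2 - 1) := by
      rw [orderOf_eq_card_of_forall_mem_zpowers hg, Nat.card_eq_fintype_card, Fintype.card_units,
        hE, ← Nat.sq_sub_sq, ← pow_mul, one_pow]
    have h4 : 2 ^ 2 ≤ q ^ 2 := Nat.pow_le_pow_left hq2 2
    refine ⟨g ^ (q ^ 2 - 1), ?_⟩
    rw [orderOf_pow' g (by omega), hc, Nat.gcd_eq_right (Dvd.intro_left _ rfl),
      Nat.mul_div_cancel _ (by omega)]
  let T : Matrix (Fin 4) (Fin 4) F := Φ (Algebra.lmul F E θ)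
  let U : Matrix (Fin 4) (Fin 4) F := Φ (FiniteField.frobeniusAlgHom F E).toLinearMap
  have hT : ∀ k, T ^ k = Φ (Algebra.lmul F E ((θ ^ k : Eˣ) : E)) := fun k => by
    simp only [T, ← map_pow, Units.val_pow_eq_pow_val]
  have hTord : T ^ (q ^ 2 + 1) = 1 := by
    rw [hT, ← hθ, pow_orderOf_eq_one, Units.val_one, map_one, map_one]
  have hU : U ^ 4 = 1 := by
    rw [← map_pow, ← map_one Φ]
    congr 1
    ext x
    rw [Module.End.pow_apply]
    change (⇑(FiniteField.frobeniusAlgHom F E))^[4] x = x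
    rw [FiniteField.coe_frobeniusAlgHom, pow_iterate, hF, ← hE]
    exact FiniteField.pow_card x
  have hTU : U * T = T ^ q * U := by
    rw [hT, ← map_mul, ← map_mul]
    congr 1
    ext x
    simp [hF, mul_pow]
  have hTdet : T.det = 1 := by
    have h : T.det ^ (q ^ 2 + 1) = 1 := by rw [← Matrix.det_pow, hTord, Matrix.det_one]
    exact eq_one_of_pow_eq_one hF (coprime_sub_one_sq_add_one hq hq2)
      (fun h0 => by simp [h0] at h) h
  have hUdet : U.det = 1 := by
    have h : U.det ^ 4 = 1 := by rw [← Matrix.det_pow, hU, Matrix.det_one]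
    exact eq_one_of_pow_four_eq_one h
  refine ⟨⟨T, hTdet⟩, ⟨U, hUdet⟩, ?_, Subtype.ext ?_, Subtype.ext ?_⟩
  · rw [← hθ]
    refine orderOf_eq_orderOf_iff.2 fun k => ?_
    refine Subtype.ext_iff.trans ?_
    change T ^ k = 1 ↔ _
    rw [hT, ← Units.val_inj, Units.val_one, ← map_one Φ, Φ.injective.eq_iff,
      ← map_one (Algebra.lmul F E), Algebra.lmul_injective.eq_iff]
  · exact hU
  · exact hTU

theorem mk_pow_four_eq_one [CharP F 2] {h : Matrix.SpecialLinearGroup (Fin 4) F}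
    (hh : (QuotientGroup.mk h : Matrix.ProjectiveSpecialLinearGroup (Fin 4) F) ^ 8 = 1) :
    (QuotientGroup.mk h : Matrix.ProjectiveSpecialLinearGroup (Fin 4) F) ^ 4 = 1 := by
  classical
  obtain ⟨c, hc⟩ := (mk_pow_eq_one_iff h 8).1 hh
  obtain ⟨d, rfl⟩ : ∃ d, d ^ 2 ^ 3 = c := by
    have := (bijective_iterateFrobenius (R := F) 2 3).2 c
    simpa [iterateFrobenius_def] using this
  have hcomm : Commute h.1 (Matrix.scalar (Fin 4) d) :=
    (Matrix.scalar_commute d (Commute.all _) h.1).symm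
  have hN : (h.1 - Matrix.scalar (Fin 4) d) ^ 2 ^ 3 = 0 := by
    rw [sub_pow_char_pow_of_commute 2 3 hcomm, ← map_pow, ← hc]
    exact sub_self _
  have hchar := (Matrix.isNilpotent_charpoly_sub_pow_of_isNilpotent ⟨_, hN⟩).eq_zero
  have h4 : (h.1 - Matrix.scalar (Fin 4) d) ^ 2 ^ 2 = 0 := by
    have := Matrix.aeval_self_charpoly (h.1 - Matrix.scalar (Fin 4) d)
    rw [sub_eq_zero.1 hchar] at this
    simpa using this
  rw [sub_pow_char_pow_of_commute 2 2 hcomm, sub_eq_zero, ← map_pow] at h4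
  exact (mk_pow_eq_one_iff h 4).2 ⟨_, h4⟩

end EvenFourMatrices

section EvenFourAssembly

variable {F : Type*} [Field F] [Fintype F] {K W : Type*} [Field K] [AddCommGroup W] [Module K W]
  [Nontrivial W] {q : ℕ} [CharP F 2] [CharP K 2]

theorem groupSpectrum_ne_of_four_even (hF : Fintype.card F = q)
    (ρ : Matrix.ProjectiveSpecialLinearGroup (Fin 4) F →* (W ≃ₗ[K] W)) :
    groupSpectrum (SemidirectProduct (Multiplicative W) _ ((linearToMulAut K W).comp ρ)) ≠
      groupSpectrum (Matrix.ProjectiveSpecialLinearGroup (Fin 4) F) := by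
  have hp : Nat.Prime 2 := Nat.prime_two
  have hq2 : 2 ≤ q := hF ▸ Fintype.one_lt_card
  have hq := even_card_of_charP_two hF
  obtain ⟨s, u, hs, hu, hsu⟩ := exists_normalized_torus (q := q) hF
  let S : Matrix.ProjectiveSpecialLinearGroup (Fin 4) F := QuotientGroup.mk s
  let U : Matrix.ProjectiveSpecialLinearGroup (Fin 4) F := QuotientGroup.mk u
  have hU : U ^ 4 = 1 := by rw [← QuotientGroup.mk_pow, hu, QuotientGroup.mk_one]
  have h2 : ∀ w : W, w + w = 0 := fun w => by
    rw [← two_nsmul, ← Nat.cast_smul_eq_nsmul K, CharP.cast_eq_zero, zero_smul]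
  by_cases hsum : ∃ w, ∑ i ∈ Finset.range 4, ρ (U ^ i) w ≠ 0
  · refine groupSpectrum_semidirect_ne hp ρ (g := U) (k := 4) ?_ (by norm_num) hsum ?_
    · refine orderOf_eq_prime_pow (p := 2) (n := 1) (fun h => ?_) hU
      obtain ⟨w, hw⟩ := hsum
      rw [pow_one] at h
      refine hw ?_
      rw [Finset.sum_range_succ, Finset.sum_range_succ, Finset.sum_range_succ,
        Finset.sum_range_one, pow_succ U 2, h, pow_zero, pow_one, one_mul, add_assoc, add_assoc,
        add_left_comm (ρ U w), ← add_assoc, h2, h2, add_zero]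
    · intro x hx
      obtain ⟨x, rfl⟩ := QuotientGroup.mk_surjective x
      have h8 := mk_pow_four_eq_one (hx ▸ pow_orderOf_eq_one _)
      have := Nat.le_of_dvd (by norm_num) (hx ▸ orderOf_dvd_of_pow_eq_one h8)
      omega
  · push Not at hsum
    have hEnd : CharP (Module.End K W) 2 :=
      charP_of_injective_algebraMap (algebraMap K (Module.End K W)).injective 2
    let φ : Matrix.ProjectiveSpecialLinearGroup (Fin 4) F →* Module.End K W :=
      LinearEquiv.automorphismGroup.toLinearMapMonoidHom.comp ρ
    have hφ : ∀ g w, φ g w = ρ g w := fun _ _ => rfl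
    have hφS : φ S = 1 := by
      refine eq_one_of_geom_sum_eq_zero hq (u := φ U) ?_ ?_ ?_
      · rw [← map_pow, ← map_mul, ← map_mul]
        congr 1
        rw [← QuotientGroup.mk_mul, hsu, QuotientGroup.mk_mul, QuotientGroup.mk_pow]
      · rw [← map_pow, ← QuotientGroup.mk_pow, ← hs, pow_orderOf_eq_one, QuotientGroup.mk_one,
          map_one]
      · ext w
        rw [LinearMap.sum_apply]
        simp_rw [← map_pow, hφ]
        exact hsum w
    have hord : orderOf S = q ^ 2 + 1 := by
      rw [← hs]
      refine orderOf_eq_orderOf_iff.2 fun k => ⟨fun h => ?_, fun h => ?_⟩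
      · obtain ⟨c, hc⟩ := (mk_pow_eq_one_iff s k).1 h
        have h1 : c ^ 4 = 1 := by
          have := (s ^ k).2
          rw [hc, Matrix.scalar_apply, Matrix.det_diagonal] at this
          simpa using this
        exact Subtype.ext (by rw [hc, eq_one_of_pow_four_eq_one h1, map_one]; rfl)
      · rw [← QuotientGroup.mk_pow, h, QuotientGroup.mk_one]
    have hpk : ¬ 2 ∣ q ^ 2 + 1 := by
      rw [← even_iff_two_dvd, Nat.even_add_one, not_not]
      exact hq.pow_of_ne_zero two_ne_zero
    obtain ⟨R, hR, hRq, hRe⟩ := exists_primMod_two_mul hq2 (b := 2) (by omega)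
    refine groupSpectrum_semidirect_ne hp ρ hord (by omega) ?_ ?_
    · obtain ⟨w, hw⟩ := exists_ne (0 : W)
      refine ⟨w, ?_⟩
      simp_rw [← hφ, map_pow, hφS, one_pow, Module.End.one_apply]
      rw [Finset.sum_const, Finset.card_range, ← Nat.cast_smul_eq_nsmul K]
      exact smul_ne_zero (fun h => hpk ((CharP.cast_eq_zero_iff K 2 _).1 h)) hw
    · intro x
      obtain ⟨x, rfl⟩ := QuotientGroup.mk_surjective x
      exact orderOf_mk_ne x hpk hR hRq (hF ▸ hRe) (by omega) (by omega)

end EvenFourAssembly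

end PSLSpec

/-- If the simple group `L = PSL_n(q)`, `q = p^m`, with `n ≥ 5`, or `n = 4` and `q` prime,
or `n = 4` and `q` even, acts linearly on a nonzero vector space `W` over a field `K` of
characteristic `p`, then the spectrum of `W ⋊ L` differs from the spectrum of `L`. -/
theorem spectrum_semidirectProduct_ne_spectrum_PSL
    (p m q n : ℕ) (hp : p.Prime) (hm : 0 < m) (hq : q = p ^ m)
    (hn : 5 ≤ n ∨ (n = 4 ∧ q.Prime) ∨ (n = 4 ∧ Even q))
    (F : Type*) [Field F] [Fintype F] (hF : Fintype.card F = q)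
    (K : Type*) [Field K] [CharP K p]
    (W : Type*) [AddCommGroup W] [Module K W] [Nontrivial W]
    (ρ : Matrix.ProjectiveSpecialLinearGroup (Fin n) F →* (W ≃ₗ[K] W)) :
    groupSpectrum (SemidirectProduct (Multiplicative W)
        (Matrix.ProjectiveSpecialLinearGroup (Fin n) F) ((linearToMulAut K W).comp ρ)) ≠
      groupSpectrum (Matrix.ProjectiveSpecialLinearGroup (Fin n) F) := by
  have : Fact p.Prime := ⟨hp⟩
  have hpq : p ∣ q := hq ▸ dvd_pow_self p hm.ne'
  have hcharF : CharP F p := by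
    obtain ⟨r, hr⟩ := CharP.exists F
    obtain ⟨k, hrp, hk⟩ := FiniteField.card F r
    have h : p ∣ r := hp.dvd_of_dvd_pow (hk ▸ hF ▸ hpq)
    rwa [(Nat.prime_dvd_prime_iff_eq hp hrp).1 h]
  by_cases hn4 : n = 4
  · subst hn4
    by_cases hp2 : p = 2
    · subst hp2
      exact PSLSpec.groupSpectrum_ne_of_four_even hF ρ
    · refine PSLSpec.groupSpectrum_ne_of_four hp2 (hF.trans ?_) ρ
      rcases hn with h | ⟨-, h⟩ | ⟨-, h⟩
      · omega
      · exact ((Nat.prime_dvd_prime_iff_eq hp h).1 hpq).symm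
      · exact absurd ((Nat.prime_dvd_prime_iff_eq Nat.prime_two hp).1
          (Nat.prime_two.dvd_of_dvd_pow (hq ▸ h.two_dvd))).symm hp2
  · have h5 : 5 ≤ n := by omega
    obtain ⟨b, rfl⟩ | ⟨b, c, hc, hbc, rfl⟩ : (∃ b, n = 2 * b + 1) ∨
        ∃ b c, 0 < c ∧ (b = c ∨ b = c + 1) ∧ n = 2 * b + 1 + (2 * c + 1) := by
      rcases Nat.even_or_odd' n with ⟨a, rfl | rfl⟩
      · exact Or.inr ⟨a / 2, (a - 1) / 2, by omega, by omega, by omega⟩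
      · exact Or.inl ⟨a, rfl⟩
    · exact PSLSpec.groupSpectrum_ne_of_odd (by omega) hF hpq ρ
    · exact PSLSpec.groupSpectrum_ne_of_even hc hbc hF hpq ρ
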